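/- The space Q_m^{tr}(BC_N) of trigonometric quasi-invariants of type BC_N is a free module of rank 2^N·N! over the ring ℂ[x_1,…,x_N]^{W(B_N)} of invariants of the hyperoctahedral group. -/

import Mathlib

open MvPolynomial

noncomputable section

/-- Substitution `x ↦ x + v` on polynomials. -/
def shiftPoly {n : ℕ} (v : Fin n → ℂ) (p : MvPolynomial (Fin n) ℂ) :
    MvPolynomial (Fin n) ℂ :=
  MvPolynomial.aeval (fun i => MvPolynomial.X i + MvPolynomial.C (v i)) p

/-- `σ_j`: negation of the `j`-th coordinate. -/
def sigmaP {n : ℕ} (j : Fin n) (p : MvPolynomial (Fin n) ℂ) : MvPolynomial (Fin n) ℂ :=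
  MvPolynomial.aeval
    (fun k => if k = j then -(MvPolynomial.X j) else (MvPolynomial.X k : MvPolynomial (Fin n) ℂ)) p

/-- `τ_{ij}`: transposition of the `i`-th and `j`-th coordinates. -/
def swapP {n : ℕ} (i j : Fin n) (p : MvPolynomial (Fin n) ℂ) : MvPolynomial (Fin n) ℂ :=
  MvPolynomial.aeval
    (fun k => if k = i then MvPolynomial.X j
      else if k = j then MvPolynomial.X i else (MvPolynomial.X k : MvPolynomial (Fin n) ℂ)) p

/-- `ρ_{ij}`: swap of the `i`-th and `j`-th coordinates combined with negating both. -/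
def rhoP {n : ℕ} (i j : Fin n) (p : MvPolynomial (Fin n) ℂ) : MvPolynomial (Fin n) ℂ :=
  MvPolynomial.aeval
    (fun k => if k = i then -(MvPolynomial.X j)
      else if k = j then -(MvPolynomial.X i) else (MvPolynomial.X k : MvPolynomial (Fin n) ℂ)) p

/-- The trigonometric quasi-invariants of type `BC_N`. -/
def QtrBC (N : ℕ) (m1 m2 m3 : ℕ) : Set (MvPolynomial (Fin N) ℂ) :=
  {p | (∀ j : Fin N, ∀ s : ℕ, 1 ≤ s → s ≤ m1 →
          MvPolynomial.X j ∣
            shiftPoly (Pi.single j ((s : ℂ))) p - shiftPoly (Pi.single j (-(s : ℂ))) p) ∧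
       (∀ j : Fin N, ∀ s : ℕ, 1 ≤ s → s ≤ m2 →
          MvPolynomial.X j ∣
            shiftPoly (Pi.single j ((s : ℂ) - 1/2)) p
              - shiftPoly (Pi.single j (-((s : ℂ) - 1/2))) p) ∧
       (∀ i j : Fin N, i ≠ j → ∀ s : ℕ, 1 ≤ s → s ≤ m3 →
          ((MvPolynomial.X i - MvPolynomial.X j) ∣
            shiftPoly (Pi.single i ((s : ℂ))) p - shiftPoly (Pi.single j ((s : ℂ))) p) ∧
          ((MvPolynomial.X i + MvPolynomial.X j) ∣
            shiftPoly (Pi.single i (-(s : ℂ))) p - shiftPoly (Pi.single j ((s : ℂ))) p))}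

/-- The `B_N` quasi-invariants `Q_{m̃}` with multiplicity `m̃(e_i) = m_1 + m_2`,
`m̃(e_i ± e_j) = m_3`. -/
def QtildeBC (N : ℕ) (m1 m2 m3 : ℕ) : Set (MvPolynomial (Fin N) ℂ) :=
  {q | (∀ j : Fin N, MvPolynomial.X j ^ (2 * (m1 + m2)) ∣ q - sigmaP j q) ∧
       (∀ i j : Fin N, i ≠ j →
          ((MvPolynomial.X i - MvPolynomial.X j) ^ (2 * m3) ∣ q - swapP i j q) ∧
          ((MvPolynomial.X i + MvPolynomial.X j) ^ (2 * m3) ∣ q - rhoP i j q))}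


/-- Invariance under the hyperoctahedral group `W(B_N)` (equivalently, under its
generators: the sign changes `σ_j` and the transpositions `τ_{ij}`). -/
def BInv {N : ℕ} (p : MvPolynomial (Fin N) ℂ) : Prop :=
  (∀ j : Fin N, sigmaP j p = p) ∧ (∀ i j : Fin N, i ≠ j → swapP i j p = p)

section

/-- Coordinates, commuting partial derivatives and inverse differences indexed by a finite
set of signed indices. -/
structure SignedData (S R : Type) [Fintype S] [DecidableEq S] [CommRing R] [Algebra ℂ R] where
  neg : S → S
  neg_neg : ∀ a, neg (neg a) = a
  neg_ne : ∀ a, neg a ≠ a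
  x : S → R
  x_neg : ∀ a, x (neg a) = -x a
  d : S → Derivation ℂ R R
  d_neg : ∀ a, d (neg a) = -d a
  d_comm : ∀ a b f, d a (d b f) = d b (d a f)
  d_x : ∀ a b, d a (x b) = (if b = a then 1 else 0) - (if b = neg a then 1 else 0)
  w : S → S → R
  w_self : ∀ a, w a a = 0
  w_mul : ∀ a b, a ≠ b → w a b * (x a - x b) = 1
  m : ℕ
  k : ℕ

namespace SignedData

variable {S R : Type} [Fintype S] [DecidableEq S] [CommRing R] [Algebra ℂ R]
variable (Z : SignedData S R)

lemma neg_inj {a b : S} : Z.neg a = Z.neg b ↔ a = b :=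
  ⟨fun h => by rw [← Z.neg_neg a, h, Z.neg_neg], fun h => by rw [h]⟩

lemma neg_eq {a b : S} : Z.neg a = b ↔ a = Z.neg b :=
  ⟨fun h => by rw [← h, Z.neg_neg], fun h => by rw [h, Z.neg_neg]⟩

/-- The involution as an equivalence. -/
def negEquiv : S ≃ S := ⟨Z.neg, Z.neg, Z.neg_neg, Z.neg_neg⟩

lemma sum_neg {M : Type} [AddCommMonoid M] (f : S → M) : ∑ a, f (Z.neg a) = ∑ a, f a :=
  Equiv.sum_comp Z.negEquiv f

lemma w_unique {a b : S} (h : a ≠ b) {u : R} (hu : u * (Z.x a - Z.x b) = 1) : u = Z.w a b := by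
  have h1 := Z.w_mul a b h
  linear_combination u * (-h1) + Z.w a b * hu

lemma w_symm (a b : S) : Z.w b a = -Z.w a b := by
  by_cases h : a = b
  · subst h; simp [Z.w_self]
  · symm
    apply Z.w_unique (Ne.symm h)
    linear_combination Z.w_mul a b h

lemma w_neg_neg (a b : S) : Z.w (Z.neg a) (Z.neg b) = -Z.w a b := by
  by_cases h : a = b
  · subst h; simp [Z.w_self]
  · symm
    apply Z.w_unique (fun h' => h (Z.neg_inj.1 h'))
    rw [Z.x_neg, Z.x_neg]
    linear_combination Z.w_mul a b h

lemma w_neg_left (a b : S) : Z.w (Z.neg a) b = Z.w (Z.neg b) a := by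
  have := Z.w_neg_neg a (Z.neg b)
  rw [Z.neg_neg] at this
  rw [this, Z.w_symm a (Z.neg b)]

lemma three_term {a b c : S} (hab : a ≠ b) (hbc : b ≠ c) (hac : a ≠ c) :
    Z.w a b * Z.w b c = Z.w a c * (Z.w a b + Z.w b c) := by
  have h1 := Z.w_mul a b hab
  have h2 := Z.w_mul b c hbc
  have h3 := Z.w_mul a c hac
  linear_combination Z.w a b * Z.w b c * (-h3) + Z.w a c * Z.w b c * h1 + Z.w a c * Z.w a b * h2

/-- The sign pairing of two indices. -/
def g (a b : S) : R := (if b = a then 1 else 0) - (if b = Z.neg a then 1 else 0)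

lemma d_x' (a b : S) : Z.d a (Z.x b) = Z.g a b := Z.d_x a b

lemma d_w (c a b : S) : Z.d c (Z.w a b) = -Z.w a b ^ 2 * (Z.g c a - Z.g c b) := by
  by_cases h : a = b
  · subst h; simp [Z.w_self]
  · have h1 := Z.w_mul a b h
    have h2 := congrArg (Z.d c) h1
    rw [Derivation.leibniz, map_sub, Z.d_x', Z.d_x', Derivation.map_one_eq_zero] at h2
    simp only [smul_eq_mul] at h2
    linear_combination Z.w a b * h2 - Z.d c (Z.w a b) * h1

/-- Coupling constants. -/
def κ (a b : S) : R := if b = a then 0 else if b = Z.neg a then 2 * (Z.m : R) else (Z.k : R)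

/-- Length correction. -/
def h (a b : S) : R := if b = Z.neg a then 2 else 1

lemma κ_self (a : S) : Z.κ a a = 0 := by simp [κ]

lemma κ_neg (a : S) : Z.κ a (Z.neg a) = 2 * (Z.m : R) := by simp [κ, Z.neg_ne]

lemma κ_gen {a b : S} (h1 : b ≠ a) (h2 : b ≠ Z.neg a) : Z.κ a b = (Z.k : R) := by simp [κ, h1, h2]

lemma κ_symm (a b : S) : Z.κ a b = Z.κ b a := by
  unfold κ
  have h1 : (b = a) = (a = b) := propext eq_comm
  have h2 : (b = Z.neg a) = (a = Z.neg b) := by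
    apply propext; rw [eq_comm, Z.neg_eq]
  simp only [h1, h2]

lemma κ_neg_neg (a b : S) : Z.κ (Z.neg a) (Z.neg b) = Z.κ a b := by
  unfold κ
  simp only [Z.neg_inj]

lemma h_neg_neg (a b : S) : Z.h (Z.neg a) (Z.neg b) = (Z.h a b : R) := by
  unfold h
  simp only [Z.neg_inj]

lemma h_symm (a b : S) : (Z.h a b : R) = Z.h b a := by
  unfold h
  have h2 : (b = Z.neg a) = (a = Z.neg b) := by
    apply propext; rw [eq_comm, Z.neg_eq]
  simp only [h2]

lemma d_κ (c a b : S) : Z.d c (Z.κ a b) = 0 := by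
  unfold κ
  split_ifs
  · simp
  · rw [show (2 * (Z.m : R)) = ((2 * Z.m : ℕ) : R) by push_cast; ring, Derivation.map_natCast]
  · exact Derivation.map_natCast _ _

lemma d_h (c a b : S) : Z.d c (Z.h a b) = 0 := by
  unfold h
  split_ifs
  · exact Derivation.map_natCast _ 2
  · simp

/-- Sum of the squared derivatives, twice the Laplacian. -/
def lap : R →ₗ[ℂ] R := ∑ c, (Z.d c).toLinearMap ∘ₗ (Z.d c).toLinearMap

lemma lap_apply (f : R) : Z.lap f = ∑ c, Z.d c (Z.d c f) := by
  simp [lap]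

lemma sum_g_mul (a : S) (f : S → R) : ∑ c, Z.g c a * f c = f a - f (Z.neg a) := by
  unfold g
  have : ∀ c, (a = Z.neg c) = (c = Z.neg a) := fun c => propext (by rw [eq_comm, Z.neg_eq])
  simp [sub_mul, Finset.sum_sub_distrib, this]

lemma g_self (a : S) : Z.g a a = (1 : R) := by simp [g, (Z.neg_ne a).symm]

lemma g_neg_left (a b : S) : Z.g (Z.neg a) b = -(Z.g a b : R) := by
  simp [g, Z.neg_neg]

lemma g_neg_right (a b : S) : Z.g a (Z.neg b) = -(Z.g a b : R) := by
  unfold g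
  simp only [Z.neg_eq, Z.neg_neg]; ring

lemma g_gen {a b : S} (h1 : b ≠ a) (h2 : b ≠ Z.neg a) : Z.g a b = (0 : R) := by simp [g, h1, h2]

lemma g_h {a b : S} (hab : b ≠ a) : 1 - Z.g a b = (Z.h a b : R) := by
  by_cases h2 : b = Z.neg a
  · subst h2; rw [g_neg_right, g_self]; simp [h]; ring
  · rw [g_gen _ hab h2]; simp [h, h2]

lemma w_sq_h (a b : S) : Z.w a b ^ 2 * (1 - Z.g a b) = Z.w a b ^ 2 * Z.h a b := by
  by_cases hab : b = a
  · subst hab; simp [Z.w_self]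
  · rw [g_h _ hab]

lemma d_w_left (a b : S) : Z.d a (Z.w a b) = -Z.w a b ^ 2 * Z.h a b := by
  rw [d_w, g_self]
  linear_combination -Z.w_sq_h a b

lemma d_add_neg (a : S) (f : R) : Z.d (Z.neg a) f = -Z.d a f := by rw [Z.d_neg]; rfl

lemma lap_mul (f u : R) : Z.lap (f * u) = Z.lap f * u + 2 * ∑ c, Z.d c f * Z.d c u + f * Z.lap u := by
  simp only [lap_apply, Finset.sum_mul, Finset.mul_sum, ← Finset.sum_add_distrib]
  refine Finset.sum_congr rfl fun c _ => ?_
  simp only [Derivation.leibniz, map_add, smul_eq_mul]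
  ring

lemma sum_d_w_mul (a b : S) (u : R) :
    ∑ c, Z.d c (Z.w a b) * Z.d c u = -2 * Z.w a b ^ 2 * (Z.d a u - Z.d b u) := by
  have h1 := Z.sum_g_mul a (fun c => Z.d c u)
  have h2 := Z.sum_g_mul b (fun c => Z.d c u)
  simp only [d_add_neg] at h1 h2
  calc _ = -Z.w a b ^ 2 * ((∑ c, Z.g c a * Z.d c u) - ∑ c, Z.g c b * Z.d c u) := by
        rw [← Finset.sum_sub_distrib, Finset.mul_sum]
        refine Finset.sum_congr rfl fun c _ => ?_
        rw [d_w]; ring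
    _ = _ := by rw [h1, h2]; ring

lemma lap_w (a b : S) : Z.lap (Z.w a b) = 8 * Z.h a b * Z.w a b ^ 3 := by
  have hg : ∀ c a b : S, Z.d c (Z.g a b) = 0 := by
    intro c a b; unfold g; split_ifs <;> simp
  rw [lap_apply]
  have : ∀ c, Z.d c (Z.d c (Z.w a b)) =
      2 * Z.w a b ^ 3 * (Z.g c a * (Z.g c a - Z.g c b) - Z.g c b * (Z.g c a - Z.g c b)) := by
    intro c
    rw [d_w, Derivation.leibniz, map_sub, hg, hg]
    simp only [map_neg, Derivation.leibniz_pow, d_w, smul_eq_mul, nsmul_eq_mul]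
    push_cast
    ring
  simp only [this]
  rw [← Finset.mul_sum, Finset.sum_sub_distrib, sum_g_mul, sum_g_mul]
  simp only [g_neg_left, g_self]
  by_cases hab : b = a
  · subst hab; simp [Z.w_self]
  · have h1 := Z.g_h (R := R) hab
    have h2 := Z.g_h (R := R) (Ne.symm hab)
    rw [h_symm] at h2
    linear_combination 4 * Z.w a b ^ 3 * h1 + 4 * Z.w a b ^ 3 * h2

/-- Coupled inverse differences. -/
def y (a b : S) : R := Z.κ a b * Z.w a b

/-- The exchange matrix. -/
def t (a b : S) : R := 4 * Z.κ a b * Z.w a b ^ 2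

lemma y_symm (a b : S) : Z.y b a = -Z.y a b := by
  rw [y, y, w_symm, κ_symm]; ring

lemma t_symm (a b : S) : Z.t b a = Z.t a b := by
  rw [t, t, w_symm, κ_symm]; ring

/-- The Calogero-Moser potential. -/
def V : R := ∑ a, ∑ b, Z.κ a b * (Z.κ a b + Z.h a b) * Z.w a b ^ 2

lemma d_V (a : S) : Z.d a Z.V = -8 * ∑ b, Z.κ a b * (Z.κ a b + Z.h a b) * Z.w a b ^ 3 := by
  have h1 : Z.d a Z.V = ∑ b, ∑ c, Z.κ b c * (Z.κ b c + Z.h b c) * (-2 * Z.w b c ^ 3) *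
      (Z.g a b - Z.g a c) := by
    unfold V
    rw [map_sum]
    refine Finset.sum_congr rfl fun b _ => ?_
    rw [map_sum]
    refine Finset.sum_congr rfl fun c _ => ?_
    simp only [Derivation.leibniz, Derivation.leibniz_pow, d_w, smul_eq_mul, nsmul_eq_mul, map_add,
      d_κ, d_h]
    push_cast
    ring
  have gs : ∀ a b, (Z.g a b : R) = Z.g b a := by
    intro a b; unfold g
    have h1 : (b = a) = (a = b) := propext eq_comm
    have h2 : (b = Z.neg a) = (a = Z.neg b) := by
      apply propext; rw [eq_comm, Z.neg_eq]
    simp only [h1, h2]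
  have key : ∀ F : S → S → R, (∀ b c, F (Z.neg b) (Z.neg c) = -F b c) →
      ∑ b, ∑ c, Z.g b a * F b c = 2 * ∑ c, F a c := by
    intro F hF
    simp only [← Finset.mul_sum]
    rw [Z.sum_g_mul a (fun b => ∑ c, F b c), ← Z.sum_neg (fun c => F (Z.neg a) c)]
    simp only [hF, Finset.sum_neg_distrib]
    ring
  have k1 := key (fun b c => Z.κ b c * (Z.κ b c + Z.h b c) * (-2 * Z.w b c ^ 3)) (by
    intro b c; simp only [κ_neg_neg, h_neg_neg, w_neg_neg]; ring)
  have k2 := key (fun c b => Z.κ b c * (Z.κ b c + Z.h b c) * (2 * Z.w b c ^ 3)) (by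
    intro b c; simp only [κ_neg_neg, h_neg_neg, w_neg_neg]; ring)
  rw [Finset.sum_comm] at k2
  rw [h1]
  calc _ = (∑ b, ∑ c, Z.g b a * (Z.κ b c * (Z.κ b c + Z.h b c) * (-2 * Z.w b c ^ 3))) +
        ∑ b, ∑ c, Z.g c a * (Z.κ b c * (Z.κ b c + Z.h b c) * (2 * Z.w b c ^ 3)) := by
        simp only [← Finset.sum_add_distrib, gs a]
        refine Finset.sum_congr rfl fun b _ => Finset.sum_congr rfl fun c _ => ?_
        ring
    _ = _ := by
        rw [k1, k2, Finset.mul_sum, Finset.mul_sum, Finset.mul_sum, ← Finset.sum_add_distrib]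
        refine Finset.sum_congr rfl fun c _ => ?_
        rw [κ_symm Z c a, h_symm Z c a, w_symm Z a c]
        ring

/-- The off-diagonal terms of the Lax commutator. -/
lemma lax_offdiag {a c : S} (hac : a ≠ c) :
    ∑ b, (Z.y a c * (Z.t a b - Z.t c b) - Z.t a b * Z.y b c + Z.y a b * Z.t b c) = 0 := by
  set F : S → R := fun b =>
    Z.y a c * (Z.t a b - Z.t c b) - Z.t a b * Z.y b c + Z.y a b * Z.t b c with hF
  have gen : ∀ b, b ≠ a → b ≠ c → b ≠ Z.neg a → b ≠ Z.neg c →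
      F b = 4 * (Z.κ a c - Z.k) * Z.k * Z.w a c * (Z.w a b ^ 2 - Z.w b c ^ 2) := by
    intro b h1 h2 h3 h4
    have := Z.three_term h1.symm h2 hac
    simp only [hF, y, t, Z.κ_gen h1 h3, Z.κ_gen h2 h4, Z.κ_symm b c, Z.w_symm b c]
    linear_combination 4 * (Z.k : R) ^ 2 * (-Z.w a b + Z.w b c) * this
  by_cases hc : c = Z.neg a
  · have hneg : ∀ b, F (Z.neg b) = -F b := by
      intro b
      have w1 : Z.w a (Z.neg b) = Z.w b c := by
        rw [hc, w_symm Z (Z.neg b), w_symm Z (Z.neg a), Z.w_neg_left]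
      have w2 : Z.w (Z.neg b) c = Z.w a b := by
        rw [hc, w_neg_neg, w_symm Z a b]; ring
      have k1 : Z.κ a (Z.neg b) = Z.κ b c := by
        rw [← κ_neg_neg, Z.neg_neg, ← hc, κ_symm]
      have k2 : Z.κ (Z.neg b) c = Z.κ a b := by
        rw [← κ_neg_neg, Z.neg_neg, hc, Z.neg_neg, κ_symm]
      simp only [hF, y, t, Z.κ_symm c, Z.w_symm _ c, w1, w2, k1, k2]
      ring
    have h1 := Z.sum_neg F
    simp only [hneg, Finset.sum_neg_distrib] at h1
    have h2 : (2 : ℂ) • ∑ b, F b = 0 := by rw [two_smul]; nth_rewrite 1 [← h1]; simp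
    simpa using h2
  · have hsub : ∑ b, F b = ∑ b ∈ ({a, c, Z.neg a, Z.neg c} : Finset S), F b := by
      symm
      apply Finset.sum_subset (Finset.subset_univ _)
      intro b _ hb
      simp only [Finset.mem_insert, Finset.mem_singleton, not_or] at hb
      rw [gen b hb.1 hb.2.1 hb.2.2.1 hb.2.2.2, Z.κ_gen hac.symm hc]
      ring
    have hc' : a ≠ Z.neg c := fun h => hc (Z.neg_eq.1 h.symm)
    have na := Z.neg_ne a
    have nc := Z.neg_ne c
    rw [hsub, Finset.sum_insert, Finset.sum_insert, Finset.sum_insert, Finset.sum_singleton]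
    · have e1 := Z.three_term na.symm (Ne.symm hc) hac
      have e2 := Z.three_term hc' nc hac
      have hw : Z.w (Z.neg a) c ^ 2 = Z.w a (Z.neg c) ^ 2 := by
        rw [Z.w_neg_left, Z.w_symm a]; ring
      have k1 : Z.κ (Z.neg a) c = Z.k := Z.κ_gen hc.elim (by rw [Z.neg_neg]; exact hac.symm)
      have k2 : Z.κ a (Z.neg c) = Z.k := Z.κ_gen hc'.symm (fun h => hac (Z.neg_inj.1 h).symm)
      have k3 : Z.κ a c = Z.k := Z.κ_gen hac.symm hc
      have k4 : Z.κ (Z.neg c) c = 2 * Z.m := by rw [κ_symm, κ_neg]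
      have ts : ∀ b, Z.t c b = Z.t b c := fun b => Z.t_symm b c
      simp only [hF]
      simp only [ts]
      simp only [y, t, κ_self, w_self, κ_neg, k1, k2, k3, k4]
      linear_combination (-8 * (Z.m : R) * Z.k) * (Z.w a (Z.neg a) - Z.w (Z.neg a) c) * e1 +
        (-8 * (Z.m : R) * Z.k) * (Z.w a (Z.neg c) - Z.w (Z.neg c) c) * e2 +
        (8 * (Z.m : R) * Z.k - 4 * Z.k ^ 2) * Z.w a c * hw
    · simpa using fun h => hac (Z.neg_inj.1 h)
    · simp [hc, Ne.symm nc]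
    · simp [hac, na.symm, hc']

/-- The matrix Lax operator. -/
def lax : (S → R) →ₗ[ℂ] (S → R) where
  toFun u a := Z.d a (u a) + ∑ b, Z.y a b * u b
  map_add' u v := by
    ext a; simp only [Pi.add_apply, map_add, mul_add, Finset.sum_add_distrib]; ring
  map_smul' c u := by
    ext a; simp [Finset.smul_sum]

lemma lax_apply (u : S → R) (a : S) : Z.lax u a = Z.d a (u a) + ∑ b, Z.y a b * u b := rfl

/-- The matrix Calogero-Moser operator. -/
def ham : (S → R) →ₗ[ℂ] (S → R) where
  toFun u a := Z.lap (u a) - Z.V * u a - ∑ b, Z.t a b * (u b - u a)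
  map_add' u v := by
    ext a
    simp only [Pi.add_apply, map_add, mul_add, mul_sub, Finset.sum_add_distrib,
      Finset.sum_sub_distrib]; ring
  map_smul' c u := by
    ext a; simp [Finset.smul_sum, smul_sub, mul_sub]

lemma ham_apply (u : S → R) (a : S) :
    Z.ham u a = Z.lap (u a) - Z.V * u a - ∑ b, Z.t a b * (u b - u a) := rfl

/-- The scalar Calogero-Moser operator. -/
def ham₀ : R →ₗ[ℂ] R := Z.lap - LinearMap.mulLeft ℂ Z.V

lemma ham₀_apply (f : R) : Z.ham₀ f = Z.lap f - Z.V * f := rfl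

/-- Multiplication by the coordinates. -/
def mulX : (S → R) →ₗ[ℂ] (S → R) where
  toFun u a := Z.x a * u a
  map_add' u v := by ext a; simp [mul_add]
  map_smul' c u := by ext a; simp

lemma mulX_apply (u : S → R) (a : S) : Z.mulX u a = Z.x a * u a := rfl

lemma lap_d (a : S) (f : R) : Z.lap (Z.d a f) = Z.d a (Z.lap f) := by
  simp only [lap_apply, map_sum]
  refine Finset.sum_congr rfl fun c _ => ?_
  rw [Z.d_comm c a, Z.d_comm c a]

lemma lap_y_mul (a b : S) (u : R) : Z.lap (Z.y a b * u) =
    8 * Z.κ a b * Z.h a b * Z.w a b ^ 3 * u - Z.t a b * (Z.d a u - Z.d b u) + Z.y a b * Z.lap u := by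
  have h1 : Z.lap (Z.y a b) = Z.κ a b * Z.lap (Z.w a b) := by
    rw [lap_apply, lap_apply, Finset.mul_sum]
    refine Finset.sum_congr rfl fun c _ => ?_
    rw [y]
    simp [Derivation.leibniz, d_κ]
  have h2 : ∑ c, Z.d c (Z.y a b) * Z.d c u = Z.κ a b * ∑ c, Z.d c (Z.w a b) * Z.d c u := by
    rw [Finset.mul_sum]
    refine Finset.sum_congr rfl fun c _ => ?_
    rw [y]
    simp [Derivation.leibniz, d_κ, mul_assoc]
  rw [lap_mul, h1, h2, lap_w, sum_d_w_mul, t]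
  ring

lemma d_t (a b : S) : Z.d a (Z.t a b) = -(8 * Z.κ a b * Z.h a b * Z.w a b ^ 3) := by
  have : Z.t a b = (4 : ℕ) • (Z.κ a b * Z.w a b ^ 2) := by rw [t]; simp [mul_assoc]
  rw [this, map_nsmul]
  simp only [Derivation.leibniz, Derivation.leibniz_pow, d_κ, d_w_left, smul_eq_mul, nsmul_eq_mul]
  push_cast
  ring

lemma lax_coeff (a c : S) :
    ∑ b, (Z.y a c * (Z.t a b - Z.t c b) - Z.t a b * Z.y b c + Z.y a b * Z.t b c) =
      if a = c then ∑ b, 8 * Z.κ a b ^ 2 * Z.w a b ^ 3 else 0 := by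
  split_ifs with hac
  · subst hac
    refine Finset.sum_congr rfl fun b _ => ?_
    rw [y_symm Z a b, t_symm Z a b, y, y, t, κ_self]
    ring
  · exact Z.lax_offdiag hac

theorem ham_lax (u : S → R) : Z.ham (Z.lax u) = Z.lax (Z.ham u) := by
  ext a
  have coeff : ∀ c, u c * ∑ b, (Z.y a c * (Z.t a b - Z.t c b) - Z.t a b * Z.y b c
      + Z.y a b * Z.t b c) = u c * if a = c then ∑ b, 8 * Z.κ a b ^ 2 * Z.w a b ^ 3 else 0 :=
    fun c => by rw [lax_coeff]
  have h0 := Finset.sum_congr rfl fun c (_ : c ∈ Finset.univ) => coeff c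
  simp only [mul_ite, mul_zero, Finset.sum_ite_eq, Finset.mem_univ, if_true] at h0
  rw [← sub_eq_zero]
  simp only [ham_apply, lax_apply, map_add, map_sub, map_sum, lap_d, lap_y_mul,
    Derivation.leibniz, smul_eq_mul, d_V, d_t]
  have e : ∀ b, Z.t a b * ((Z.d b (u b) + ∑ c, Z.y b c * u c) - (Z.d a (u a) + ∑ c, Z.y a c * u c))
      = Z.t a b * (Z.d b (u b) - Z.d a (u a)) + ∑ c, u c * (Z.t a b * Z.y b c)
        - ∑ c, u c * (Z.t a b * Z.y a c) := by
    intro b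
    rw [← sub_eq_zero]
    simp only [mul_sub, mul_add, Finset.mul_sum]
    have : ∀ c, u c * (Z.t a b * Z.y a c) = Z.t a b * (Z.y a c * u c) := fun c => by ring
    have h' : ∀ c, u c * (Z.t a b * Z.y b c) = Z.t a b * (Z.y b c * u c) := fun c => by ring
    simp only [this, h']; ring
  have e2 : ∀ b, Z.y a b * (Z.lap (u b) - Z.V * u b - ∑ c, Z.t b c * (u c - u b)) =
      Z.y a b * Z.lap (u b) - Z.V * (Z.y a b * u b) - ∑ c, u c * (Z.y a b * Z.t b c)
        + ∑ c, u b * (Z.y a b * Z.t b c) := by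
    intro b
    rw [← sub_eq_zero]
    have h' : ∀ c, u c * (Z.y a b * Z.t b c) = Z.y a b * (Z.t b c * u c) := fun c => by ring
    have h'' : ∀ c, u b * (Z.y a b * Z.t b c) = Z.y a b * (Z.t b c * u b) := fun c => by ring
    simp only [mul_sub, Finset.mul_sum, Finset.sum_sub_distrib, h', h'']; ring
  simp only [e, e2]
  simp only [Finset.sum_add_distrib, Finset.sum_sub_distrib, mul_add, mul_sub, Finset.mul_sum,
    neg_mul] at h0 ⊢
  have c1 : ∑ x, ∑ c, u c * (Z.t a x * Z.y a c) = ∑ x, ∑ i, u x * (Z.y a x * Z.t a i) := by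
    rw [Finset.sum_comm]; simp only [mul_comm (Z.t _ _)]
  have c2 : ∑ x, ∑ c, u c * (Z.t a x * Z.y x c) = ∑ x, ∑ i, u x * (Z.t a i * Z.y i x) :=
    Finset.sum_comm
  have c3 : ∑ x, ∑ c, u c * (Z.y a x * Z.t x c) = ∑ x, ∑ i, u x * (Z.y a i * Z.t i x) :=
    Finset.sum_comm
  have c4 : ∑ x, (u x - u a) * -(8 * Z.κ a x * Z.h a x * Z.w a x ^ 3) =
      -∑ x, 8 * Z.κ a x * Z.h a x * Z.w a x ^ 3 * u x
        + ∑ x, u a * (8 * Z.κ a x * Z.h a x * Z.w a x ^ 3) := by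
    rw [← Finset.sum_neg_distrib, ← Finset.sum_add_distrib]
    exact Finset.sum_congr rfl fun _ _ => by ring
  have c5 : ∑ i, u a * -(8 * ((Z.κ a i * Z.κ a i + Z.κ a i * Z.h a i) * Z.w a i ^ 3)) =
      -∑ i, u a * (8 * Z.κ a i ^ 2 * Z.w a i ^ 3)
        - ∑ x, u a * (8 * Z.κ a x * Z.h a x * Z.w a x ^ 3) := by
    rw [← Finset.sum_neg_distrib, ← Finset.sum_sub_distrib]
    exact Finset.sum_congr rfl fun _ _ => by ring
  rw [c1, c2, c3, c4, c5]
  linear_combination h0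

/-- The commutator of the Hamiltonian with multiplication by coordinates. -/
theorem ham_mulX (u : S → R) : Z.ham (Z.mulX u) = Z.mulX (Z.ham u) + (4 : ℂ) • Z.lax u := by
  ext a
  have h1 : Z.lap (Z.x a) = 0 := by
    rw [lap_apply]
    refine Finset.sum_eq_zero fun c _ => ?_
    rw [Z.d_x']; unfold g; split_ifs <;> simp
  have h2 : ∑ c, Z.d c (Z.x a) * Z.d c (u a) = 2 * Z.d a (u a) := by
    simp only [Z.d_x']
    rw [Z.sum_g_mul a (fun c => Z.d c (u a)), d_add_neg]; ring
  have h3 : ∀ b, Z.t a b * (Z.x b * u b - Z.x a * u a) =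
      Z.x a * (Z.t a b * (u b - u a)) - 4 * (Z.y a b * u b) := by
    intro b
    by_cases hab : a = b
    · subst hab; simp [t, y, κ_self]
    · have := Z.w_mul a b hab
      rw [t, y]
      linear_combination (-4 * Z.κ a b * Z.w a b * u b) * this
  simp only [Pi.add_apply, Pi.smul_apply, mulX_apply, ham_apply, lax_apply, lap_mul, h1, h2, h3,
    Finset.sum_sub_distrib, ← Finset.mul_sum]
  have : (4 : ℂ) • (Z.d a (u a) + ∑ b, Z.y a b * u b) =
      4 * (Z.d a (u a) + ∑ b, Z.y a b * u b) := by
    rw [Algebra.smul_def, map_ofNat]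
  rw [this]
  ring

/-- Constant vectors. -/
def const : R →ₗ[ℂ] (S → R) := LinearMap.pi fun _ => LinearMap.id

omit [Fintype S] [DecidableEq S] in
lemma const_apply (f : R) (a : S) : (const f : S → R) a = f := rfl

/-- The sum of the components. -/
def total : (S → R) →ₗ[ℂ] R := ∑ a, LinearMap.proj a

omit [DecidableEq S] in
lemma total_apply (u : S → R) : total u = ∑ a, u a := by simp [total]

lemma ham_const (f : R) : Z.ham (const f) = const (Z.ham₀ f) := by
  ext a; simp [ham_apply, ham₀_apply, const_apply]

lemma total_ham (u : S → R) : total (Z.ham u) = Z.ham₀ (total u) := by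
  have h : ∑ a, ∑ b, Z.t a b * (u b - u a) = 0 := by
    simp only [mul_sub, Finset.sum_sub_distrib]
    rw [sub_eq_zero, Finset.sum_comm]
    simp only [Z.t_symm]
  simp only [total_apply, ham_apply, ham₀_apply, Finset.sum_sub_distrib, h, map_sum,
    sub_zero, ← Finset.mul_sum]

/-- The logarithmic derivative of the weight. -/
def ell (a : S) : R := ∑ b, Z.y a b

omit [Fintype S] [DecidableEq S] in
lemma eq_zero_of_nsmul {n : ℕ} (hn : n ≠ 0) {r : R} (hr : (n : R) * r = 0) : r = 0 := by
  have h : (n : ℂ) • r = 0 := by rw [Algebra.smul_def, map_natCast, hr]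
  have h' : (n : ℂ) ≠ 0 := by exact_mod_cast hn
  simpa [h'] using h

lemma sum_cross_opp : ∑ a, ∑ c, (if c = Z.neg a then 0 else Z.y a (Z.neg a) * Z.y a c) = 0 := by
  set G : S → S → R := fun a c => if c = Z.neg a then 0 else Z.y a (Z.neg a) * Z.y a c with hG
  have hsum : ∀ a c, G a c + G (Z.neg a) c + (G c a + G (Z.neg c) a) = 0 := by
    intro a c
    have e : ∀ a c, (a = Z.neg c) = (c = Z.neg a) := fun a c => propext (by rw [eq_comm, Z.neg_eq])
    simp only [hG, Z.neg_neg]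
    by_cases h1 : c = a
    · subst h1
      simp only [(Z.neg_ne c).symm, y, κ_self, if_true, if_false]; ring
    by_cases h2 : c = Z.neg a
    · subst h2
      simp only [Z.neg_neg, Z.neg_ne, (Z.neg_ne a).symm, y, κ_self, if_true, if_false]; ring
    have h3 : a ≠ Z.neg c := by rw [Ne, e]; exact h2
    have k1 : Z.κ a c = Z.k := Z.κ_gen h1 h2
    have k2 : Z.κ (Z.neg a) c = Z.k := Z.κ_gen h2 (by rw [Z.neg_neg]; exact h1)
    have k3 : Z.κ (Z.neg c) a = Z.k := by rw [κ_symm]; exact Z.κ_gen h3.symm (by rwa [Ne, Z.neg_inj])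
    have k4 : ∀ a, Z.κ (Z.neg a) a = 2 * Z.m := fun a => by rw [κ_symm, κ_neg]
    have t1 := Z.three_term (Z.neg_ne a).symm (Ne.symm h2) (Ne.symm h1)
    have t2 := Z.three_term (Z.neg_ne c).symm (Ne.symm h3) h1
    rw [Z.w_neg_left c a] at t2
    simp only [h1, h2, h3, Ne.symm h1, if_false, y, κ_neg, κ_symm Z c a, k1, k2, k3, k4,
      Z.w_neg_left c a, Z.w_symm a c]
    rw [Z.w_symm a c] at t2
    rw [Z.w_symm c (Z.neg c), Z.w_symm a (Z.neg a)]
    linear_combination (-2 * (Z.m : R) * Z.k) * t1 + (-2 * (Z.m : R) * Z.k) * t2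
  have h1 : ∑ a, ∑ c, G (Z.neg a) c = ∑ a, ∑ c, G a c := Z.sum_neg (fun a => ∑ c, G a c)
  have h2 : ∑ a, ∑ c, G c a = ∑ a, ∑ c, G a c := Finset.sum_comm
  have h3 : ∑ a, ∑ c, G (Z.neg c) a = ∑ a, ∑ c, G a c := by rw [Finset.sum_comm, h1]
  have h4 := Finset.sum_congr rfl fun a (_ : a ∈ Finset.univ) =>
    Finset.sum_congr rfl fun c (_ : c ∈ Finset.univ) => hsum a c
  simp only [Finset.sum_add_distrib, h1, h2, h3, Finset.sum_const_zero] at h4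
  apply eq_zero_of_nsmul (n := 4) (by norm_num)
  push_cast
  linear_combination h4

lemma sum_cross_pair : ∑ a, ∑ b, Z.y a b * Z.y a (Z.neg b) = 0 := by
  have h : ∀ a b, Z.y b a * Z.y b (Z.neg a) = -(Z.y a b * Z.y a (Z.neg b)) := by
    intro a b
    have k1 : Z.κ b (Z.neg a) = Z.κ a (Z.neg b) := by
      rw [← κ_neg_neg, Z.neg_neg, κ_symm]
    have w1 : Z.w b (Z.neg a) = Z.w a (Z.neg b) := by
      rw [w_symm, w_neg_left, ← w_symm]
    rw [y_symm, y, y, y, k1, w1]; ring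
  have h2 : ∑ a, ∑ b, Z.y a b * Z.y a (Z.neg b) = ∑ a, ∑ b, Z.y b a * Z.y b (Z.neg a) :=
    Finset.sum_comm
  rw [Finset.sum_congr rfl fun a _ => Finset.sum_congr rfl fun b _ => h a b] at h2
  simp only [Finset.sum_neg_distrib] at h2
  apply eq_zero_of_nsmul (n := 2) (by norm_num)
  push_cast
  linear_combination h2

lemma sum_cross_gen : ∑ a, ∑ b, ∑ c, (if b ≠ a ∧ b ≠ Z.neg a ∧ c ≠ a ∧ c ≠ Z.neg a ∧ b ≠ c ∧
    b ≠ Z.neg c then Z.y a b * Z.y a c else 0) = 0 := by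
  set F : S → S → S → R := fun a b c => if b ≠ a ∧ b ≠ Z.neg a ∧ c ≠ a ∧ c ≠ Z.neg a ∧ b ≠ c ∧
    b ≠ Z.neg c then Z.y a b * Z.y a c else 0 with hF
  have e : ∀ a c, (a = Z.neg c) = (c = Z.neg a) := fun a c => propext (by rw [eq_comm, Z.neg_eq])
  have hcyc : ∀ a b c, F a b c + F b c a + F c a b = 0 := by
    intro a b c
    by_cases h : b ≠ a ∧ b ≠ Z.neg a ∧ c ≠ a ∧ c ≠ Z.neg a ∧ b ≠ c ∧ b ≠ Z.neg c
    · have h1 : c ≠ b ∧ c ≠ Z.neg b ∧ a ≠ b ∧ a ≠ Z.neg b ∧ c ≠ a ∧ c ≠ Z.neg a := by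
        have := e a b; have := e b c
        simp_all [Ne.symm h.1, Ne.symm h.2.2.2.2.1]
      have h2 : a ≠ c ∧ a ≠ Z.neg c ∧ b ≠ c ∧ b ≠ Z.neg c ∧ a ≠ b ∧ a ≠ Z.neg b := by
        have := e a c
        refine ⟨Ne.symm h.2.2.1, ?_, h.2.2.2.2.1, h.2.2.2.2.2, h1.2.2.1, h1.2.2.2.1⟩
        rw [Ne, this]; exact h.2.2.2.1
      simp only [hF]
      rw [if_pos h, if_pos h1, if_pos h2]
      have t1 := Z.three_term h1.2.2.1 h.2.2.2.2.1 h2.1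
      simp only [y, Z.κ_gen h.1 h.2.1, Z.κ_gen h.2.2.1 h.2.2.2.1, Z.κ_gen h1.1 h1.2.1,
        Z.κ_gen h1.2.2.1 h1.2.2.2.1, Z.κ_gen h2.1 h2.2.1, Z.κ_gen h2.2.2.1 h2.2.2.2.1,
        Z.w_symm a b, Z.w_symm a c, Z.w_symm b c]
      linear_combination -(Z.k : R) ^ 2 * t1
    · have h1 : ¬ (c ≠ b ∧ c ≠ Z.neg b ∧ a ≠ b ∧ a ≠ Z.neg b ∧ c ≠ a ∧ c ≠ Z.neg a) := by
        rw [Ne, Ne, Ne, Ne, e a b, e c b, eq_comm (a := c) (b := b), eq_comm (a := a) (b := b)]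
        tauto
      have h2 : ¬ (a ≠ c ∧ a ≠ Z.neg c ∧ b ≠ c ∧ b ≠ Z.neg c ∧ a ≠ b ∧ a ≠ Z.neg b) := by
        rw [Ne, Ne, Ne, Ne, Ne, Ne, e a b, e a c, eq_comm (a := a) (b := c),
          eq_comm (a := a) (b := b)]
        tauto
      simp only [hF]
      rw [if_neg h, if_neg h1, if_neg h2]; ring
  have h1 : ∑ a, ∑ b, ∑ c, F b c a = ∑ a, ∑ b, ∑ c, F a b c := by
    rw [Finset.sum_comm]
    exact Finset.sum_congr rfl fun _ _ => Finset.sum_comm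
  have h2 : ∑ a, ∑ b, ∑ c, F c a b = ∑ a, ∑ b, ∑ c, F a b c := by
    rw [← h1]
    rw [Finset.sum_comm]
    exact (Finset.sum_congr rfl fun _ _ => Finset.sum_comm).trans
      (Finset.sum_comm.trans (Finset.sum_congr rfl fun _ _ => Finset.sum_comm)) |>.trans h1.symm
  have h4 := Finset.sum_congr rfl fun a (_ : a ∈ Finset.univ) =>
    Finset.sum_congr rfl fun b (_ : b ∈ Finset.univ) =>
    Finset.sum_congr rfl fun c (_ : c ∈ Finset.univ) => hcyc a b c
  simp only [Finset.sum_add_distrib, h1, h2, Finset.sum_const_zero] at h4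
  apply eq_zero_of_nsmul (n := 3) (by norm_num)
  push_cast
  linear_combination h4

lemma sum_cross : ∑ a, ∑ b, ∑ c, (if b = c then 0 else Z.y a b * Z.y a c) = 0 := by
  have hpt : ∀ a b c, (if b = c then 0 else Z.y a b * Z.y a c) =
      (if b = Z.neg a then (if c = Z.neg a then 0 else Z.y a b * Z.y a c) else 0) +
      (if c = Z.neg a then (if b = Z.neg a then 0 else Z.y a b * Z.y a c) else 0) +
      (if c = Z.neg b then Z.y a b * Z.y a c else 0) +
      (if b ≠ a ∧ b ≠ Z.neg a ∧ c ≠ a ∧ c ≠ Z.neg a ∧ b ≠ c ∧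
        b ≠ Z.neg c then Z.y a b * Z.y a c else 0) := by
    intro a b c
    have ya : Z.y a a = 0 := by simp [y, κ_self]
    have h1 := Z.neg_ne a
    have h2 := Z.neg_ne b
    have h3 := Z.neg_neg a
    have h4 := Z.neg_neg b
    have h5 := Z.neg_neg c
    grind
  simp only [hpt, Finset.sum_add_distrib, sum_cross_gen]
  have s1 := Z.sum_cross_opp
  have s2 := Z.sum_cross_pair
  have e1 : ∀ a, ∑ b, ∑ c, (if b = Z.neg a then (if c = Z.neg a then 0 else Z.y a b * Z.y a c)
      else 0) = ∑ c, (if c = Z.neg a then 0 else Z.y a (Z.neg a) * Z.y a c) := by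
    intro a
    rw [Finset.sum_comm]
    simp
  have e2 : ∀ a, ∑ b, ∑ c, (if c = Z.neg a then (if b = Z.neg a then 0 else Z.y a b * Z.y a c)
      else 0) = ∑ c, (if c = Z.neg a then 0 else Z.y a (Z.neg a) * Z.y a c) := by
    intro a
    simp [mul_comm]
  simp only [e1, e2]
  simp [s1, s2]

lemma sum_ell_sq : ∑ a, (Z.ell a ^ 2 - Z.d a (Z.ell a)) = Z.V := by
  have h1 : ∀ a, Z.ell a ^ 2 = ∑ b, Z.y a b ^ 2 +
      ∑ b, ∑ c, (if b = c then 0 else Z.y a b * Z.y a c) := by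
    intro a
    rw [ell, sq, Finset.sum_mul_sum, ← Finset.sum_add_distrib]
    refine Finset.sum_congr rfl fun b _ => ?_
    have : Z.y a b ^ 2 = ∑ c, if b = c then Z.y a b * Z.y a c else 0 := by simp [sq]
    rw [this, ← Finset.sum_add_distrib]
    refine Finset.sum_congr rfl fun c _ => ?_
    split_ifs <;> simp
  simp only [h1, Finset.sum_sub_distrib, Finset.sum_add_distrib, sum_cross, V, add_zero]
  rw [← Finset.sum_sub_distrib]
  refine Finset.sum_congr rfl fun a _ => ?_
  rw [ell, map_sum, ← Finset.sum_sub_distrib]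
  refine Finset.sum_congr rfl fun b _ => ?_
  rw [y, Derivation.leibniz, d_κ, d_w_left]
  simp only [smul_eq_mul]
  ring

lemma lap_weight {θ : R} (hθ : ∀ a, Z.d a θ = -Z.ell a * θ) : Z.lap θ = Z.V * θ := by
  rw [lap_apply, ← sum_ell_sq, Finset.sum_mul]
  refine Finset.sum_congr rfl fun a _ => ?_
  rw [hθ, Derivation.leibniz, map_neg, hθ]
  simp only [smul_eq_mul]
  ring

lemma ham₀_weight {θ : R} (hθ : ∀ a, Z.d a θ = -Z.ell a * θ) (f : R) :
    Z.ham₀ (f * θ) = (Z.lap f - 2 * ∑ a, Z.ell a * Z.d a f) * θ := by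
  have : ∑ c, Z.d c f * Z.d c θ = -(∑ a, Z.ell a * Z.d a f) * θ := by
    rw [← Finset.sum_neg_distrib, Finset.sum_mul]
    refine Finset.sum_congr rfl fun a _ => ?_
    rw [hθ]; ring
  rw [ham₀_apply, lap_mul, lap_weight Z hθ, this]
  ring

end SignedData

end

section

section gexp

variable {E F : Type} [AddCommGroup E] [Module ℂ E] [AddCommGroup F] [Module ℂ F]

/-- Coefficients of the exponential series at `-1/4`. -/
def expCoeff (j : ℕ) : ℂ := (-1 / 4) ^ j / (j.factorial : ℂ)

lemma expCoeff_zero : expCoeff 0 = 1 := by simp [expCoeff]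

lemma expCoeff_succ (j : ℕ) : expCoeff (j + 1) * (4 * ((j + 1 : ℕ) : ℂ)) = -expCoeff j := by
  have h1 : ((j.factorial : ℕ) : ℂ) ≠ 0 := by exact_mod_cast j.factorial_ne_zero
  have h2 : ((j : ℂ) + 1) ≠ 0 := by exact_mod_cast j.succ_ne_zero
  simp only [expCoeff, Nat.factorial_succ]
  push_cast
  field_simp
  ring

/-- The operator `exp (-H / 4)` on locally nilpotent vectors. -/
def gexp (H : E →ₗ[ℂ] E) (v : E) : E := ∑ᶠ j : ℕ, expCoeff j • (H ^ j) v

/-- Locally nilpotent vectors. -/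
def LocNil (H : E →ₗ[ℂ] E) (v : E) : Prop := ∃ K : ℕ, (H ^ K) v = 0

lemma pow_eq_zero_of_le' {H : E →ₗ[ℂ] E} {v : E} {K n : ℕ} (h : (H ^ K) v = 0) (hn : K ≤ n) :
    (H ^ n) v = 0 := by
  obtain ⟨e, rfl⟩ := Nat.exists_eq_add_of_le hn
  rw [add_comm, pow_add, Module.End.mul_apply, h, map_zero]

lemma gexp_eq {H : E →ₗ[ℂ] E} {v : E} {K : ℕ} (h : (H ^ K) v = 0) :
    gexp H v = ∑ j ∈ Finset.range K, expCoeff j • (H ^ j) v := by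
  apply finsum_eq_sum_of_support_subset
  intro j hj
  simp only [Function.mem_support] at hj
  simp only [Finset.coe_range, Set.mem_Iio]
  by_contra hK
  exact hj (by rw [pow_eq_zero_of_le' h (not_lt.1 hK), smul_zero])

lemma LocNil.add {H : E →ₗ[ℂ] E} {u v : E} (hu : LocNil H u) (hv : LocNil H v) :
    LocNil H (u + v) := by
  obtain ⟨K, hK⟩ := hu
  obtain ⟨K', hK'⟩ := hv
  exact ⟨max K K', by rw [map_add, pow_eq_zero_of_le' hK (le_max_left _ _),
    pow_eq_zero_of_le' hK' (le_max_right _ _), add_zero]⟩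

lemma LocNil.smul {H : E →ₗ[ℂ] E} {u : E} (c : ℂ) (hu : LocNil H u) : LocNil H (c • u) := by
  obtain ⟨K, hK⟩ := hu
  exact ⟨K, by rw [map_smul, hK, smul_zero]⟩

lemma locNil_zero (H : E →ₗ[ℂ] E) : LocNil H 0 := ⟨0, map_zero _⟩

lemma gexp_add {H : E →ₗ[ℂ] E} {u v : E} (hu : LocNil H u) (hv : LocNil H v) :
    gexp H (u + v) = gexp H u + gexp H v := by
  obtain ⟨K, hK⟩ := hu
  obtain ⟨K', hK'⟩ := hv
  have h1 := pow_eq_zero_of_le' hK (le_max_left K K')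
  have h2 := pow_eq_zero_of_le' hK' (le_max_right K K')
  rw [gexp_eq h1, gexp_eq h2, gexp_eq (K := max K K') (by rw [map_add, h1, h2, add_zero]),
    ← Finset.sum_add_distrib]
  simp only [map_add, smul_add]

lemma gexp_smul {H : E →ₗ[ℂ] E} {u : E} (c : ℂ) (hu : LocNil H u) :
    gexp H (c • u) = c • gexp H u := by
  obtain ⟨K, hK⟩ := hu
  rw [gexp_eq hK, gexp_eq (K := K) (by rw [map_smul, hK, smul_zero]), Finset.smul_sum]
  simp only [map_smul, smul_comm c]

lemma map_pow_comm {H : E →ₗ[ℂ] E} {H' : F →ₗ[ℂ] F} {T : E →ₗ[ℂ] F}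
    (hT : ∀ v, H' (T v) = T (H v)) (j : ℕ) (v : E) : (H' ^ j) (T v) = T ((H ^ j) v) := by
  induction j generalizing v with
  | zero => rfl
  | succ j ih => rw [pow_succ, pow_succ, Module.End.mul_apply, Module.End.mul_apply, hT, ih]

lemma LocNil.map {H : E →ₗ[ℂ] E} {H' : F →ₗ[ℂ] F} {T : E →ₗ[ℂ] F}
    (hT : ∀ v, H' (T v) = T (H v)) {v : E} (hv : LocNil H v) : LocNil H' (T v) := by
  obtain ⟨K, hK⟩ := hv
  exact ⟨K, by rw [map_pow_comm hT, hK, map_zero]⟩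

lemma gexp_map {H : E →ₗ[ℂ] E} {H' : F →ₗ[ℂ] F} {T : E →ₗ[ℂ] F}
    (hT : ∀ v, H' (T v) = T (H v)) {v : E} (hv : LocNil H v) :
    gexp H' (T v) = T (gexp H v) := by
  obtain ⟨K, hK⟩ := hv
  rw [gexp_eq hK, gexp_eq (K := K) (by rw [map_pow_comm hT, hK, map_zero]), map_sum]
  simp only [map_pow_comm hT, map_smul]

variable {H X D : E →ₗ[ℂ] E}

lemma pow_comm_apply (h1 : ∀ v, H (X v) = X (H v) + (4 : ℂ) • D v) (h2 : ∀ v, H (D v) = D (H v))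
    (j : ℕ) (v : E) :
    (H ^ (j + 1)) (X v) = X ((H ^ (j + 1)) v) + (4 * ((j + 1 : ℕ) : ℂ)) • D ((H ^ j) v) := by
  induction j with
  | zero => simp [h1]
  | succ j ih =>
    rw [pow_succ' H (j + 1), Module.End.mul_apply, ih, map_add, h1, map_smul, h2,
      Module.End.mul_apply, pow_succ' H j, Module.End.mul_apply, add_assoc, ← add_smul]
    push_cast
    ring_nf

lemma LocNil.comm_apply (h1 : ∀ v, H (X v) = X (H v) + (4 : ℂ) • D v)
    (h2 : ∀ v, H (D v) = D (H v)) {v : E} (hv : LocNil H v) : LocNil H (X v) := by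
  obtain ⟨K, hK⟩ := hv
  exact ⟨K + 1, by rw [pow_comm_apply h1 h2, hK, pow_eq_zero_of_le' hK K.le_succ]; simp⟩

lemma gexp_comm_apply (h1 : ∀ v, H (X v) = X (H v) + (4 : ℂ) • D v)
    (h2 : ∀ v, H (D v) = D (H v)) {v : E} (hv : LocNil H v) :
    gexp H (X v) = (X - D) (gexp H v) := by
  obtain ⟨K, hK⟩ := hv
  have hK1 : (H ^ (K + 1)) (X v) = 0 := by
    rw [pow_comm_apply h1 h2, hK, pow_eq_zero_of_le' hK K.le_succ]; simp
  rw [gexp_eq hK1, LinearMap.sub_apply]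
  nth_rewrite 1 [gexp_eq (pow_eq_zero_of_le' hK K.le_succ)]
  rw [gexp_eq hK, Finset.sum_range_succ', Finset.sum_range_succ']
  simp only [pow_comm_apply h1 h2, map_add, map_sum, map_smul, smul_add, smul_smul, expCoeff_succ,
    Finset.sum_add_distrib, neg_smul, Finset.sum_neg_distrib]
  simp only [pow_zero, Module.End.one_apply]
  abel

lemma gexp_comm_pow_apply (h1 : ∀ v, H (X v) = X (H v) + (4 : ℂ) • D v)
    (h2 : ∀ v, H (D v) = D (H v)) (n : ℕ) {v : E} (hv : LocNil H v) :
    LocNil H ((X ^ n) v) ∧ gexp H ((X ^ n) v) = ((X - D) ^ n) (gexp H v) := by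
  induction n with
  | zero => exact ⟨hv, rfl⟩
  | succ n ih =>
    rw [pow_succ', pow_succ', Module.End.mul_apply, Module.End.mul_apply]
    exact ⟨ih.1.comm_apply h1 h2, by rw [gexp_comm_apply h1 h2 ih.1, ih.2]⟩

end gexp

namespace SignedData

variable {S R : Type} [Fintype S] [DecidableEq S] [CommRing R] [Algebra ℂ R]
variable (Z : SignedData S R)

/-- The power sum of the signed coordinates. -/
def psum (n : ℕ) : R := ∑ a, Z.x a ^ n

/-- The quantum integrals. -/
def integral (n : ℕ) : R →ₗ[ℂ] R := total ∘ₗ (Z.lax ^ n) ∘ₗ const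

lemma integral_apply (n : ℕ) (f : R) : Z.integral n f = total ((Z.lax ^ n) (const f)) := rfl

lemma mulX_pow_apply (n : ℕ) (u : S → R) (a : S) : (Z.mulX ^ n) u a = Z.x a ^ n * u a := by
  induction n with
  | zero => simp
  | succ n ih => rw [pow_succ', Module.End.mul_apply, mulX_apply, ih]; ring

lemma psum_mul (n : ℕ) (f : R) : Z.psum n * f = total ((Z.mulX ^ n) (const f)) := by
  simp [total_apply, mulX_pow_apply, const_apply, psum, Finset.sum_mul]

lemma ham₀_psum {n : ℕ} {f : R} (hf : LocNil Z.ham₀ f) :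
    LocNil Z.ham₀ (Z.psum n * f) ∧
    gexp Z.ham₀ (Z.psum n * f) = total (((Z.mulX - Z.lax) ^ n) (const (gexp Z.ham₀ f))) := by
  have h1 : LocNil Z.ham (const f) := hf.map (H' := Z.ham) Z.ham_const
  have h2 := gexp_comm_pow_apply Z.ham_mulX Z.ham_lax n h1
  have h3 : ∀ u, Z.ham₀ (total u) = total (Z.ham u) := fun u => (Z.total_ham u).symm
  rw [psum_mul]
  exact ⟨h2.1.map h3, by rw [gexp_map h3 h2.1, h2.2, gexp_map Z.ham_const hf]⟩

/-- A Gaussian functional. -/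
def IsGaussian (I : R →ₗ[ℂ] ℂ) : Prop := ∀ a f, I (Z.d a f) = I (Z.x a * f)

variable {Z} {I : R →ₗ[ℂ] ℂ}

lemma IsGaussian.adjoint (hI : Z.IsGaussian I) (u v : S → R) :
    ∑ a, I ((Z.mulX - Z.lax) u a * v a) = ∑ a, I (u a * Z.lax v a) := by
  have h1 : ∀ a, I (Z.d a (u a) * v a) = I (Z.x a * u a * v a) - I (u a * Z.d a (v a)) := by
    intro a
    have := hI a (u a * v a)
    rw [Derivation.leibniz, map_add, smul_eq_mul, smul_eq_mul, ← mul_assoc, mul_comm (v a)] at this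
    linear_combination this
  have h2 : ∑ a, I ((∑ b, Z.y a b * u b) * v a) = -∑ a, I (u a * ∑ b, Z.y a b * v b) := by
    simp only [Finset.sum_mul, Finset.mul_sum, map_sum]
    rw [Finset.sum_comm, ← Finset.sum_neg_distrib]
    refine Finset.sum_congr rfl fun a _ => ?_
    rw [← Finset.sum_neg_distrib]
    refine Finset.sum_congr rfl fun b _ => ?_
    rw [← map_neg, Z.y_symm a b]
    congr 1; ring
  simp only [LinearMap.sub_apply, Pi.sub_apply, mulX_apply, lax_apply, sub_mul, add_mul, mul_add,
    map_sub, map_add, h1, Finset.sum_sub_distrib, Finset.sum_add_distrib, h2]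
  ring

lemma IsGaussian.adjoint_pow (hI : Z.IsGaussian I) (n : ℕ) (u v : S → R) :
    ∑ a, I (((Z.mulX - Z.lax) ^ n) u a * v a) = ∑ a, I (u a * (Z.lax ^ n) v a) := by
  induction n generalizing u v with
  | zero => rfl
  | succ n ih =>
    rw [pow_succ, pow_succ', Module.End.mul_apply, Module.End.mul_apply, ih, hI.adjoint]

theorem IsGaussian.psum_adjoint (hI : Z.IsGaussian I) (n : ℕ) {f : R} (hf : LocNil Z.ham₀ f)
    (h : R) : I (gexp Z.ham₀ (Z.psum n * f) * h) = I (gexp Z.ham₀ f * Z.integral n h) := by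
  rw [(Z.ham₀_psum hf).2, integral_apply]
  have := hI.adjoint_pow n (const (gexp Z.ham₀ f)) (const h)
  simp only [const_apply] at this
  rw [total_apply, total_apply, Finset.sum_mul, Finset.mul_sum, map_sum, map_sum, this]

variable (Z)

/-- Twice the Euler operator. -/
def euler : R →ₗ[ℂ] R := ∑ a, LinearMap.mulLeft ℂ (Z.x a) ∘ₗ (Z.d a).toLinearMap

lemma euler_apply (f : R) : Z.euler f = ∑ a, Z.x a * Z.d a f := by simp [euler]

lemma euler_mul (f g : R) : Z.euler (f * g) = Z.euler f * g + f * Z.euler g := by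
  simp only [euler_apply, Finset.sum_mul, Finset.mul_sum, ← Finset.sum_add_distrib]
  refine Finset.sum_congr rfl fun a _ => ?_
  rw [Derivation.leibniz]; simp only [smul_eq_mul]; ring

lemma euler_w (a b : S) : Z.euler (Z.w a b) = -2 * Z.w a b := by
  by_cases h : a = b
  · subst h; simp [w_self]
  have h1 := Z.sum_g_mul a Z.x
  have h2 := Z.sum_g_mul b Z.x
  have h3 : Z.euler (Z.w a b) =
      -Z.w a b ^ 2 * ((∑ c, Z.g c a * Z.x c) - ∑ c, Z.g c b * Z.x c) := by
    rw [euler_apply, ← Finset.sum_sub_distrib, Finset.mul_sum]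
    refine Finset.sum_congr rfl fun c _ => ?_
    rw [d_w]; ring
  rw [h3, h1, h2, x_neg, x_neg]
  linear_combination (-2 * Z.w a b) * Z.w_mul a b h

lemma euler_V : Z.euler Z.V = -4 * Z.V := by
  have h : ∀ a b, Z.euler (Z.κ a b * (Z.κ a b + Z.h a b) * Z.w a b ^ 2) =
      -4 * (Z.κ a b * (Z.κ a b + Z.h a b) * Z.w a b ^ 2) := by
    intro a b
    have : Z.euler (Z.κ a b * (Z.κ a b + Z.h a b)) = 0 := by
      rw [euler_apply]
      refine Finset.sum_eq_zero fun c _ => ?_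
      simp [Derivation.leibniz, d_κ, d_h]
    rw [euler_mul, this, sq, euler_mul, euler_w]; ring
  unfold V
  simp only [map_sum, h, Finset.mul_sum]

lemma ham₀_euler (f : R) : Z.ham₀ (Z.euler f) = Z.euler (Z.ham₀ f) + (4 : ℂ) • Z.ham₀ f := by
  have h1 : ∀ c, Z.lap (Z.x c * Z.d c f) = 4 * Z.d c (Z.d c f) + Z.x c * Z.d c (Z.lap f) := by
    intro c
    have e1 : Z.lap (Z.x c) = 0 := by
      rw [lap_apply]
      refine Finset.sum_eq_zero fun e _ => ?_
      rw [Z.d_x']; unfold g; split_ifs <;> simp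
    have e2 : ∑ e, Z.d e (Z.x c) * Z.d e (Z.d c f) = 2 * Z.d c (Z.d c f) := by
      simp only [Z.d_x']
      rw [Z.sum_g_mul c (fun e => Z.d e (Z.d c f)), d_add_neg]; ring
    rw [lap_mul, e1, e2, lap_d]; ring
  have h2 : Z.lap (Z.euler f) = 4 * Z.lap f + Z.euler (Z.lap f) := by
    rw [euler_apply, map_sum, lap_apply Z f, euler_apply, Finset.mul_sum, ← Finset.sum_add_distrib]
    refine Finset.sum_congr rfl fun c _ => ?_
    rw [h1, lap_apply]
  have h3 : (4 : ℂ) • Z.ham₀ f = 4 * Z.ham₀ f := by rw [Algebra.smul_def, map_ofNat]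
  rw [h3, ham₀_apply, ham₀_apply, h2, map_sub, euler_mul, euler_V]
  ring

lemma gexp_euler {f : R} (hf : LocNil Z.ham₀ f) :
    gexp Z.ham₀ (Z.euler f) = Z.euler (gexp Z.ham₀ f) - Z.ham₀ (gexp Z.ham₀ f) :=
  gexp_comm_apply Z.ham₀_euler (fun _ => rfl) hf

variable {Z}

lemma IsGaussian.euler_symm (hI : Z.IsGaussian I) (f g : R) :
    I ((Z.euler f - Z.ham₀ f) * g) = I (f * (Z.euler g - Z.ham₀ g)) := by
  have h : ∀ f g, I ((Z.euler f - Z.ham₀ f) * g) = ∑ a, I (Z.d a f * Z.d a g) + I (Z.V * f * g) := by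
    intro f g
    rw [ham₀_apply, euler_apply, lap_apply, sub_mul, sub_mul, Finset.sum_mul, Finset.sum_mul,
      map_sub, map_sub, map_sum, map_sum]
    have : ∀ a, I (Z.d a (Z.d a f) * g) = I (Z.x a * Z.d a f * g) - I (Z.d a f * Z.d a g) := by
      intro a
      have := hI a (Z.d a f * g)
      rw [Derivation.leibniz, map_add, smul_eq_mul, smul_eq_mul, ← mul_assoc, mul_comm g] at this
      linear_combination this
    simp only [this, Finset.sum_sub_distrib]
    ring
  rw [h, mul_comm f, h]
  congr 1
  · exact Finset.sum_congr rfl fun a _ => by rw [mul_comm]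
  · congr 1; ring

theorem IsGaussian.orthogonal (hI : Z.IsGaussian I) {f g : R} (hf : LocNil Z.ham₀ f)
    (hg : LocNil Z.ham₀ g) {c e : ℂ} (hfc : Z.euler f = c • f) (hge : Z.euler g = e • g)
    (hce : c ≠ e) : I (gexp Z.ham₀ f * gexp Z.ham₀ g) = 0 := by
  have h1 := Z.gexp_euler hf
  have h2 := Z.gexp_euler hg
  rw [hfc, gexp_smul c hf] at h1
  rw [hge, gexp_smul e hg] at h2
  have h3 := hI.euler_symm (gexp Z.ham₀ f) (gexp Z.ham₀ g)
  rw [← h1, ← h2, smul_mul_assoc, mul_smul_comm, map_smul, map_smul, smul_eq_mul, smul_eq_mul] at h3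
  have h4 : (c - e) * I (gexp Z.ham₀ f * gexp Z.ham₀ g) = 0 := by linear_combination h3
  exact (mul_eq_zero.1 h4).resolve_left (sub_ne_zero.2 hce)

lemma sum_x_ell : ∃ M : ℂ, ∑ a, Z.x a * Z.ell a = algebraMap ℂ R M := by
  have h1 : ∑ a, Z.x a * Z.ell a = ∑ a, ∑ b, Z.x a * Z.y a b := by
    simp only [ell, Finset.mul_sum]
  have h2 : ∑ a, Z.x a * Z.ell a = -∑ a, ∑ b, Z.x b * Z.y a b := by
    rw [h1, Finset.sum_comm, ← Finset.sum_neg_distrib]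
    refine Finset.sum_congr rfl fun a _ => ?_
    rw [← Finset.sum_neg_distrib]
    refine Finset.sum_congr rfl fun b _ => ?_
    rw [Z.y_symm a b]; ring
  have h3 : ∀ a b, Z.x a * Z.y a b - Z.x b * Z.y a b = Z.κ a b := by
    intro a b
    by_cases h : a = b
    · subst h; simp [y, κ_self]
    · rw [y]; linear_combination Z.κ a b * Z.w_mul a b h
  have h4 : ∀ a b, ∃ q : ℕ, Z.κ a b = (q : R) := by
    intro a b
    unfold κ
    split_ifs
    · exact ⟨0, by simp⟩
    · exact ⟨2 * Z.m, by push_cast; ring⟩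
    · exact ⟨Z.k, rfl⟩
  choose q hq using h4
  refine ⟨2⁻¹ * ∑ a, ∑ b, (q a b : ℂ), ?_⟩
  have h5 : (2 : R) * ∑ a, Z.x a * Z.ell a = ∑ a, ∑ b, (q a b : R) := by
    rw [two_mul]
    nth_rewrite 1 [h1]
    rw [h2, ← sub_eq_add_neg]
    simp only [← Finset.sum_sub_distrib, h3, hq]
  have h6 : algebraMap ℂ R 2⁻¹ * 2 = 1 := by
    rw [← map_ofNat (algebraMap ℂ R) 2, ← map_mul]; norm_num
  rw [map_mul, map_sum]
  simp only [map_sum, map_natCast]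
  rw [← h5, ← mul_assoc, h6, one_mul]

variable (Z)

/-- The degree of the weight. -/
def weightDeg : ℂ := (Z.sum_x_ell).choose

lemma euler_weight {θ : R} (hθ : ∀ a, Z.d a θ = -Z.ell a * θ) :
    Z.euler θ = -Z.weightDeg • θ := by
  have h : ∑ a, Z.x a * Z.ell a = algebraMap ℂ R Z.weightDeg := (Z.sum_x_ell).choose_spec
  rw [euler_apply, neg_smul, Algebra.smul_def, ← h, Finset.sum_mul, ← Finset.sum_neg_distrib]
  refine Finset.sum_congr rfl fun a _ => ?_
  rw [hθ]; ring

end SignedData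

end

section

/-- A graded space of polynomials stable under the scalar Hamiltonian and under multiplication by
power sums, with a nondegenerate Gaussian pairing. -/
structure GradedPairing (n : ℕ) (S R : Type) [Fintype S] [DecidableEq S] [CommRing R]
    [Algebra ℂ R] where
  Z : SignedData S R
  I : R →ₗ[ℂ] ℂ
  gaussian : Z.IsGaussian I
  τ : MvPolynomial (Fin n) ℂ →ₗ[ℂ] R
  τ_inj : Function.Injective τ
  piece : ℕ → Submodule ℂ (MvPolynomial (Fin n) ℂ)
  piece_le : ∀ d, piece d ≤ homogeneousSubmodule (Fin n) ℂ d
  pow : ℕ → MvPolynomial (Fin n) ℂ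
  pow_mul_mem : ∀ k d q, 1 ≤ k → q ∈ piece d → pow k * q ∈ piece (d + 2 * k)
  psum_mul_τ : ∀ k q, 1 ≤ k → Z.psum (2 * k) * τ q = (2 : ℂ) • τ (pow k * q)
  ham_lt : ∀ d q, d < 2 → q ∈ piece d → Z.ham₀ (τ q) = 0
  ham_mem : ∀ d q, q ∈ piece (d + 2) → ∃ q' ∈ piece d, Z.ham₀ (τ q) = τ q'
  shift : ℂ
  euler_τ : ∀ d q, q ∈ piece d → Z.euler (τ q) = (2 * (d : ℂ) + shift) • τ q
  nondeg : ∀ r, (∀ d, ∀ q ∈ piece d, I (τ q * r) = 0) → r = 0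
  bound : ℕ
  hol : Submodule ℂ R
  hol_fin : FiniteDimensional ℂ hol
  hol_le : Module.finrank ℂ hol ≤ bound
  mem_hol : ∀ p, (∀ k, 1 ≤ k → Z.integral (2 * k) p = 0) → (∃ q, p = τ q) → p ∈ hol

lemma gexp_injective {E : Type} [AddCommGroup E] [Module ℂ E] {H : E →ₗ[ℂ] E} {v : E}
    (hv : LocNil H v) (h : gexp H v = 0) : v = 0 := by
  classical
  by_contra hne
  have hK := Nat.find_spec hv
  set K := Nat.find hv with hKdef
  have hK0 : K ≠ 0 := by
    intro h0
    rw [h0] at hK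
    exact hne hK
  obtain ⟨L, hL⟩ := Nat.exists_eq_succ_of_ne_zero hK0
  have hmin : (H ^ L) v ≠ 0 := Nat.find_min hv (by omega)
  apply hmin
  have h1 := congrArg (H ^ L) h
  rw [gexp_eq hK, hL, Finset.sum_range_succ', map_add, map_sum, map_zero] at h1
  rw [Finset.sum_eq_zero, zero_add] at h1
  · simpa [expCoeff_zero] using h1
  · intro j _
    rw [map_smul, ← Module.End.mul_apply, ← pow_add, pow_eq_zero_of_le' hK (by omega), smul_zero]

/-- Vectors on which the operator is locally nilpotent, as a submodule. -/
def locNilSub {E : Type} [AddCommGroup E] [Module ℂ E] (H : E →ₗ[ℂ] E) : Submodule ℂ E where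
  carrier := {v | LocNil H v}
  add_mem' := LocNil.add
  zero_mem' := locNil_zero H
  smul_mem' c _ h := h.smul c

/-- The exponential as a linear map on locally nilpotent vectors. -/
def gexpLin {E : Type} [AddCommGroup E] [Module ℂ E] (H : E →ₗ[ℂ] E) : locNilSub H →ₗ[ℂ] E where
  toFun v := gexp H v.1
  map_add' u v := gexp_add u.2 v.2
  map_smul' c u := gexp_smul c u.2

namespace GradedPairing

variable {n : ℕ} {S R : Type} [Fintype S] [DecidableEq S] [CommRing R] [Algebra ℂ R]
variable (Y : GradedPairing n S R)

lemma locNil {d : ℕ} {q} (hq : q ∈ Y.piece d) : LocNil Y.Z.ham₀ (Y.τ q) := by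
  induction d using Nat.strong_induction_on generalizing q with
  | _ d ih =>
    by_cases hd : d < 2
    · exact ⟨1, by simpa using Y.ham_lt d q hd hq⟩
    · obtain ⟨e, rfl⟩ := Nat.exists_eq_add_of_le (not_lt.1 hd)
      rw [add_comm] at hq
      obtain ⟨q', hq', h⟩ := Y.ham_mem e q hq
      obtain ⟨K, hK⟩ := ih e (by omega) hq'
      exact ⟨K + 1, by rw [pow_succ, Module.End.mul_apply, h, hK]⟩

lemma exists_gexp {d : ℕ} {q} (hq : q ∈ Y.piece d) :
    ∃ p, gexp Y.Z.ham₀ (Y.τ q) = Y.τ p := by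
  have : ∀ j, ∃ p, (Y.Z.ham₀ ^ j) (Y.τ q) = Y.τ p := by
    have h0 : ∀ j, ∀ d, ∀ q ∈ Y.piece d, ∃ p, (Y.Z.ham₀ ^ j) (Y.τ q) = Y.τ p := by
      intro j
      induction j with
      | zero => exact fun d q _ => ⟨q, rfl⟩
      | succ j ih =>
        intro d q hq
        rw [pow_succ, Module.End.mul_apply]
        by_cases hd : d < 2
        · exact ⟨0, by rw [Y.ham_lt d q hd hq]; simp⟩
        · obtain ⟨e, rfl⟩ := Nat.exists_eq_add_of_le (not_lt.1 hd)
          rw [add_comm] at hq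
          obtain ⟨q', hq', h⟩ := Y.ham_mem e q hq
          rw [h]; exact ih e q' hq'
    exact fun j => h0 j d q hq
  choose p hp using this
  obtain ⟨K, hK⟩ := Y.locNil hq
  refine ⟨∑ j ∈ Finset.range K, expCoeff j • p j, ?_⟩
  rw [gexp_eq hK, map_sum]
  simp only [hp, map_smul]

lemma pow_ham_pairing {r : R} {d : ℕ}
    (hr : ∀ e < d, ∀ q ∈ Y.piece e, Y.I (Y.τ q * r) = 0) (j : ℕ) {q} (hq : q ∈ Y.piece d) :
    Y.I ((Y.Z.ham₀ ^ (j + 1)) (Y.τ q) * r) = 0 := by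
  induction j generalizing d q with
  | zero =>
    rw [zero_add, pow_one]
    by_cases hd : d < 2
    · rw [Y.ham_lt d q hd hq]; simp
    · obtain ⟨e, rfl⟩ := Nat.exists_eq_add_of_le (not_lt.1 hd)
      rw [add_comm] at hq
      obtain ⟨q', hq', h⟩ := Y.ham_mem e q hq
      rw [h]; exact hr e (by omega) q' hq'
  | succ j ih =>
    rw [pow_succ, Module.End.mul_apply]
    by_cases hd : d < 2
    · rw [Y.ham_lt d q hd hq]; simp
    · obtain ⟨e, rfl⟩ := Nat.exists_eq_add_of_le (not_lt.1 hd)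
      rw [add_comm] at hq
      obtain ⟨q', hq', h⟩ := Y.ham_mem e q hq
      rw [h]; exact ih (fun e' he' => hr e' (by omega)) hq'

lemma eq_zero_of_gexp_pairing {r : R}
    (hr : ∀ d, ∀ q ∈ Y.piece d, Y.I (gexp Y.Z.ham₀ (Y.τ q) * r) = 0) : r = 0 := by
  apply Y.nondeg
  intro d
  induction d using Nat.strong_induction_on with
  | _ d ih =>
    intro q hq
    obtain ⟨K, hK⟩ := Y.locNil hq
    have h := hr d q hq
    rw [gexp_eq (pow_eq_zero_of_le' hK K.le_succ), Finset.sum_range_succ', add_mul,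
      Finset.sum_mul, map_add, map_sum, Finset.sum_eq_zero, zero_add] at h
    · simpa [expCoeff_zero] using h
    · intro j _
      rw [smul_mul_assoc, map_smul, Y.pow_ham_pairing ih j hq, smul_zero]

/-- The pairing on a graded piece. -/
def form (d : ℕ) : LinearMap.BilinForm ℂ (Y.piece d) :=
  let U : Y.piece d →ₗ[ℂ] R := gexpLin Y.Z.ham₀ ∘ₗ
    (Y.τ ∘ₗ (Y.piece d).subtype).codRestrict (locNilSub Y.Z.ham₀) fun q => Y.locNil q.2
  ((LinearMap.mul ℂ R).compl₁₂ U U).compr₂ Y.I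

lemma form_apply (d : ℕ) (p q : Y.piece d) : Y.form d p q =
    Y.I (gexp Y.Z.ham₀ (Y.τ p) * gexp Y.Z.ham₀ (Y.τ q)) := rfl

lemma pairing_ne {d e : ℕ} (hde : d ≠ e) {p q} (hp : p ∈ Y.piece d) (hq : q ∈ Y.piece e) :
    Y.I (gexp Y.Z.ham₀ (Y.τ p) * gexp Y.Z.ham₀ (Y.τ q)) = 0 := by
  refine Y.gaussian.orthogonal (Y.locNil hp) (Y.locNil hq) (Y.euler_τ d p hp) (Y.euler_τ e q hq) ?_
  intro h
  apply hde
  have : (d : ℂ) = e := by linear_combination h / 2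
  exact_mod_cast this

instance (d : ℕ) : FiniteDimensional ℂ (Y.piece d) := by
  have : Y.piece d ≤ restrictTotalDegree (Fin n) ℂ d := by
    intro p hp
    rw [mem_restrictTotalDegree]
    exact ((mem_homogeneousSubmodule d p).1 (Y.piece_le d hp)).totalDegree_le
  exact Submodule.finiteDimensional_of_le this

lemma form_symm (d : ℕ) : (Y.form d).IsSymm := ⟨fun p q => by
  simp only [form_apply]; rw [mul_comm]⟩

lemma form_nondeg (d : ℕ) : (Y.form d).Nondegenerate := by
  have h : ∀ q : Y.piece d, (∀ p, Y.form d p q = 0) → q = 0 := by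
    intro q hq
    have : gexp Y.Z.ham₀ (Y.τ q) = 0 := by
      apply Y.eq_zero_of_gexp_pairing
      intro e p hp
      by_cases he : e = d
      · subst he; exact hq ⟨p, hp⟩
      · exact Y.pairing_ne he hp q.2
    have := gexp_injective (Y.locNil q.2) this
    rw [← map_zero Y.τ] at this
    exact Subtype.ext (Y.τ_inj this)
  refine ⟨fun q hq => h q fun p => ?_, fun q hq => h q hq⟩
  rw [← hq p]
  exact (Y.form_symm d).eq p q

/-- The decomposable part of a graded piece. -/
def decomp (d : ℕ) : Submodule ℂ (Y.piece d) :=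
  Submodule.span ℂ {q | ∃ k e, ∃ p ∈ Y.piece e, 1 ≤ k ∧ d = e + 2 * k ∧
    (q : MvPolynomial (Fin n) ℂ) = Y.pow k * p}

/-- The orthogonal complement of the decomposable part. -/
def orth (d : ℕ) : Submodule ℂ (MvPolynomial (Fin n) ℂ) :=
  ((Y.form d).orthogonal (Y.decomp d)).map (Y.piece d).subtype

lemma orth_le (d : ℕ) : Y.orth d ≤ Y.piece d := Submodule.map_subtype_le _ _

lemma gexp_mem_hol {d : ℕ} {q} (hq : q ∈ Y.orth d) : gexp Y.Z.ham₀ (Y.τ q) ∈ Y.hol := by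
  obtain ⟨q, hq, rfl⟩ := hq
  refine Y.mem_hol _ (fun k hk => ?_) (Y.exists_gexp q.2)
  apply Y.eq_zero_of_gexp_pairing
  intro e p hp
  rw [← Y.gaussian.psum_adjoint (2 * k) (Y.locNil hp), Y.psum_mul_τ k p hk]
  have hkp := Y.pow_mul_mem k e p hk hp
  rw [gexp_smul _ (Y.locNil hkp), smul_mul_assoc, map_smul]
  convert smul_zero _
  by_cases he : e + 2 * k = d
  · subst he
    exact hq ⟨_, hkp⟩ (Submodule.subset_span ⟨k, e, p, hp, hk, rfl, rfl⟩)
  · exact Y.pairing_ne he hkp q.2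

/-- The rank of the indecomposable quotient. -/
def rk (d : ℕ) : ℕ := Module.finrank ℂ (Y.orth d)

lemma sum_rk_le (D : ℕ) : ∑ d ∈ Finset.range D, Y.rk d ≤ Y.bound := by
  have := Y.hol_fin
  have hfin : ∀ d, FiniteDimensional ℂ (Y.orth d) := fun d =>
    Submodule.finiteDimensional_of_le (Y.orth_le d)
  let U : (d : ℕ) → Y.orth d →ₗ[ℂ] locNilSub Y.Z.ham₀ := fun d =>
    (Y.τ ∘ₗ (Y.orth d).subtype).codRestrict
      (locNilSub Y.Z.ham₀) fun q => Y.locNil (Y.orth_le d q.2)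
  let Φ : ((d : Fin D) → Y.orth d) →ₗ[ℂ] R :=
    ∑ d : Fin D, gexpLin Y.Z.ham₀ ∘ₗ U d ∘ₗ LinearMap.proj d
  have hΦ : ∀ v, Φ v = ∑ d : Fin D, gexp Y.Z.ham₀ (Y.τ (v d).1) := by
    intro v
    simp only [Φ, LinearMap.sum_apply]
    rfl
  have hΦmem : ∀ v, Φ v ∈ Y.hol := by
    intro v
    rw [hΦ]
    exact Submodule.sum_mem _ fun d _ => Y.gexp_mem_hol (v d).2
  have hinj : Function.Injective Φ := by
    refine (injective_iff_map_eq_zero Φ).2 fun v hv => ?_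
    have h1 : Φ v = gexpLin Y.Z.ham₀ (∑ d : Fin D, U d (v d)) := by
      rw [map_sum]; simp only [Φ, LinearMap.sum_apply]; rfl
    rw [h1] at hv
    have h2 := gexp_injective (Subtype.property _) hv
    have h3 : Y.τ (∑ d : Fin D, (v d).1) = 0 := by
      rw [map_sum, ← h2, AddSubmonoidClass.coe_finsetSum]; rfl
    rw [← map_zero Y.τ] at h3
    have h4 := Y.τ_inj h3
    funext d
    have h5 := congrArg (homogeneousComponent (d : ℕ)) h4
    rw [map_sum, map_zero, Finset.sum_eq_single d] at h5
    · rw [homogeneousComponent_of_mem (Y.piece_le _ (Y.orth_le _ (v d).2)), if_pos rfl] at h5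
      exact Subtype.ext h5
    · intro e _ he
      rw [homogeneousComponent_of_mem (Y.piece_le _ (Y.orth_le _ (v e).2)), if_neg]
      exact fun h => he (Fin.ext h.symm)
    · simp
  have h6 := LinearMap.finrank_le_finrank_of_injective
    (f := Φ.codRestrict Y.hol hΦmem) (by
      intro u v huv
      exact hinj (congrArg Subtype.val huv))
  rw [Module.finrank_pi_fintype] at h6
  rw [Finset.sum_range]
  exact h6.trans Y.hol_le

omit [Fintype S] [DecidableEq S] [CommRing R] [Algebra ℂ R] in
lemma exists_complement {V : Type} [AddCommGroup V] [Module ℂ V] [FiniteDimensional ℂ V]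
    {B : LinearMap.BilinForm ℂ V} (hB : B.Nondegenerate) (A : Submodule ℂ V) :
    ∃ v : Fin (Module.finrank ℂ (B.orthogonal A)) → V,
      A ⊔ Submodule.span ℂ (Set.range v) = ⊤ := by
  obtain ⟨C, hC⟩ := Submodule.exists_isCompl A
  have h1 := LinearMap.BilinForm.finrank_orthogonal hB A
  have h2 := Submodule.finrank_add_eq_of_isCompl hC
  have h3 : Module.finrank ℂ C = Module.finrank ℂ (B.orthogonal A) := by omega
  let b := Module.finBasisOfFinrankEq ℂ C h3
  refine ⟨fun i => (b i).1, ?_⟩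
  have : Submodule.span ℂ (Set.range fun i => (b i).1) = C := by
    have h4 := congrArg (Submodule.map C.subtype) b.span_eq
    rw [Submodule.map_span, ← Set.range_comp, Submodule.map_top, Submodule.range_subtype] at h4
    exact h4
  rw [this]
  exact hC.sup_eq_top

lemma exists_family (d : ℕ) : ∃ v : Fin (Y.rk d) → Y.piece d,
    Y.decomp d ⊔ Submodule.span ℂ (Set.range v) = ⊤ := by
  have h : Y.rk d = Module.finrank ℂ ((Y.form d).orthogonal (Y.decomp d)) :=
    LinearEquiv.finrank_eq (Submodule.equivSubtypeMap _ _).symm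
  rw [h]
  exact exists_complement (Y.form_nondeg d) (Y.decomp d)

theorem exists_generators : ∃ (v : Fin Y.bound → MvPolynomial (Fin n) ℂ) (δ : Fin Y.bound → ℕ),
    (∀ i, v i ∈ Y.piece (δ i)) ∧
    ∀ d, Y.piece d ≤ Submodule.span ℂ {q | ∃ k e, ∃ p ∈ Y.piece e, 1 ≤ k ∧ d = e + 2 * k ∧
      q = Y.pow k * p} ⊔ Submodule.span ℂ {q | ∃ i, δ i = d ∧ q = v i} := by
  classical
  choose v hv using Y.exists_family
  obtain ⟨D, hD⟩ : ∃ D, ∀ d, D ≤ d → Y.rk d = 0 := by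
    have hfin : {d | Y.rk d ≠ 0}.Finite := by
      by_contra hinf
      obtain ⟨t, ht, hcard⟩ := Set.Infinite.exists_subset_card_eq hinf (Y.bound + 1)
      obtain ⟨D, hD⟩ := t.exists_nat_subset_range
      have h1 := Finset.sum_le_sum_of_subset (f := Y.rk) hD
      have h2 : t.card • 1 ≤ ∑ d ∈ t, Y.rk d :=
        Finset.card_nsmul_le_sum t _ 1 fun d hd => Nat.one_le_iff_ne_zero.2 (ht hd)
      have h3 := Y.sum_rk_le D
      rw [smul_eq_mul] at h2
      omega
    obtain ⟨D, hD⟩ := hfin.toFinset.exists_nat_subset_range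
    refine ⟨D, fun d hd => ?_⟩
    by_contra h
    have := hD (hfin.mem_toFinset.2 h)
    rw [Finset.mem_range] at this
    omega
  have hcard : Fintype.card (Σ d : Fin D, Fin (Y.rk d)) ≤ Fintype.card (Fin Y.bound) := by
    rw [Fintype.card_sigma, Fintype.card_fin]
    simp only [Fintype.card_fin]
    rw [← Finset.sum_range (fun d => Y.rk d)]
    exact Y.sum_rk_le D
  obtain ⟨φ⟩ := Function.Embedding.nonempty_of_card_le hcard
  let v' : Fin Y.bound → MvPolynomial (Fin n) ℂ := fun i =>
    if h : ∃ s, φ s = i then (v h.choose.1 h.choose.2).1 else 0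
  let δ : Fin Y.bound → ℕ := fun i => if h : ∃ s, φ s = i then h.choose.1 else 0
  have hφ : ∀ s, v' (φ s) = (v s.1 s.2).1 ∧ δ (φ s) = s.1 := by
    intro s
    have h : ∃ s', φ s' = φ s := ⟨s, rfl⟩
    have h1 : h.choose = s := φ.injective h.choose_spec
    simp only [v', δ, dif_pos h]
    rw [h1]
    exact ⟨rfl, rfl⟩
  refine ⟨v', δ, fun i => ?_, fun d => ?_⟩
  · by_cases h : ∃ s, φ s = i
    · simp only [v', δ, dif_pos h]
      exact Subtype.property _
    · simp only [v', δ, dif_neg h]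
      exact Submodule.zero_mem _
  · intro q hq
    have h1 : (⟨q, hq⟩ : Y.piece d) ∈ Y.decomp d ⊔ Submodule.span ℂ (Set.range (v d)) := by
      rw [hv]; trivial
    have h2 := Submodule.mem_map_of_mem (f := (Y.piece d).subtype) h1
    rw [Submodule.map_sup] at h2
    refine SetLike.le_def.1 (sup_le_sup ?_ ?_) h2
    · rw [decomp, Submodule.map_span]
      apply Submodule.span_mono
      rintro _ ⟨q, ⟨k, e, p, hp, hk, hd, hqp⟩, rfl⟩
      exact ⟨k, e, p, hp, hk, hd, hqp⟩
    · rw [Submodule.map_span, ← Set.range_comp]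
      apply Submodule.span_mono
      rintro _ ⟨i, rfl⟩
      have hdD : d < D := by
        by_contra h
        have := hD d (not_lt.1 h)
        rw [this] at i
        exact i.elim0
      have := hφ ⟨⟨d, hdD⟩, i⟩
      exact ⟨_, this.2, this.1.symm⟩

end GradedPairing

end

section

section Hyperplane

variable {n : ℕ}

lemma X_sub_dvd_sub_subst (j : Fin n) (q p : MvPolynomial (Fin n) ℂ) :
    X j - q ∣ p - aeval (fun i => if i = j then q else X i) p := by
  rw [← Ideal.mem_span_singleton, ← Ideal.Quotient.mk_eq_mk_iff_sub_mem]
  have : (Ideal.Quotient.mkₐ ℂ (Ideal.span {X j - q})) =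
      (Ideal.Quotient.mkₐ ℂ (Ideal.span {X j - q})).comp
        (aeval (fun i => if i = j then q else X i)) := by
    apply MvPolynomial.algHom_ext
    intro i
    rw [AlgHom.comp_apply, aeval_X]
    split_ifs with h
    · subst h
      rw [Ideal.Quotient.mkₐ_eq_mk, Ideal.Quotient.mk_eq_mk_iff_sub_mem]
      exact Ideal.mem_span_singleton_self _
    · rfl
  exact DFunLike.congr_fun this p

lemma eval_subst (j : Fin n) (q p : MvPolynomial (Fin n) ℂ) (v : Fin n → ℂ) :
    eval v (aeval (fun i => if i = j then q else X i) p) =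
      eval (Function.update v j (eval v q)) p := by
  rw [aeval_def, eval_eval₂]
  have : ((eval v).comp (algebraMap ℂ (MvPolynomial (Fin n) ℂ))) = RingHom.id ℂ := by
    ext c; simp [algebraMap_eq]
  rw [this, eval₂_id]
  congr 2
  funext i
  by_cases h : i = j
  · subst h; simp
  · simp [h]

/-- A polynomial vanishing at the points of the graph hyperplane `x_j = q` where `h` does not
vanish is divisible by `x_j - q`. -/
lemma X_sub_dvd_of_vanish (j : Fin n) (q h p : MvPolynomial (Fin n) ℂ)
    (hq : ∀ v c, eval (Function.update v j c) q = eval v q)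
    (v₀ : Fin n → ℂ) (hv₀ : v₀ j = eval v₀ q) (hh : eval v₀ h ≠ 0)
    (hp : ∀ v : Fin n → ℂ, v j = eval v q → eval v h ≠ 0 → eval v p = 0) : X j - q ∣ p := by
  set φ := aeval (R := ℂ) (fun i => if i = j then q else (X i : MvPolynomial (Fin n) ℂ)) with hφ
  have h1 : φ (p * h) = 0 := by
    apply MvPolynomial.funext
    intro v
    rw [map_zero, hφ, eval_subst, map_mul]
    by_cases h0 : eval (Function.update v j (eval v q)) h = 0
    · rw [h0, mul_zero]
    · rw [hp _ _ h0, zero_mul]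
      rw [hq]; simp
  have h2 : φ h ≠ 0 := by
    intro h0
    have := congrArg (eval v₀) h0
    rw [hφ, eval_subst, ← hv₀, Function.update_eq_self, map_zero] at this
    exact hh this
  have h3 : φ p = 0 := by
    rw [map_mul] at h1
    exact (mul_eq_zero.1 h1).resolve_right h2
  have := X_sub_dvd_sub_subst j q p
  rwa [← hφ, h3, sub_zero] at this

end Hyperplane

/-- Signed indices. -/
abbrev Sg (N : ℕ) := Fin N × ℤˣ

namespace Sg

variable {N : ℕ}

/-- The sign of an index. -/
def sg (a : Sg N) : ℂ := ((a.2 : ℤ) : ℂ)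

/-- The opposite index. -/
def ng (a : Sg N) : Sg N := (a.1, -a.2)

lemma sg_mul_self (a : Sg N) : a.sg * a.sg = 1 := by
  rcases Int.units_eq_one_or a.2 with h | h <;> simp [sg, h]

lemma sg_ne_zero (a : Sg N) : a.sg ≠ 0 := fun h => by simpa [h] using a.sg_mul_self

lemma sg_ng (a : Sg N) : a.ng.sg = -a.sg := by simp [sg, ng]

@[simp] lemma ng_ng (a : Sg N) : a.ng.ng = a := by simp [ng]

@[simp] lemma ng_fst (a : Sg N) : a.ng.1 = a.1 := rfl

lemma ng_ne (a : Sg N) : a.ng ≠ a := by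
  intro h
  have h1 : -a.2 = a.2 := congrArg Prod.snd h
  rcases Int.units_eq_one_or a.2 with h2 | h2 <;> rw [h2] at h1 <;> exact absurd h1 (by decide)

lemma ng_inj {a b : Sg N} : a.ng = b.ng ↔ a = b :=
  ⟨fun h => by rw [← a.ng_ng, h, ng_ng], fun h => by rw [h]⟩

lemma ng_eq {a b : Sg N} : a.ng = b ↔ a = b.ng :=
  ⟨fun h => by rw [← h, ng_ng], fun h => by rw [h, ng_ng]⟩

lemma eq_or_eq_ng {a b : Sg N} (h : a.1 = b.1) : a = b ∨ a = b.ng := by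
  by_cases h2 : a.2 = b.2
  · exact Or.inl (Prod.ext h h2)
  · refine Or.inr (Prod.ext h ?_)
    change a.2 = -b.2
    rcases Int.units_eq_one_or a.2 with h3 | h3 <;> rcases Int.units_eq_one_or b.2 with h4 | h4 <;>
      simp [h3, h4] at h2 ⊢

lemma fst_ne {a b : Sg N} (h : b ≠ a) (h' : b ≠ a.ng) : b.1 ≠ a.1 := fun h1 =>
  (eq_or_eq_ng h1).elim h h'

/-- The coordinate of a vector along a signed index. -/
def co (a : Sg N) (v : Fin N → ℂ) : ℂ := a.sg * v a.1

/-- The signed basis vector. -/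
def bv (a : Sg N) : Fin N → ℂ := Pi.single a.1 a.sg

lemma co_ng (a : Sg N) (v) : a.ng.co v = -a.co v := by simp [co, sg_ng]

lemma bv_ng (a : Sg N) : a.ng.bv = -a.bv := by simp [bv, sg_ng, Pi.single_neg]

lemma co_add (a : Sg N) (v w) : a.co (v + w) = a.co v + a.co w := by simp [co, mul_add]

lemma co_sub (a : Sg N) (v w) : a.co (v - w) = a.co v - a.co w := by simp [co, mul_sub]

lemma co_smul (a : Sg N) (c : ℂ) (v) : a.co (c • v) = c * a.co v := by simp [co]; ring

lemma co_bv_self (a : Sg N) : a.co a.bv = 1 := by simp [co, bv, sg_mul_self]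

lemma co_bv (a b : Sg N) :
    a.co b.bv = (if b = a then 1 else 0) - (if b = a.ng then 1 else 0) := by
  by_cases h1 : b = a
  · subst h1; simp [co_bv_self, (ng_ne b).symm]
  by_cases h2 : b = a.ng
  · subst h2; simp [bv_ng, ng_ne]
    have := co_bv_self a
    simp [co] at this ⊢; exact this
  · have := fst_ne h1 h2
    simp [h1, h2, co, bv, this.symm]

lemma apply_eq_co (v : Fin N → ℂ) (j : Fin N) : v j = co (j, 1) v := by simp [co, sg]

lemma ext_co {v w : Fin N → ℂ} (h : ∀ a, co a v = co a w) : v = w := by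
  funext j
  rw [apply_eq_co v, h, ← apply_eq_co]

/-- The linear polynomial of a signed index. -/
def lin (a : Sg N) : MvPolynomial (Fin N) ℂ := C a.sg * X a.1

@[simp] lemma eval_lin (a : Sg N) (v) : eval v a.lin = a.co v := by simp [lin, co]

lemma lin_ng (a : Sg N) : a.ng.lin = -a.lin := by simp [lin, sg_ng]

/-- Action of a permutation of signed indices on vectors. -/
def act (π : Equiv.Perm (Sg N)) (v : Fin N → ℂ) : Fin N → ℂ := fun j => co (π.symm (j, 1)) v

/-- Permutations commuting with the sign. -/
def Odd (π : Equiv.Perm (Sg N)) : Prop := ∀ a : Sg N, π a.ng = (π a).ng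

lemma Odd.symm {π : Equiv.Perm (Sg N)} (h : Odd π) : Odd π.symm := fun a => by
  rw [Equiv.symm_apply_eq, h, Equiv.apply_symm_apply]

lemma co_act {π : Equiv.Perm (Sg N)} (h : Odd π) (a : Sg N) (v) :
    a.co (act π v) = co (π.symm a) v := by
  rcases Int.units_eq_one_or a.2 with h2 | h2
  · have : a = (a.1, 1) := Prod.ext rfl h2
    rw [this, ← apply_eq_co]; rfl
  · have : a = ng (a.1, 1) := Prod.ext rfl h2
    rw [this, h.symm, co_ng, co_ng, ← apply_eq_co]; rfl

lemma act_bv {π : Equiv.Perm (Sg N)} (h : Odd π) (a : Sg N) : act π a.bv = (π a).bv := by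
  apply ext_co
  intro c
  rw [co_act h, co_bv, co_bv, ← h.symm]
  simp only [Equiv.eq_symm_apply]

lemma act_add {π : Equiv.Perm (Sg N)} (h : Odd π) (v w) : act π (v + w) = act π v + act π w :=
  ext_co fun a => by simp only [co_add, co_act h]

lemma act_smul {π : Equiv.Perm (Sg N)} (h : Odd π) (c : ℂ) (v) : act π (c • v) = c • act π v :=
  ext_co fun a => by simp only [co_smul, co_act h]

/-- The transposition of `a` and `b`, together with that of their opposites. -/
def rs (a b : Sg N) : Equiv.Perm (Sg N) :=
  if b = a.ng then Equiv.swap a a.ng else Equiv.swap a b * Equiv.swap a.ng b.ng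

lemma rs_ng (a : Sg N) : rs a a.ng = Equiv.swap a a.ng := by simp [rs]

lemma rs_apply {a b : Sg N} (h : b ≠ a) (h' : b ≠ a.ng) (c : Sg N) : rs a b c =
    if c = a then b else if c = b then a else if c = a.ng then b.ng else
      if c = b.ng then a.ng else c := by
  have h1 : a ≠ b := h.symm
  have h2 : a.ng ≠ b := h'.symm
  have h3 : a ≠ b.ng := fun e => h2 (ng_eq.2 e)
  have h4 : a.ng ≠ b.ng := fun e => h1 (ng_inj.1 e)
  have h5 := ng_ne a
  have h6 := ng_ne b
  rw [rs, if_neg h', Equiv.Perm.mul_apply]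
  simp only [Equiv.swap_apply_def]
  split_ifs <;> grind

lemma rs_odd (a b : Sg N) (h : b ≠ a) : Odd (rs a b) := by
  intro c
  by_cases h' : b = a.ng
  · subst h'
    have := ng_ne a
    have e1 : c.ng = a ↔ c = a.ng := ng_eq
    have e2 : c.ng = a.ng ↔ c = a := ng_inj
    rw [rs_ng]
    simp only [Equiv.swap_apply_def, e1, e2]
    split_ifs with h1 h2 h2
    · rw [h2] at h1; exact absurd h1.symm this
    · rfl
    · rw [ng_ng]
    · rfl
  · rw [rs_apply h h', rs_apply h h']
    have h1 : a ≠ b := h.symm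
    have h2 : a.ng ≠ b := fun e => h' e.symm
    have h3 : a ≠ b.ng := fun e => h2 (ng_eq.2 e)
    have h4 : a.ng ≠ b.ng := fun e => h1 (ng_inj.1 e)
    have h5 := ng_ne a
    have h6 := ng_ne b
    have e1 : c.ng = a ↔ c = a.ng := ng_eq
    have e2 : c.ng = a.ng ↔ c = a := ng_inj
    have e3 : c.ng = b ↔ c = b.ng := ng_eq
    have e4 : c.ng = b.ng ↔ c = b := ng_inj
    simp only [e1, e2, e3, e4]
    split_ifs <;> grind [ng_ng]

lemma rs_symm (a b : Sg N) (h : b ≠ a) : (rs a b).symm = rs a b := by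
  by_cases h' : b = a.ng
  · subst h'; rw [rs_ng, Equiv.symm_swap]
  · ext1 c
    rw [Equiv.symm_apply_eq, rs_apply h h', rs_apply h h']
    have h1 : a ≠ b := h.symm
    have h2 : a.ng ≠ b := fun e => h' e.symm
    have h3 : a ≠ b.ng := fun e => h2 (ng_eq.2 e)
    have h4 : a.ng ≠ b.ng := fun e => h1 (ng_inj.1 e)
    have h5 := ng_ne a
    have h6 := ng_ne b
    split_ifs <;> grind

lemma act_act (a b : Sg N) (h : b ≠ a) (v) : act (rs a b) (act (rs a b) v) = v := by
  apply ext_co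
  intro c
  rw [co_act (rs_odd a b h), co_act (rs_odd a b h), rs_symm a b h]
  congr 1
  nth_rewrite 1 [← rs_symm a b h]
  simp

lemma act_rs {a b : Sg N} (h : b ≠ a) (h' : b ≠ a.ng) (v) :
    act (rs a b) v = v - (co a v - co b v) • a.bv + (co a v - co b v) • b.bv := by
  apply ext_co
  intro c
  rw [co_act (rs_odd a b h), rs_symm a b h, rs_apply h h']
  simp only [co_add, co_sub, co_smul, co_bv]
  have h1 : a ≠ b := h.symm
  have h2 : a.ng ≠ b := h'.symm
  have h3 : a ≠ b.ng := fun e => h2 (ng_eq.2 e)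
  have h4 : a.ng ≠ b.ng := fun e => h1 (ng_inj.1 e)
  have e1 : a = c.ng ↔ c = a.ng := ⟨fun e => (ng_eq.2 e).symm, fun e => by rw [e, ng_ng]⟩
  have e2 : b = c.ng ↔ c = b.ng := ⟨fun e => (ng_eq.2 e).symm, fun e => by rw [e, ng_ng]⟩
  have e3 : a = c ↔ c = a := eq_comm
  have e4 : b = c ↔ c = b := eq_comm
  have h5 := ng_ne a
  have h6 := ng_ne b
  simp only [e1, e2, e3, e4]
  by_cases c1 : c = a
  · subst c1; simp [h1, h3, h5.symm]
  by_cases c2 : c = b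
  · subst c2; simp [h, h2.symm, h6.symm]
  by_cases c3 : c = a.ng
  · subst c3; simp [h5, h2, h4, co_ng]; ring
  by_cases c4 : c = b.ng
  · subst c4; simp [h3.symm, h4.symm, h6, co_ng]; ring
  · simp [c1, c2, c3, c4]

lemma act_rs_ng (a : Sg N) (v) : act (rs a a.ng) v = v - (2 * co a v) • a.bv := by
  apply ext_co
  intro c
  have h5 := ng_ne a
  rw [co_act (rs_odd _ _ h5), rs_symm _ _ h5, rs_ng, Equiv.swap_apply_def]
  simp only [co_sub, co_smul, co_bv]
  have e1 : a = c.ng ↔ c = a.ng := ⟨fun e => (ng_eq.2 e).symm, fun e => by rw [e, ng_ng]⟩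
  have e3 : a = c ↔ c = a := eq_comm
  simp only [e1, e3]
  split_ifs with c1 c2 c2
  · exact absurd (c2.symm.trans c1) h5
  · subst c1; simp [co_ng]; ring
  · subst c2; simp [co_ng]; ring
  · simp

end Sg

end

section

namespace Sg

variable {N : ℕ}

/-- Quasi-invariance expressed by values at points. -/
structure QE (m1 m2 m3 : ℕ) (p : MvPolynomial (Fin N) ℂ) : Prop where
  short : ∀ a : Sg N, ∀ s : ℕ, 1 ≤ s → s ≤ m1 → ∀ y, co a y = s →
    eval (act (rs a a.ng) y) p = eval y p
  half : ∀ a : Sg N, ∀ s : ℕ, 1 ≤ s → s ≤ m2 → ∀ y, co a y = s - 1/2 →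
    eval (act (rs a a.ng) y) p = eval y p
  long : ∀ a b : Sg N, b ≠ a → b ≠ a.ng → ∀ s : ℕ, 1 ≤ s → s ≤ m3 → ∀ y, co a y - co b y = s →
    eval (act (rs a b) y) p = eval y p

lemma eval_shiftPoly (v w : Fin N → ℂ) (p) : eval v (shiftPoly w p) = eval (v + w) p := by
  rw [shiftPoly, aeval_def, eval_eval₂]
  have : ((eval v).comp (algebraMap ℂ (MvPolynomial (Fin N) ℂ))) = RingHom.id ℂ := by
    ext c; simp [algebraMap_eq]
  rw [this, eval₂_id]
  congr 2
  funext i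
  simp

lemma X_dvd_iff (j : Fin N) (q : MvPolynomial (Fin N) ℂ) :
    X j ∣ q ↔ ∀ v : Fin N → ℂ, v j = 0 → eval v q = 0 := by
  constructor
  · rintro ⟨r, rfl⟩ v hv; simp [hv]
  · intro h
    have := X_sub_dvd_of_vanish j 0 1 q (by simp) 0 (by simp) (by simp) (fun v hv _ => h v (by simpa using hv))
    simpa using this

lemma lin_sub_dvd_iff {i j : Fin N} (hij : i ≠ j) (e : ℂ) (q : MvPolynomial (Fin N) ℂ) :
    X i - C e * X j ∣ q ↔ ∀ v : Fin N → ℂ, v i = e * v j → eval v q = 0 := by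
  constructor
  · rintro ⟨r, rfl⟩ v hv; simp [hv]
  · intro h
    exact X_sub_dvd_of_vanish i (C e * X j) 1 q (by simp [hij.symm]) 0 (by simp) (by simp)
      (fun v hv _ => h v (by simpa using hv))

theorem mem_QtrBC_iff {m1 m2 m3 : ℕ} {p : MvPolynomial (Fin N) ℂ} :
    p ∈ QtrBC N m1 m2 m3 ↔ QE m1 m2 m3 p := by
  have ec : ∀ {v w : Fin N → ℂ}, v = w → eval v p = eval w p := fun h => by rw [h]
  have hs : ∀ s : ℂ, (∀ j : Fin N, X j ∣ shiftPoly (Pi.single j s) p - shiftPoly (Pi.single j (-s)) p) ↔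
      ∀ a : Sg N, ∀ y, co a y = s → eval (act (rs a a.ng) y) p = eval y p := by
    intro s
    simp only [X_dvd_iff, map_sub, eval_shiftPoly, sub_eq_zero]
    constructor
    · intro h a y hy
      have h1 := h a.1 (y - s • a.bv) (by
        simp only [Pi.sub_apply, Pi.smul_apply, bv, Pi.single_eq_same, smul_eq_mul, ← hy, co]
        linear_combination (-y a.1) * a.sg_mul_self)
      rw [act_rs_ng, hy]
      have h2 : (Pi.single a.1 s : Fin N → ℂ) = (s * a.sg) • a.bv := by
        rw [bv, ← Pi.single_smul, smul_eq_mul, mul_assoc, sg_mul_self, mul_one]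
      rw [Pi.single_neg, h2] at h1
      rcases Int.units_eq_one_or a.2 with h3 | h3
      · have h4 : a.sg = 1 := by simp [sg, h3]
        rw [h4] at h1
        exact (ec (by module)).trans (h1.symm.trans (ec (by module)))
      · have h4 : a.sg = -1 := by simp [sg, h3]
        rw [h4] at h1
        exact (ec (by module)).trans (h1.trans (ec (by module)))
    · intro h j v hv
      have h4 : ∀ t : ℂ, (Pi.single j t : Fin N → ℂ) = t • bv (j, 1) := fun t => by
        rw [bv, ← Pi.single_smul]; simp [sg]
      have h0 : co (j, 1) (v + Pi.single j s) = s := by simp [co, sg, hv]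
      have := h (j, 1) (v + Pi.single j s) h0
      rw [act_rs_ng, h0] at this
      rw [← this]
      congr 2
      rw [h4, h4]; module
  have hl : ∀ s : ℂ, (∀ i j : Fin N, i ≠ j →
      (X i - X j ∣ shiftPoly (Pi.single i s) p - shiftPoly (Pi.single j s) p) ∧
      (X i + X j ∣ shiftPoly (Pi.single i (-s)) p - shiftPoly (Pi.single j s) p)) ↔
      ∀ a b : Sg N, b ≠ a → b ≠ a.ng → ∀ y, co a y - co b y = s →
        eval (act (rs a b) y) p = eval y p := by
    intro s
    have e1 : ∀ i j : Fin N, (X i - X j : MvPolynomial (Fin N) ℂ) = X i - C 1 * X j := by simp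
    have e2 : ∀ i j : Fin N, (X i + X j : MvPolynomial (Fin N) ℂ) = X i - C (-1) * X j := by simp
    have e3 : ∀ (j : Fin N) (t : ℂ), (Pi.single j t : Fin N → ℂ) = t • bv (j, 1) := fun j t => by
      rw [bv, ← Pi.single_smul]; simp [sg]
    have e4 : ∀ (j : Fin N) (t : ℂ), (Pi.single j (-t) : Fin N → ℂ) = t • bv (j, -1) := fun j t => by
      rw [bv, ← Pi.single_smul]; simp [sg]
    have e5 : (∀ a b : Sg N, b ≠ a → b ≠ a.ng → ∀ y, co a y - co b y = s →
        eval (act (rs a b) y) p = eval y p) ↔ ∀ a b : Sg N, b ≠ a → b ≠ a.ng → ∀ z,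
        co a z = co b z → eval (z + s • a.bv) p = eval (z + s • b.bv) p := by
      constructor
      · intro h a b hab hab' z hz
        have h0 : co a (z + s • a.bv) - co b (z + s • a.bv) = s := by
          have : a ≠ b.ng := fun e => hab' (by rw [e, ng_ng])
          simp [co_add, co_smul, co_bv, hz, hab.symm, this, (ng_ne a).symm]
        rw [← h a b hab hab' _ h0, act_rs hab hab', h0]
        congr 2; module
      · intro h a b hab hab' y hy
        have : a ≠ b.ng := fun e => hab' (by rw [e, ng_ng])
        have h1 := h a b hab hab' (y - s • a.bv)
          (by simp [co_sub, co_smul, co_bv, hab.symm, this, (ng_ne a).symm]; linear_combination hy)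
        rw [act_rs hab hab', hy, ← h1]
        congr 2; module
    rw [e5]
    constructor
    · intro h
      have hp : ∀ (ε : ℤˣ) (i j : Fin N), i ≠ j → ∀ z, co (i, ε) z = co (j, 1) z →
          eval (z + s • bv (i, ε)) p = eval (z + s • bv (j, 1)) p := by
        intro ε i j hij z hz
        rcases Int.units_eq_one_or ε with h2 | h2
        · have := (h i j hij).1
          rw [e1, lin_sub_dvd_iff hij] at this
          have := this z (by subst h2; simpa [co, sg] using hz)
          rw [map_sub, eval_shiftPoly, eval_shiftPoly, sub_eq_zero, e3, e3] at this
          rw [h2, this]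
        · have := (h i j hij).2
          rw [e2, lin_sub_dvd_iff hij] at this
          have := this z (by subst h2; simp [co, sg] at hz ⊢; rw [← hz]; simp)
          rw [map_sub, eval_shiftPoly, eval_shiftPoly, sub_eq_zero, e4, e3] at this
          rw [h2, this]
      intro a b hab hab' z hz
      have hne := fst_ne hab hab'
      rcases Int.units_eq_one_or b.2 with hb | hb
      · have : b = (b.1, 1) := Prod.ext rfl hb
        rw [this] at hz ⊢
        exact hp a.2 a.1 b.1 hne.symm z hz
      · rcases Int.units_eq_one_or a.2 with ha | ha
        · have : a = (a.1, 1) := Prod.ext rfl ha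
          rw [this] at hz ⊢
          exact (hp b.2 b.1 a.1 hne z hz.symm).symm
        · have h1 : b = ng (b.1, 1) := Prod.ext rfl hb
          have h2 : a = ng (a.1, 1) := Prod.ext rfl ha
          have h3 := hp 1 b.1 a.1 hne (z + s • a.bv + s • b.bv) (by
            have q1 : ∀ w, co (b.1, 1) w = -co b w := fun w => by
              rw [congrArg (fun c => co c w) h1, co_ng, neg_neg]
            have q2 : ∀ w, co (a.1, 1) w = -co a w := fun w => by
              rw [congrArg (fun c => co c w) h2, co_ng, neg_neg]
            have : a ≠ b.ng := fun e => hab' (by rw [e, ng_ng])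
            rw [q1, q2]
            simp [co_add, co_smul, co_bv, hz, hab, hab', hab.symm, this, (ng_ne a).symm,
              (ng_ne b).symm])
          have h4 : bv (a.1, 1) = -a.bv := by rw [h2, bv_ng]; simp
          have h5 : bv (b.1, 1) = -b.bv := by rw [h1, bv_ng]; simp
          rw [h4, h5] at h3
          exact (ec (by module)).trans (h3.trans (ec (by module)))
    · intro h i j hij
      constructor
      · rw [e1, lin_sub_dvd_iff hij]
        intro v hv
        rw [map_sub, eval_shiftPoly, eval_shiftPoly, e3, e3, sub_eq_zero]
        exact h (i, 1) (j, 1) (by simp [hij.symm]) (by simp [ng, hij.symm]) v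
          (by simpa [co, sg] using hv)
      · rw [e2, lin_sub_dvd_iff hij]
        intro v hv
        rw [map_sub, eval_shiftPoly, eval_shiftPoly, e4, e3, sub_eq_zero]
        exact h (i, -1) (j, 1) (by simp [hij.symm]) (by simp [ng, hij.symm]) v
          (by simp [co, sg, hv])
  constructor
  · rintro ⟨h1, h2, h3⟩
    exact ⟨fun a s h h' => (hs s).1 (fun j => h1 j s h h') a,
      fun a s h h' => (hs (s - 1/2)).1 (fun j => h2 j s h h') a,
      fun a b hab hab' s h h' => (hl s).1 (fun i j hij => h3 i j hij s h h') a b hab hab'⟩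
  · rintro ⟨h1, h2, h3⟩
    exact ⟨fun j s h h' => (hs s).2 (fun a => h1 a s h h') j,
      fun j s h h' => (hs (s - 1/2)).2 (fun a => h2 a s h h') j,
      fun i j hij s h h' => (hl s).2 (fun a b hab hab' => h3 a b hab hab' s h h') i j hij⟩

end Sg

end

section

namespace Sg

variable {N : ℕ}

lemma act_eq {a b : Sg N} (h : b ≠ a) (v) : act (rs a b) v =
    v - ((if b = a.ng then 1/2 else 1) * (co a v - co b v)) • (a.bv - b.bv) := by
  split_ifs with h'
  · subst h'; rw [act_rs_ng, co_ng, bv_ng]; module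
  · rw [act_rs h h']; module

lemma co_rs {a b : Sg N} (h : b ≠ a) (c : Sg N) (v) : co (rs a b c) v = co c v -
    ((if b = a.ng then 1/2 else 1) * (co a v - co b v)) * co c (a.bv - b.bv) := by
  rw [← co_smul, ← co_sub, ← act_eq h, co_act (rs_odd a b h), rs_symm a b h]

lemma co_injective {a b : Sg N} (h : ∀ v, co a v = co b v) : a = b := by
  have h1 := h a.bv
  rw [co_bv_self, co_bv] at h1
  by_contra hne
  simp only [hne, if_false] at h1
  split_ifs at h1 <;> norm_num at h1

lemma co_root_ne {a b : Sg N} (h : b ≠ a) {c : Sg N} (hc : rs a b c ≠ c) :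
    co c (a.bv - b.bv) ≠ 0 := by
  intro h0
  apply hc
  apply co_injective
  intro v
  rw [co_rs h, h0, mul_zero, sub_zero]

lemma rs_rs {a b : Sg N} (h : b ≠ a) (c : Sg N) : rs a b (rs a b c) = c := by
  nth_rewrite 1 [← rs_symm a b h]; simp

lemma rs_left {a b : Sg N} (h : b ≠ a) : rs a b a = b := by
  by_cases h' : b = a.ng
  · subst h'; simp [rs_ng]
  · simp [rs_apply h h']

lemma rs_right {a b : Sg N} (h : b ≠ a) : rs a b b = a := by
  nth_rewrite 2 [← rs_left h]; exact rs_rs h a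

/-- Generic points of the hyperplane `x_a - x_b = t`. -/
structure Gen (a b : Sg N) (t : ℂ) (v : Fin N → ℂ) : Prop where
  eq : co a v - co b v = t
  ne : ∀ c d, c ≠ d → d ≠ rs a b c → co c v ≠ co d v
  half : ∀ c, ¬(b = a.ng ∧ c.1 = a.1) → co c v + 1/2 ≠ 0

lemma Gen.co_sub_rs {a b : Sg N} (h : b ≠ a) {t : ℂ} {v} (hv : Gen a b t v) (c : Sg N) :
    co c v - co (rs a b c) v = (if b = a.ng then 1/2 else 1) * t * co c (a.bv - b.bv) := by
  rw [co_rs h, hv.eq]; ring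

/-- An injective integer weight on signed indices. -/
def wt (c : Sg N) : ℤ := (c.2 : ℤ) * ((c.1 : ℕ) + 1 : ℤ)

lemma wt_ne (c : Sg N) : wt c ≠ 0 := by
  unfold wt
  have : ((c.1 : ℕ) + 1 : ℤ) ≠ 0 := by omega
  simp [this]

lemma wt_ng (c : Sg N) : wt c.ng = -wt c := by simp [wt, ng]

lemma wt_inj {c d : Sg N} (h : wt c = wt d) : c = d := by
  have h0 := h
  unfold wt at h
  have h1 : c.1 = d.1 := by
    have hc := Int.natCast_nonneg (c.1 : ℕ)
    have hd := Int.natCast_nonneg (d.1 : ℕ)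
    apply Fin.ext
    zify
    rcases Int.units_eq_one_or c.2 with h2 | h2 <;> rcases Int.units_eq_one_or d.2 with h3 | h3 <;>
      rw [h2, h3] at h <;>
      simp only [Units.val_one, Units.val_neg, one_mul, neg_mul] at h <;> linarith
  rcases eq_or_eq_ng h1 with h2 | h2
  · exact h2
  · rw [h2, wt_ng] at h0
    have := wt_ne d
    omega

/-- A generic base point. -/
def base : Fin N → ℂ := fun j => ((j : ℕ) + 1 : ℂ) * Complex.I

lemma co_base (c : Sg N) : co c base = (wt c : ℂ) * Complex.I := by
  simp [co, sg, base, wt]; ring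

lemma exists_gen {a b : Sg N} (h : b ≠ a) (t : ℝ) : ∃ v, Gen a b t v := by
  classical
  by_cases h' : b = a.ng
  · subst h'
    set v : Fin N → ℂ := Function.update base a.1 (a.sg * (t / 2)) with hv
    have h1 : ∀ c : Sg N, c.1 ≠ a.1 → co c v = (wt c : ℂ) * Complex.I := fun c hc => by
      rw [← co_base]; simp [co, hv, hc]
    have h2 : co a v = t / 2 := by simp [co, hv, ← mul_assoc, sg_mul_self]
    have h4 : ∀ c : Sg N, c.1 = a.1 → (co c v).im = 0 := by
      intro c hc
      rcases eq_or_eq_ng hc with e | e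
      · rw [e, h2]; simp
      · rw [e, co_ng, h2]; simp
    refine ⟨v, ?_, ?_, ?_⟩
    · rw [co_ng, h2]; ring
    · intro c d hcd hdr hcv
      have hcv := congrArg Complex.im hcv
      by_cases hc : c.1 = a.1 <;> by_cases hd : d.1 = a.1
      · rcases eq_or_eq_ng (hd.trans hc.symm) with e | e
        · exact hcd e.symm
        · apply hdr
          rw [e, rs_ng]
          rcases eq_or_eq_ng hc with e | e
          · rw [e]; simp
          · rw [e]; simp
      · rw [h4 c hc, h1 d hd] at hcv
        simp at hcv
        exact wt_ne d (by exact_mod_cast hcv.symm)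
      · rw [h4 d hd, h1 c hc] at hcv
        simp at hcv
        exact wt_ne c hcv
      · rw [h1 c hc, h1 d hd] at hcv
        simp at hcv
        exact hcd (wt_inj hcv)
    · intro c hc
      have hc : c.1 ≠ a.1 := fun e => hc ⟨rfl, e⟩
      intro h0
      have := congrArg Complex.im h0
      rw [h1 c hc] at this
      simp at this
      exact wt_ne c this
  · have hne := fst_ne h h'
    set v : Fin N → ℂ := Function.update base a.1 (a.sg * (co b base + t)) with hv
    have h1 : ∀ c : Sg N, c.1 ≠ a.1 → co c v = (wt c : ℂ) * Complex.I := fun c hc => by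
      rw [← co_base]; simp [co, hv, hc]
    have h2 : co a v = (wt b : ℂ) * Complex.I + t := by
      rw [← co_base]
      simp only [co, hv, Function.update_self, ← mul_assoc, sg_mul_self, one_mul]
    have h3 : ∀ c, ∃ c', (co c v).im = wt c' ∧
        ((c = a ∧ c' = b) ∨ (c = a.ng ∧ c' = b.ng) ∨ (c.1 ≠ a.1 ∧ c' = c)) := by
      intro c
      by_cases hc : c.1 = a.1
      · rcases eq_or_eq_ng hc with e | e
        · exact ⟨b, by rw [e, h2]; simp, Or.inl ⟨e, rfl⟩⟩
        · exact ⟨b.ng, by rw [e, co_ng, h2, wt_ng]; simp, Or.inr (Or.inl ⟨e, rfl⟩)⟩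
      · exact ⟨c, by rw [h1 c hc]; simp, Or.inr (Or.inr ⟨hc, rfl⟩)⟩
    refine ⟨v, ?_, ?_, ?_⟩
    · rw [h2, h1 b hne]; ring
    · intro c d hcd hdr hcv
      have hcv := congrArg Complex.im hcv
      obtain ⟨c', hc', e1⟩ := h3 c
      obtain ⟨d', hd', e2⟩ := h3 d
      rw [hc', hd'] at hcv
      have hcv : c' = d' := wt_inj (by exact_mod_cast hcv)
      subst hcv
      have hbb := ng_ne b
      have haa := ng_ne a
      have r1 := rs_left h
      have r2 := rs_right h
      have r3 : rs a b a.ng = b.ng := by rw [rs_odd a b h, r1]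
      have r4 : rs a b b.ng = a.ng := by rw [rs_odd a b h, r2]
      rcases e1 with ⟨e1, e1'⟩ | ⟨e1, e1'⟩ | ⟨e1, e1'⟩ <;>
        rcases e2 with ⟨e2, e2'⟩ | ⟨e2, e2'⟩ | ⟨e2, e2'⟩
      · exact hcd (e1.trans e2.symm)
      · exact hbb (e2'.symm.trans e1')
      · apply hdr; rw [e1, r1, ← e1', ← e2']
      · exact hbb (e1'.symm.trans e2')
      · exact hcd (e1.trans e2.symm)
      · apply hdr; rw [e1, r3, ← e1', ← e2']
      · apply hdr; rw [e2, ← e1', e2', r2]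
      · apply hdr; rw [e2, ← e1', e2', r4]
      · exact hcd (e1'.symm.trans e2')
    · intro c _ h0
      have := congrArg Complex.im h0
      obtain ⟨c', hc', -⟩ := h3 c
      simp [hc'] at this
      exact wt_ne c' this

/-- Density of generic points on the hyperplane `x_a - x_b = t`. -/
lemma dvd_of_gen {a b : Sg N} (h : b ≠ a) (t : ℝ) (q : MvPolynomial (Fin N) ℂ)
    (hq : ∀ v, Gen a b t v → eval v q = 0) : a.lin - b.lin - C (t : ℂ) ∣ q := by
  classical
  set H : MvPolynomial (Fin N) ℂ :=
    (∏ c, ∏ d, if c ≠ d ∧ d ≠ rs a b c then c.lin - d.lin else 1) *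
    ∏ c : Sg N, if ¬(b = a.ng ∧ c.1 = a.1) then c.lin + C (1/2) else 1 with hH
  have hHe : ∀ v, co a v - co b v = t → (eval v H ≠ 0 ↔ Gen a b t v) := by
    intro v hv
    have e1 : eval v H ≠ 0 ↔ (∀ c d, c ≠ d → d ≠ rs a b c → co c v ≠ co d v) ∧
        ∀ c, ¬(b = a.ng ∧ c.1 = a.1) → co c v + 1/2 ≠ 0 := by
      rw [hH, map_mul, mul_ne_zero_iff, map_prod, map_prod, Finset.prod_ne_zero_iff,
        Finset.prod_ne_zero_iff]
      refine and_congr ?_ ?_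
      · simp only [Finset.mem_univ, true_imp_iff, map_prod, Finset.prod_ne_zero_iff]
        refine forall_congr' fun c => forall_congr' fun d => ?_
        split_ifs with h1
        · simp [h1, sub_eq_zero]
        · simp only [map_one, ne_eq, one_ne_zero, not_false_eq_true, true_iff]
          intro h2 h3; exact absurd ⟨h2, h3⟩ h1
      · simp only [Finset.mem_univ, true_imp_iff]
        refine forall_congr' fun c => ?_
        split_ifs with h1
        · simp [h1]
        · simp [h1]
    rw [e1]
    exact ⟨fun h => ⟨hv, h.1, h.2⟩, fun h => ⟨h.ne, h.half⟩⟩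
  obtain ⟨v₀, hv₀⟩ := exists_gen h t
  by_cases h' : b = a.ng
  · have hl : a.lin - b.lin - C (t : ℂ) = C (2 * a.sg) * (X a.1 - C (a.sg * (t / 2))) := by
      rw [h', lin_ng, lin, mul_sub, ← C_mul]
      have : 2 * a.sg * (a.sg * (t / 2)) = t := by linear_combination (t : ℂ) * a.sg_mul_self
      rw [this, C_mul, map_ofNat]; ring
    have hi : ∀ v : Fin N → ℂ, v a.1 = a.sg * (t / 2) ↔ co a v - co b v = t := by
      intro v
      rw [h', co_ng, co]
      constructor
      · intro e; rw [e]; linear_combination (t : ℂ) * a.sg_mul_self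
      · intro e; linear_combination (-v a.1) * a.sg_mul_self + a.sg / 2 * e
    rw [hl]
    refine (IsUnit.mul_left_dvd ?_).2 (X_sub_dvd_of_vanish a.1 _ H q (by simp) v₀
      (by rw [eval_C]; exact (hi _).2 hv₀.eq) ((hHe _ hv₀.eq).2 hv₀) fun v h1 h2 => ?_)
    · exact (isUnit_iff_ne_zero.2 (mul_ne_zero two_ne_zero a.sg_ne_zero)).map C
    · rw [eval_C] at h1
      exact hq v ((hHe v ((hi v).1 h1)).1 h2)
  · have hne := fst_ne h h'
    have hl : a.lin - b.lin - C (t : ℂ) = C a.sg * (X a.1 - C a.sg * (b.lin + C (t : ℂ))) := by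
      rw [mul_sub, ← mul_assoc, ← C_mul, sg_mul_self, C_1, one_mul, lin]; ring
    have hi : ∀ v : Fin N → ℂ, v a.1 = eval v (C a.sg * (b.lin + C (t : ℂ))) ↔
        co a v - co b v = t := by
      intro v
      simp only [map_mul, eval_C, map_add, eval_lin]
      have e0 : co a v = a.sg * v a.1 := rfl
      rw [e0]
      constructor
      · intro e; rw [e]; linear_combination (co b v + t) * a.sg_mul_self
      · intro e; linear_combination (-v a.1) * a.sg_mul_self + a.sg * e
    rw [hl]
    refine (IsUnit.mul_left_dvd ?_).2 (X_sub_dvd_of_vanish a.1 _ H q ?_ v₀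
      ((hi _).2 hv₀.eq) ((hHe _ hv₀.eq).2 hv₀) fun v h1 h2 => ?_)
    · exact (isUnit_iff_ne_zero.2 a.sg_ne_zero).map C
    · intro v c; simp [co, hne]
    · exact hq v ((hHe v ((hi v).1 h1)).1 h2)

lemma vanish_of_gen {a b : Sg N} (h : b ≠ a) (t : ℝ) (q : MvPolynomial (Fin N) ℂ)
    (hq : ∀ v, Gen a b t v → eval v q = 0) (v) (hv : co a v - co b v = t) : eval v q = 0 := by
  obtain ⟨r, rfl⟩ := dvd_of_gen h t q hq
  simp [hv]

end Sg

end

section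

section Cancel

open Filter Topology

variable {n : ℕ} {ι : Type} (l : ι → MvPolynomial (Fin n) ℂ)

/-- Functions that become polynomial after multiplication by products of the given polynomials. -/
def RatOn (f : (Fin n → ℂ) → ℂ) : Prop :=
  ∃ (s : Multiset ι) (q : MvPolynomial (Fin n) ℂ), ∀ v, (∀ j, eval v (l j) ≠ 0) →
    eval v q = (s.map fun j => eval v (l j)).prod * f v

variable {l}

lemma RatOn.poly (q : MvPolynomial (Fin n) ℂ) : RatOn l fun v => eval v q :=
  ⟨0, q, fun v _ => by simp⟩

lemma RatOn.mul {f g : (Fin n → ℂ) → ℂ} (hf : RatOn l f) (hg : RatOn l g) :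
    RatOn l fun v => f v * g v := by
  obtain ⟨s, q, hq⟩ := hf
  obtain ⟨t, r, hr⟩ := hg
  refine ⟨s + t, q * r, fun v hv => ?_⟩
  rw [map_mul, hq v hv, hr v hv, Multiset.map_add, Multiset.prod_add]; ring

lemma RatOn.add {f g : (Fin n → ℂ) → ℂ} (hf : RatOn l f) (hg : RatOn l g) :
    RatOn l fun v => f v + g v := by
  obtain ⟨s, q, hq⟩ := hf
  obtain ⟨t, r, hr⟩ := hg
  have hp : ∀ (s : Multiset ι) v, eval v (s.map l).prod = (s.map fun j => eval v (l j)).prod := by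
    intro s v
    rw [map_multiset_prod, Multiset.map_map]; rfl
  refine ⟨s + t, q * (t.map l).prod + r * (s.map l).prod, fun v hv => ?_⟩
  rw [map_add, map_mul, map_mul, hp, hp, hq v hv, hr v hv, Multiset.map_add, Multiset.prod_add]
  ring

lemma RatOn.inv (j : ι) : RatOn l fun v => (eval v (l j))⁻¹ :=
  ⟨{j}, 1, fun v hv => by simp [hv j]⟩

lemma RatOn.sum {κ : Type} (s : Finset κ) {f : κ → (Fin n → ℂ) → ℂ}
    (hf : ∀ i ∈ s, RatOn l (f i)) : RatOn l fun v => ∑ i ∈ s, f i v := by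
  classical
  induction s using Finset.induction_on with
  | empty => simpa using RatOn.poly (l := l) 0
  | insert a s ha ih =>
    simp only [Finset.sum_insert ha]
    exact (hf a (by simp)).add (ih fun i hi => hf i (by simp [hi]))

lemma RatOn.prod {κ : Type} (s : Finset κ) {f : κ → (Fin n → ℂ) → ℂ}
    (hf : ∀ i ∈ s, RatOn l (f i)) : RatOn l fun v => ∏ i ∈ s, f i v := by
  classical
  induction s using Finset.induction_on with
  | empty => simpa using RatOn.poly (l := l) 1
  | insert a s ha ih =>
    simp only [Finset.prod_insert ha]
    exact (hf a (by simp)).mul (ih fun i hi => hf i (by simp [hi]))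

lemma continuous_eval_line (p : MvPolynomial (Fin n) ℂ) (v u : Fin n → ℂ) :
    Continuous fun ε : ℂ => eval (v + ε • u) p :=
  (MvPolynomial.continuous_eval p).comp (by fun_prop)

lemma tendsto_eval_line (p : MvPolynomial (Fin n) ℂ) (v u : Fin n → ℂ) :
    Tendsto (fun ε : ℂ => eval (v + ε • u) p) (𝓝[≠] 0) (𝓝 (eval v p)) := by
  have := (continuous_eval_line p v u).tendsto 0
  simp only [zero_smul, add_zero] at this
  exact this.mono_left nhdsWithin_le_nhds

/-- A rational function whose poles all cancel is polynomial. -/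
theorem RatOn.exists_poly {f : (Fin n → ℂ) → ℂ} (hf : RatOn l f) (G : ι → (Fin n → ℂ) → Prop)
    (hdiv : ∀ i q, (∀ v, G i v → eval v q = 0) → l i ∣ q)
    (hlim : ∀ i v, G i v → ∃ u, (∀ᶠ ε in 𝓝[≠] (0 : ℂ), ∀ j, eval (v + ε • u) (l j) ≠ 0) ∧
      Tendsto (fun ε : ℂ => eval (v + ε • u) (l i) * f (v + ε • u)) (𝓝[≠] 0) (𝓝 0)) :
    ∃ g : MvPolynomial (Fin n) ℂ, ∀ v, (∀ j, eval v (l j) ≠ 0) → eval v g = f v := by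
  obtain ⟨s, q, hq⟩ := hf
  induction s using Multiset.induction_on generalizing q with
  | empty => exact ⟨q, fun v hv => by simpa using hq v hv⟩
  | cons i s ih =>
    have h1 : l i ∣ q := by
      apply hdiv
      intro v hv
      obtain ⟨u, hu, hT⟩ := hlim i v hv
      have hs : Tendsto (fun ε : ℂ => (s.map fun j => eval (v + ε • u) (l j)).prod) (𝓝[≠] 0)
          (𝓝 (eval v (s.map l).prod)) := by
        have := tendsto_eval_line (s.map l).prod v u
        simpa only [map_multiset_prod, Multiset.map_map, Function.comp_def] using this
      have h2 := hs.mul hT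
      rw [mul_zero] at h2
      refine tendsto_nhds_unique (tendsto_eval_line q v u) (h2.congr' ?_)
      filter_upwards [hu] with ε hε
      rw [hq _ hε, Multiset.map_cons, Multiset.prod_cons]; ring
    obtain ⟨r, rfl⟩ := h1
    refine ih r fun v hv => ?_
    have := hq v hv
    rw [map_mul, Multiset.map_cons, Multiset.prod_cons, mul_assoc] at this
    exact mul_left_cancel₀ (hv i) this

end Cancel

namespace Sg

open Filter Topology

variable {N : ℕ}

/-- Regular points of the difference operator. -/
structure Reg (v : Fin N → ℂ) : Prop where
  ne : ∀ c d : Sg N, c ≠ d → co c v ≠ co d v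
  half : ∀ c : Sg N, co c v + 1/2 ≠ 0

lemma Reg.act {v : Fin N → ℂ} (hv : Reg v) {π : Equiv.Perm (Sg N)} (h : Odd π) :
    Reg (Sg.act π v) := by
  constructor
  · intro c d hcd
    rw [co_act h, co_act h]
    exact hv.ne _ _ fun e => hcd (π.symm.injective e)
  · intro c
    rw [co_act h]; exact hv.half _

/-- Linear denominators. -/
def den : (Sg N × Sg N) ⊕ Sg N → MvPolynomial (Fin N) ℂ
  | .inl (c, d) => if c = d then 1 else c.lin - d.lin
  | .inr c => c.lin + C (1/2)

lemma reg_iff {v : Fin N → ℂ} : Reg v ↔ ∀ j, eval v (den j) ≠ 0 := by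
  constructor
  · rintro ⟨h1, h2⟩ (⟨c, d⟩ | c)
    · by_cases h : c = d
      · simp [den, h]
      · simpa [den, h, sub_eq_zero] using h1 c d h
    · simpa [den] using h2 c
  · intro h
    refine ⟨fun c d hcd => ?_, fun c => ?_⟩
    · have := h (.inl (c, d))
      simpa [den, hcd, sub_eq_zero] using this
    · simpa [den] using h (.inr c)

variable (m1 m2 m3 : ℕ)

/-- Shift of a long or short root factor. -/
def mu (c d : Sg N) : ℂ := if d = c.ng then 2 * m1 else m3

/-- Root factor of a coefficient. -/
def fac (c d : Sg N) (v : Fin N → ℂ) : ℂ :=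
  (co c v - co d v - mu m1 m3 c d) / (co c v - co d v)

/-- Half-integral factor of a coefficient. -/
def hf (c : Sg N) (v : Fin N → ℂ) : ℂ := (co c v - m2 + 1/2) / (co c v + 1/2)

/-- Coefficients of the difference operator. -/
def cf (c : Sg N) (v : Fin N → ℂ) : ℂ := hf m2 c v * ∏ d ∈ Finset.univ.erase c, fac m1 m3 c d v

/-- The difference operator. -/
def df (p : MvPolynomial (Fin N) ℂ) (v : Fin N → ℂ) : ℂ :=
  ∑ c, cf m1 m2 m3 c v * (eval (v + bv c) p - eval v p)

variable {m1 m2 m3}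

lemma fac_act {π : Equiv.Perm (Sg N)} (h : Odd π) (c d : Sg N) (v) :
    fac m1 m3 c d (act π v) = fac m1 m3 (π.symm c) (π.symm d) v := by
  unfold fac mu
  rw [co_act h, co_act h, ← h.symm]
  simp only [Equiv.apply_eq_iff_eq]

lemma cf_act {π : Equiv.Perm (Sg N)} (h : Odd π) (c : Sg N) (v) :
    cf m1 m2 m3 c (act π v) = cf m1 m2 m3 (π.symm c) v := by
  unfold cf hf
  rw [co_act h]
  congr 1
  refine Finset.prod_equiv π.symm (fun d => by simp) fun d _ => fac_act h c d v

lemma ratOn_cf (c : Sg N) : RatOn den (cf m1 m2 m3 c) := by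
  have h1 : RatOn den (fun v => hf m2 c v) := by
    have := (RatOn.poly (l := den) (c.lin - C (m2 : ℂ) + C (1/2))).mul (RatOn.inv (.inr c))
    unfold hf
    simpa [den, div_eq_mul_inv] using this
  refine h1.mul (RatOn.prod _ fun d hd => ?_)
  have hd : c ≠ d := (Finset.ne_of_mem_erase hd).symm
  have := (RatOn.poly (l := den) (c.lin - d.lin - C (mu m1 m3 c d))).mul (RatOn.inv (.inl (c, d)))
  unfold fac
  simpa [den, hd, div_eq_mul_inv] using this

lemma ratOn_df (p : MvPolynomial (Fin N) ℂ) : RatOn den (df m1 m2 m3 p) := by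
  refine RatOn.sum _ fun c _ => (ratOn_cf c).mul ?_
  have := RatOn.poly (l := den) (shiftPoly (bv c) p - p)
  simpa only [map_sub, eval_shiftPoly] using this

lemma tendsto_co (c : Sg N) (v u : Fin N → ℂ) :
    Tendsto (fun ε : ℂ => co c (v + ε • u)) (𝓝[≠] 0) (𝓝 (co c v)) := by
  simpa using tendsto_eval_line c.lin v u

lemma tendsto_fac {c d : Sg N} {v : Fin N → ℂ} (h : co c v ≠ co d v) (u) :
    Tendsto (fun ε : ℂ => fac m1 m3 c d (v + ε • u)) (𝓝[≠] 0) (𝓝 (fac m1 m3 c d v)) :=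
  (((tendsto_co c v u).sub (tendsto_co d v u)).sub_const _).div
    ((tendsto_co c v u).sub (tendsto_co d v u)) (sub_ne_zero.2 h)

lemma tendsto_hf {c : Sg N} {v : Fin N → ℂ} (h : co c v + 1/2 ≠ 0) (u) :
    Tendsto (fun ε : ℂ => hf m2 c (v + ε • u)) (𝓝[≠] 0) (𝓝 (hf m2 c v)) :=
  (((tendsto_co c v u).sub_const _).add_const _).div ((tendsto_co c v u).add_const _) h

lemma tendsto_cf {c : Sg N} {v : Fin N → ℂ} (h : ∀ d, c ≠ d → co c v ≠ co d v)
    (h' : co c v + 1/2 ≠ 0) (u) :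
    Tendsto (fun ε : ℂ => cf m1 m2 m3 c (v + ε • u)) (𝓝[≠] 0) (𝓝 (cf m1 m2 m3 c v)) :=
  (tendsto_hf h' u).mul (tendsto_finsetProd _ fun d hd =>
    tendsto_fac (h d (Finset.ne_of_mem_erase hd).symm) u)

lemma tendsto_id' : Tendsto (fun ε : ℂ => ε) (𝓝[≠] 0) (𝓝 0) :=
  tendsto_id.mono_left nhdsWithin_le_nhds

lemma eventually_co_ne {c : Sg N} {v u : Fin N → ℂ} {z : ℂ} (h : co c v ≠ z ∨ co c u ≠ 0) :
    ∀ᶠ ε in 𝓝[≠] (0 : ℂ), co c (v + ε • u) ≠ z := by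
  by_cases h0 : co c v = z
  · have h1 := h.resolve_left (fun e => e h0)
    filter_upwards [self_mem_nhdsWithin] with ε hε
    rw [co_add, co_smul, h0]
    simpa using ⟨hε, h1⟩
  · exact (tendsto_co c v u).eventually_ne h0

lemma eventually_reg {v u : Fin N → ℂ}
    (h : ∀ c d : Sg N, c ≠ d → co c v ≠ co d v ∨ co c u ≠ co d u)
    (h' : ∀ c : Sg N, co c v + 1/2 ≠ 0 ∨ co c u ≠ 0) :
    ∀ᶠ ε in 𝓝[≠] (0 : ℂ), Reg (v + ε • u) := by
  have h1 : ∀ᶠ ε in 𝓝[≠] (0 : ℂ), ∀ c d : Sg N, c ≠ d → co c (v + ε • u) ≠ co d (v + ε • u) := by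
    simp only [eventually_all]
    intro c d hcd
    rcases h c d hcd with h0 | h0
    · have := ((tendsto_co c v u).sub (tendsto_co d v u)).eventually_ne (sub_ne_zero.2 h0)
      filter_upwards [this] with ε hε
      exact sub_ne_zero.1 hε
    · by_cases h2 : co c v = co d v
      · filter_upwards [self_mem_nhdsWithin] with ε hε
        simp only [co_add, co_smul, h2]
        intro e
        exact h0 (mul_left_cancel₀ hε (add_left_cancel e))
      · have := ((tendsto_co c v u).sub (tendsto_co d v u)).eventually_ne (sub_ne_zero.2 h2)
        filter_upwards [this] with ε hε
        exact sub_ne_zero.1 hε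
  have h2 : ∀ᶠ ε in 𝓝[≠] (0 : ℂ), ∀ c : Sg N, co c (v + ε • u) ≠ -(1/2) := by
    simp only [eventually_all]
    intro c
    refine eventually_co_ne ((h' c).imp_left fun h3 e => h3 ?_)
    rw [e]; ring
  filter_upwards [h1, h2] with ε h3 h4
  exact ⟨h3, fun c e => h4 c (by linear_combination e)⟩

section Inv

variable {p : MvPolynomial (Fin N) ℂ}

/-- Invariance of the value at a point under a reflection. -/
def Inv (p : MvPolynomial (Fin N) ℂ) (a b : Sg N) (y : Fin N → ℂ) : Prop :=
  eval (act (rs a b) y) p = eval y p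

lemma co_act_sub {a b : Sg N} (h : b ≠ a) (y) :
    co a (act (rs a b) y) - co b (act (rs a b) y) = -(co a y - co b y) := by
  rw [co_act (rs_odd a b h), co_act (rs_odd a b h), rs_symm a b h, rs_left h, rs_right h]; ring

lemma Inv.of_act {a b : Sg N} (h : b ≠ a) {y} (hi : Inv p a b (act (rs a b) y)) :
    Inv p a b y := by
  unfold Inv at *
  rw [act_act a b h] at hi
  exact hi.symm

lemma inv_of_zero {a b : Sg N} (h : b ≠ a) {y} (hy : co a y - co b y = 0) : Inv p a b y := by
  unfold Inv
  rw [act_eq h, hy]; simp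

lemma QE.inv_long (hp : QE m1 m2 m3 p) {a b : Sg N} (h : b ≠ a) (h' : b ≠ a.ng) {y}
    (n : ℤ) (hn : |n| ≤ m3) (hy : co a y - co b y = n) : Inv p a b y := by
  have pos : ∀ (n : ℤ) y, 0 < n → n ≤ m3 → co a y - co b y = n → Inv p a b y := by
    intro n y h0 h1 hy
    obtain ⟨s, rfl⟩ := Int.eq_ofNat_of_zero_le h0.le
    exact hp.long a b h h' s (by omega) (by omega) y (by simpa using hy)
  rcases lt_trichotomy n 0 with h0 | h0 | h0
  · refine Inv.of_act h (pos (-n) _ (by omega) (by rw [abs_of_neg h0] at hn; exact hn) ?_)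
    rw [co_act_sub h, hy]; simp
  · exact inv_of_zero h (by rw [hy, h0]; simp)
  · exact pos n y h0 (by rwa [abs_of_pos h0] at hn) hy

lemma QE.inv_short (hp : QE m1 m2 m3 p) {a : Sg N} {y}
    (n : ℤ) (hn : |n| ≤ m1) (hy : co a y - co a.ng y = 2 * n) : Inv p a a.ng y := by
  have h := ng_ne a
  have pos : ∀ (n : ℤ) y, 0 < n → n ≤ m1 → co a y - co a.ng y = 2 * n → Inv p a a.ng y := by
    intro n y h0 h1 hy
    obtain ⟨s, rfl⟩ := Int.eq_ofNat_of_zero_le h0.le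
    refine hp.short a s (by omega) (by omega) y ?_
    rw [co_ng] at hy
    push_cast at hy
    linear_combination hy / 2
  rcases lt_trichotomy n 0 with h0 | h0 | h0
  · refine Inv.of_act h (pos (-n) _ (by omega) (by rw [abs_of_neg h0] at hn; exact hn) ?_)
    rw [co_act_sub h, hy]; push_cast; ring
  · exact inv_of_zero h (by rw [hy, h0]; simp)
  · exact pos n y h0 (by rwa [abs_of_pos h0] at hn) hy

lemma QE.inv_half (hp : QE m1 m2 m3 p) {a : Sg N} {y}
    (n : ℤ) (hn : 1 - (m2 : ℤ) ≤ n) (hn' : n ≤ m2) (hy : co a y - co a.ng y = 2 * n - 1) :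
    Inv p a a.ng y := by
  have h := ng_ne a
  have pos : ∀ (n : ℤ) y, 0 < n → n ≤ m2 → co a y - co a.ng y = 2 * n - 1 → Inv p a a.ng y := by
    intro n y h0 h1 hy
    obtain ⟨s, rfl⟩ := Int.eq_ofNat_of_zero_le h0.le
    refine hp.half a s (by omega) (by omega) y ?_
    rw [co_ng] at hy
    push_cast at hy
    linear_combination hy / 2
  by_cases h0 : 0 < n
  · exact pos n y h0 hn' hy
  · refine Inv.of_act h (pos (1 - n) _ (by omega) (by omega) ?_)
    rw [co_act_sub h, hy]; push_cast; ring

lemma root_bv {a b : Sg N} (h : b ≠ a) (h' : b ≠ a.ng) (c : Sg N) :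
    ∃ n : ℤ, |n| ≤ 1 ∧ co a c.bv - co b c.bv = n ∧ (n = 1 → c = a ∨ c = b.ng) := by
  have h1 : a ≠ b := h.symm
  have h2 : a.ng ≠ b := h'.symm
  have h3 : a ≠ b.ng := fun e => h2 (ng_eq.2 e)
  have h4 : a.ng ≠ b.ng := fun e => h1 (ng_inj.1 e)
  have h5 := ng_ne a
  have h6 := ng_ne b
  rw [co_bv, co_bv]
  by_cases c1 : c = a
  · subst c1; exact ⟨1, by simp, by simp [h1, h3, h5.symm], by simp⟩
  by_cases c2 : c = b
  · subst c2; exact ⟨-1, by simp, by simp [h, h2.symm, h6.symm], by simp⟩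
  by_cases c3 : c = a.ng
  · subst c3; exact ⟨-1, by simp, by simp [h5, h2, h4], by simp⟩
  by_cases c4 : c = b.ng
  · subst c4; exact ⟨1, by simp, by simp [h3.symm, h4.symm, h6], by simp⟩
  · exact ⟨0, by simp, by simp [c1, c2, c3, c4], by simp⟩

lemma short_bv (a c : Sg N) :
    ∃ n : ℤ, |n| ≤ 1 ∧ co a c.bv - co a.ng c.bv = 2 * n ∧ (n = 1 → c = a) ∧
      (n = -1 → c = a.ng) := by
  have h5 := ng_ne a
  rw [co_ng, co_bv]
  by_cases c1 : c = a
  · subst c1; exact ⟨1, by simp, by simp [h5.symm]; norm_num, by simp, by simp⟩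
  by_cases c3 : c = a.ng
  · subst c3; exact ⟨-1, by simp, by simp [h5]; norm_num, by simp, by simp⟩
  · exact ⟨0, by simp, by simp [c1, c3], by simp, by simp⟩

end Inv

end Sg

end

section

namespace Sg

open Filter Topology

variable {N : ℕ} {m1 m2 m3 : ℕ}

lemma rs_eq_ng_iff {a b : Sg N} (h : b ≠ a) {c : Sg N} (hc : rs a b c ≠ c) :
    rs a b c = c.ng ↔ b = a.ng := by
  constructor
  · intro h1
    by_contra h'
    rw [rs_apply h h'] at h1 hc
    have h5 := ng_ne a
    have h6 := ng_ne b
    split_ifs at h1 hc with e1 e2 e3 e4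
    · subst e1; exact h' h1
    · subst e2; exact h' (by rw [h1, ng_ng])
    · subst e3; rw [ng_ng] at h1; exact h' (ng_eq.1 h1)
    · subst e4; rw [ng_ng] at h1; exact h' h1.symm
    · exact hc rfl
  · rintro rfl
    rw [rs_ng] at hc ⊢
    by_cases e1 : c = a
    · subst e1; simp
    by_cases e2 : c = a.ng
    · subst e2; simp
    · exact absurd (Equiv.swap_apply_of_ne_of_ne e1 e2) hc

lemma mu_rs {a b : Sg N} (h : b ≠ a) {c : Sg N} (hc : rs a b c ≠ c) :
    mu m1 m3 c (rs a b c) = mu m1 m3 a b := by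
  unfold mu
  simp only [rs_eq_ng_iff h hc]

lemma co_root_self {a b : Sg N} (h : b ≠ a) :
    (if b = a.ng then 1/2 else 1) * (co a (a.bv - b.bv) - co b (a.bv - b.bv)) = (2 : ℂ) := by
  have h5 := ng_ne a
  split_ifs with h'
  · subst h'; simp only [bv_ng, co_ng, sub_neg_eq_add, co_add, co_bv_self]; norm_num
  · have h2 : a ≠ b.ng := fun e => h' (by rw [e, ng_ng])
    simp only [co_sub, co_bv_self, co_bv, h, h', h.symm, h2, if_false]; norm_num

lemma co_root_rs {a b : Sg N} (h : b ≠ a) (c : Sg N) :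
    co c (a.bv - b.bv) - co (rs a b c) (a.bv - b.bv) = 2 * co c (a.bv - b.bv) := by
  rw [co_rs h, co_root_self h]; ring

lemma act_root {a b : Sg N} (h : b ≠ a) : act (rs a b) (a.bv - b.bv) = -(a.bv - b.bv) := by
  apply ext_co
  intro c
  rw [co_act (rs_odd a b h), rs_symm a b h]
  have := co_root_rs h c
  have h2 : co c (-(a.bv - b.bv)) = -co c (a.bv - b.bv) := by simp [co]; ring
  rw [h2]; linear_combination -this

lemma tendsto_neg' : Tendsto (fun ε : ℂ => -ε) (𝓝[≠] 0) (𝓝[≠] 0) := by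
  refine tendsto_nhdsWithin_iff.2 ⟨?_, ?_⟩
  · have : Tendsto (fun ε : ℂ => -ε) (𝓝 0) (𝓝 (-0)) := tendsto_id.neg
    rw [neg_zero] at this
    exact this.mono_left nhdsWithin_le_nhds
  · filter_upwards [self_mem_nhdsWithin] with ε hε
    simpa using hε

lemma Gen.half_zero {a b : Sg N} {v} (hv : Gen a b 0 v) (c : Sg N) : co c v + 1/2 ≠ 0 := by
  by_cases hc : b = a.ng ∧ c.1 = a.1
  · have h0 := hv.eq
    rw [hc.1, co_ng] at h0
    have : co a v = 0 := by linear_combination h0 / 2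
    rcases eq_or_eq_ng hc.2 with e | e <;> simp [e, co_ng, this]
  · exact hv.half c hc

lemma exists_pole {a b : Sg N} (h : b ≠ a) {v} (hv : Gen a b 0 v) (c : Sg N) :
    ∃ B : ℂ, Tendsto (fun ε : ℂ => ε * cf m1 m2 m3 c (v + ε • (a.bv - b.bv))) (𝓝[≠] 0) (𝓝 B) ∧
      (rs a b c = c → B = 0) ∧ (mu m1 m3 a b = 0 → B = 0) := by
  by_cases hc : rs a b c = c
  · refine ⟨0, ?_, fun _ => rfl, fun _ => rfl⟩
    have := tendsto_id'.mul (tendsto_cf (m1 := m1) (m2 := m2) (m3 := m3)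
      (fun d hd => hv.ne c d hd (by rw [hc]; exact hd.symm)) (hv.half_zero c) (a.bv - b.bv))
    simpa using this
  · set u := a.bv - b.bv with hu
    set r := rs a b c with hr
    have hcu : co c u ≠ 0 := co_root_ne h hc
    have hf1 : Tendsto (fun ε : ℂ => ε * fac m1 m3 c r (v + ε • u)) (𝓝[≠] 0)
        (𝓝 (-mu m1 m3 a b / (2 * co c u))) := by
      have h1 : Tendsto (fun ε : ℂ => (ε * (2 * co c u) - mu m1 m3 a b) / (2 * co c u)) (𝓝[≠] 0)
          (𝓝 ((0 * (2 * co c u) - mu m1 m3 a b) / (2 * co c u))) :=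
        ((tendsto_id'.mul_const _).sub_const _).div_const _
      rw [zero_mul, zero_sub] at h1
      refine h1.congr' ?_
      filter_upwards [self_mem_nhdsWithin] with ε hε
      have hε : ε ≠ 0 := hε
      have h2 : co c (v + ε • u) - co r (v + ε • u) = ε * (2 * co c u) := by
        have e1 := hv.co_sub_rs h c
        rw [mul_zero, zero_mul] at e1
        have e2 := co_root_rs h c
        rw [← hu, ← hr] at e2
        simp only [co_add, co_smul]
        linear_combination e1 + ε * e2
      rw [fac, h2, mu_rs h hc]
      field_simp
    have hf2 : Tendsto (fun ε : ℂ => ∏ d ∈ (Finset.univ.erase c).erase r,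
        fac m1 m3 c d (v + ε • u)) (𝓝[≠] 0)
        (𝓝 (∏ d ∈ (Finset.univ.erase c).erase r, fac m1 m3 c d v)) := by
      refine tendsto_finsetProd _ fun d hd => tendsto_fac ?_ u
      simp only [Finset.mem_erase] at hd
      exact hv.ne c d hd.2.1.symm hd.1
    refine ⟨_, ((tendsto_hf (m2 := m2) (hv.half_zero c) u).mul (hf1.mul hf2)).congr' ?_,
      fun e => absurd e hc, fun e => by simp [e]⟩
    refine Eventually.of_forall fun ε => ?_
    change _ = ε * cf m1 m2 m3 c (v + ε • u)
    rw [cf, ← Finset.mul_prod_erase (Finset.univ.erase c) _ (Finset.mem_erase.2 ⟨hc, Finset.mem_univ r⟩)]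
    ring

variable {p : MvPolynomial (Fin N) ℂ}

lemma tendsto_shift (p : MvPolynomial (Fin N) ℂ) (v u w : Fin N → ℂ) :
    Tendsto (fun ε : ℂ => eval (v + ε • u + w) p - eval (v + ε • u) p) (𝓝[≠] 0)
      (𝓝 (eval (v + w) p - eval v p)) := by
  have := (tendsto_eval_line p (v + w) u).sub (tendsto_eval_line p v u)
  simpa only [add_right_comm] using this

lemma act_root_line {a b : Sg N} (h : b ≠ a) {v} (hv : co a v - co b v = 0) (ε : ℂ) :
    act (rs a b) (v + ε • (a.bv - b.bv)) = v + (-ε) • (a.bv - b.bv) := by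
  rw [act_add (rs_odd a b h), act_smul (rs_odd a b h), act_root h, act_eq h v, hv]
  module

lemma tendsto_root (hp : QE m1 m2 m3 p) {a b : Sg N} (h : b ≠ a) {v} (hv : Gen a b 0 v) :
    Tendsto (fun ε : ℂ => ε * df m1 m2 m3 p (v + ε • (a.bv - b.bv))) (𝓝[≠] 0) (𝓝 0) := by
  choose B hB hB0 hB1 using exists_pole (m1 := m1) (m2 := m2) (m3 := m3) h hv
  have hodd := rs_odd a b h
  have hBr : ∀ c, B (rs a b c) = -B c := by
    intro c
    refine tendsto_nhds_unique (hB (rs a b c)) ?_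
    refine (((hB c).comp tendsto_neg').neg).congr fun ε => ?_
    simp only [Function.comp_apply]
    rw [← act_root_line h hv.eq, cf_act hodd, rs_symm a b h]; ring
  have hsum : ∑ c, B c * (eval (v + bv c) p - eval v p) = 0 := by
    refine Finset.sum_involution (fun c _ => rs a b c) ?_ ?_ ?_ ?_
    · intro c _
      rw [hBr]
      by_cases hmu : mu m1 m3 a b = 0
      · simp [hB1 c hmu]
      · have hinv : Inv p a b (v + bv c) := by
          by_cases h' : b = a.ng
          · subst h'
            obtain ⟨n, hn, hn', -⟩ := short_bv a c
            have : m1 ≠ 0 := fun e => hmu (by simp [mu, e])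
            refine hp.inv_short n (by omega) ?_
            rw [co_add, co_add]; linear_combination hv.eq + hn'
          · obtain ⟨n, hn, hn', -⟩ := root_bv h h' c
            have : m3 ≠ 0 := fun e => hmu (by simp [mu, h', e])
            refine hp.inv_long h h' n (by omega) ?_
            rw [co_add, co_add]; linear_combination hv.eq + hn'
        have e1 : act (rs a b) (v + bv c) = v + bv (rs a b c) := by
          rw [act_add hodd, act_bv hodd, act_eq h v, hv.eq]; simp
        unfold Inv at hinv
        rw [e1] at hinv
        rw [hinv]; ring
    · intro c _ hc e
      exact hc (by simp [hB0 c e])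
    · simp
    · intro c _; exact rs_rs h c
  have := tendsto_finsetSum Finset.univ fun c _ =>
    (hB c).mul (tendsto_shift p v (a.bv - b.bv) (bv c))
  rw [hsum] at this
  refine this.congr fun ε => ?_
  rw [df, Finset.mul_sum]
  exact Finset.sum_congr rfl fun c _ => by ring

lemma Gen.reg_ne {a b : Sg N} (h : b ≠ a) {t : ℂ} (ht : t ≠ 0) {v} (hv : Gen a b t v) {c d : Sg N}
    (hcd : c ≠ d) : co c v ≠ co d v := by
  by_cases hd : d = rs a b c
  · subst hd
    have := hv.co_sub_rs h c
    rw [← sub_ne_zero, this]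
    refine mul_ne_zero (mul_ne_zero ?_ ht) (co_root_ne h hcd.symm)
    split_ifs <;> norm_num
  · exact hv.ne c d hcd hd

lemma tendsto_half (hp : QE m1 m2 m3 p) {a : Sg N} {v} (hv : Gen a a.ng (-1) v) :
    Tendsto (fun ε : ℂ => ε * df m1 m2 m3 p (v + ε • a.bv)) (𝓝[≠] 0) (𝓝 0) := by
  have h := ng_ne a
  have hne : ∀ {c d : Sg N}, c ≠ d → co c v ≠ co d v := hv.reg_ne h (by norm_num)
  have ha : co a v = -1/2 := by
    have := hv.eq; rw [co_ng] at this; linear_combination this / 2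
  have hpole : Tendsto (fun ε : ℂ => ε * cf m1 m2 m3 a (v + ε • a.bv)) (𝓝[≠] 0)
      (𝓝 (-m2 * ∏ d ∈ Finset.univ.erase a, fac m1 m3 a d v)) := by
    have h1 : Tendsto (fun ε : ℂ => ε - (m2 : ℂ)) (𝓝[≠] 0) (𝓝 (0 - m2)) := tendsto_id'.sub_const _
    rw [zero_sub] at h1
    refine (h1.mul (tendsto_finsetProd (Finset.univ.erase a) fun d hd => tendsto_fac
      (m1 := m1) (m3 := m3) (hne (Finset.ne_of_mem_erase hd).symm) a.bv)).congr' ?_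
    filter_upwards [self_mem_nhdsWithin] with ε hε
    have hε : ε ≠ 0 := hε
    have e1 : co a (v + ε • a.bv) = ε - 1/2 := by
      rw [co_add, co_smul, co_bv_self, ha]; ring
    rw [cf, hf, e1]
    have e2 : ε - 1/2 - m2 + 1/2 = ε - m2 := by ring
    have e3 : ε - 1/2 + 1/2 = ε := by ring
    rw [e2, e3]
    field_simp
  have hterm : ∀ c, Tendsto (fun ε : ℂ => ε * (cf m1 m2 m3 c (v + ε • a.bv) *
      (eval (v + ε • a.bv + bv c) p - eval (v + ε • a.bv) p))) (𝓝[≠] 0) (𝓝 0) := by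
    intro c
    by_cases hc : c = a
    · subst hc
      have := hpole.mul (tendsto_shift p v (bv c) (bv c))
      have e0 : -(m2 : ℂ) * (∏ d ∈ Finset.univ.erase c, fac m1 m3 c d v) *
          (eval (v + bv c) p - eval v p) = 0 := by
        by_cases hm : m2 = 0
        · simp [hm]
        · have hi : Inv p c c.ng v := hp.inv_half 0 (by omega) (by omega) (by
            rw [hv.eq]; norm_num)
          unfold Inv at hi
          rw [act_rs_ng, ha] at hi
          have e2 : v - (2 * (-1/2 : ℂ)) • c.bv = v + c.bv := by
            rw [show (2 * (-1/2 : ℂ)) = -1 by norm_num]; simp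
          rw [e2] at hi
          rw [hi]; ring
      rw [e0] at this
      exact this.congr fun ε => by ring
    · have hh : co c v + 1/2 ≠ 0 := by
        by_cases h1 : c.1 = a.1
        · have := (eq_or_eq_ng h1).resolve_left hc
          rw [this, co_ng, ha]; norm_num
        · exact hv.half c (by simp [h1])
      have := tendsto_id'.mul ((tendsto_cf (m1 := m1) (m2 := m2) (m3 := m3)
        (fun d hd => hne hd) hh a.bv).mul (tendsto_shift p v (bv a) (bv c)))
      rwa [zero_mul] at this
  have := tendsto_finsetSum Finset.univ fun c _ => hterm c
  simp only [Finset.sum_const_zero] at this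
  exact this.congr fun ε => by rw [df, Finset.mul_sum]

/-- The difference operator maps quasi-invariants to polynomials. -/
theorem exists_df (hp : QE m1 m2 m3 p) :
    ∃ g : MvPolynomial (Fin N) ℂ, ∀ v, Reg v → eval v g = df m1 m2 m3 p v := by
  have key := RatOn.exists_poly (ratOn_df (m1 := m1) (m2 := m2) (m3 := m3) p) (fun i v => match i with
    | .inl (c, d) => c ≠ d ∧ Gen c d 0 v
    | .inr c => Gen c c.ng (-1) v) ?_ ?_
  · obtain ⟨g, hg⟩ := key
    exact ⟨g, fun v hv => hg v (reg_iff.1 hv)⟩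
  · rintro (⟨c, d⟩ | c) q hq
    · by_cases hcd : c = d
      · simp [den, hcd]
      · have := dvd_of_gen (Ne.symm hcd) 0 q fun v hv => hq v ⟨hcd, by simpa using hv⟩
        simpa [den, hcd] using this
    · have := dvd_of_gen (ng_ne c) (-1) q fun v hv => hq v (by simpa using hv)
      have e : c.lin - c.ng.lin - C (((-1 : ℝ) : ℝ) : ℂ) = C 2 * (c.lin + C (1/2)) := by
        rw [lin_ng, mul_add, ← C_mul, map_ofNat]; norm_num; ring
      rw [e] at this
      exact (IsUnit.mul_left_dvd ((isUnit_iff_ne_zero.2 two_ne_zero).map C)).1 this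
  · rintro (⟨a, b⟩ | a) v hG
    · obtain ⟨hab, hv⟩ := hG
      have h : b ≠ a := Ne.symm hab
      refine ⟨a.bv - b.bv, ?_, ?_⟩
      · have : ∀ᶠ ε in 𝓝[≠] (0 : ℂ), Reg (v + ε • (a.bv - b.bv)) := by
          refine eventually_reg (fun c d hcd => ?_) fun c => Or.inl (hv.half_zero c)
          by_cases hd : d = rs a b c
          · right
            subst hd
            rw [← sub_ne_zero, co_root_rs h]
            exact mul_ne_zero two_ne_zero (co_root_ne h hcd.symm)
          · exact Or.inl (hv.ne c d hcd hd)
        filter_upwards [this] with ε hε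
        exact reg_iff.1 hε
      · have := (tendsto_root hp h hv).const_mul (co a (a.bv - b.bv) - co b (a.bv - b.bv))
        rw [mul_zero] at this
        refine this.congr fun ε => ?_
        simp only [den, hab, if_false, map_sub, eval_lin, co_add, co_smul]
        linear_combination (-df m1 m2 m3 p (v + ε • (a.bv - b.bv))) * hv.eq
    · have hv : Gen a a.ng (-1) v := hG
      have h := ng_ne a
      have ha : co a v = -1/2 := by
        have := hv.eq; rw [co_ng] at this; linear_combination this / 2
      refine ⟨a.bv, ?_, ?_⟩
      · have : ∀ᶠ ε in 𝓝[≠] (0 : ℂ), Reg (v + ε • a.bv) := by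
          refine eventually_reg (fun c d hcd => Or.inl (hv.reg_ne h (by norm_num) hcd)) fun c => ?_
          by_cases hc : c = a
          · subst hc; right; rw [co_bv_self]; norm_num
          · left
            by_cases h1 : c.1 = a.1
            · have := (eq_or_eq_ng h1).resolve_left hc
              rw [this, co_ng, ha]; norm_num
            · exact hv.half c (by simp [h1])
        filter_upwards [this] with ε hε
        exact reg_iff.1 hε
      · refine (tendsto_half hp hv).congr fun ε => ?_
        simp only [den, map_add, eval_lin, eval_C, co_add, co_smul, co_bv_self, ha]
        ring

end Sg

end

section

/-- Restriction of a polynomial to a line. -/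
def linePoly {n : ℕ} (v u : Fin n → ℂ) (p : MvPolynomial (Fin n) ℂ) : Polynomial ℂ :=
  aeval (fun i => Polynomial.C (v i) + Polynomial.C (u i) * Polynomial.X) p

lemma eval_linePoly {n : ℕ} (v u : Fin n → ℂ) (p : MvPolynomial (Fin n) ℂ) (ε : ℂ) :
    (linePoly v u p).eval ε = eval (v + ε • u) p := by
  have h1 : ((Polynomial.aeval ε).comp (aeval (fun i => Polynomial.C (v i) +
      Polynomial.C (u i) * Polynomial.X) : MvPolynomial (Fin n) ℂ →ₐ[ℂ] Polynomial ℂ)) =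
      aeval (v + ε • u) := by
    ext i; simp; ring
  have h2 := DFunLike.congr_fun h1 p
  rw [AlgHom.comp_apply, Polynomial.coe_aeval_eq_eval, MvPolynomial.aeval_eq_eval] at h2
  exact h2

namespace Sg

open Filter Topology

variable {N : ℕ} {m1 m2 m3 : ℕ} {p : MvPolynomial (Fin N) ℂ}

/-- Action of a permutation of signed indices on polynomials. -/
def actP (π : Equiv.Perm (Sg N)) (p : MvPolynomial (Fin N) ℂ) : MvPolynomial (Fin N) ℂ :=
  aeval (fun j => lin (π.symm (j, 1))) p

lemma eval_actP (π : Equiv.Perm (Sg N)) (p : MvPolynomial (Fin N) ℂ) (v) :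
    eval v (actP π p) = eval (act π v) p := by
  rw [actP, aeval_def, eval_eval₂]
  have : ((eval v).comp (algebraMap ℂ (MvPolynomial (Fin N) ℂ))) = RingHom.id ℂ := by
    ext c; simp [algebraMap_eq]
  rw [this, eval₂_id]
  congr 2
  funext i
  simp [act]

lemma df_act {a b : Sg N} (h : b ≠ a) (v) : df m1 m2 m3 p (act (rs a b) v) =
    ∑ c, cf m1 m2 m3 c v * (eval (act (rs a b) (v + bv c)) p - eval (act (rs a b) v) p) := by
  have hodd := rs_odd a b h
  rw [df]
  refine Finset.sum_equiv (rs a b) (by simp) fun c _ => ?_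
  rw [cf_act hodd, rs_symm a b h, act_add hodd, act_bv hodd, rs_rs h]

lemma df_act_eq {a b : Sg N} (h : b ≠ a) {v}
    (hc : ∀ c, cf m1 m2 m3 c v = 0 ∨ Inv p a b (v + bv c)) (hv : Inv p a b v) :
    df m1 m2 m3 p (act (rs a b) v) = df m1 m2 m3 p v := by
  rw [df_act h, df]
  refine Finset.sum_congr rfl fun c _ => ?_
  rcases hc c with h1 | h1
  · simp [h1]
  · unfold Inv at h1 hv
    rw [h1, hv]

lemma cf_eq_zero {c d : Sg N} (hcd : d ≠ c) {v} (h : co c v - co d v = mu m1 m3 c d) :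
    cf m1 m2 m3 c v = 0 := by
  rw [cf, Finset.prod_eq_zero (Finset.mem_erase.2 ⟨hcd, Finset.mem_univ d⟩), mul_zero]
  rw [fac, h]; simp

lemma long_cond (hp : QE m1 m2 m3 p) {a b : Sg N} (h : b ≠ a) (h' : b ≠ a.ng) {s : ℕ} (hs : 1 ≤ s)
    (hs' : s ≤ m3) {v} (hv : co a v - co b v = s) (c) :
    cf m1 m2 m3 c v = 0 ∨ Inv p a b (v + bv c) := by
  obtain ⟨n, hn, hn', hn1⟩ := root_bv h h' c
  by_cases hb : n = 1 ∧ s = m3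
  · left
    rcases hn1 hb.1 with rfl | rfl
    · refine cf_eq_zero h ?_
      rw [hv, hb.2]; simp [mu, h']
    · refine cf_eq_zero (d := a.ng) (fun e => h (ng_inj.1 e).symm) ?_
      have : a.ng ≠ b := fun e => h' e.symm
      rw [co_ng, co_ng, mu, ng_ng, if_neg this, ← hb.2, ← hv]; ring
  · right
    rw [abs_le] at hn
    refine hp.inv_long h h' (s + n) (abs_le.2 ?_) ?_
    · omega
    · rw [co_add, co_add]; push_cast; linear_combination hv + hn'

lemma short_cond (hp : QE m1 m2 m3 p) {a : Sg N} {s : ℕ} (hs : 1 ≤ s)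
    (hs' : s ≤ m1) {v} (hv : co a v - co a.ng v = 2 * s) (c) :
    cf m1 m2 m3 c v = 0 ∨ Inv p a a.ng (v + bv c) := by
  obtain ⟨n, hn, hn', hn1, -⟩ := short_bv a c
  by_cases hb : n = 1 ∧ s = m1
  · left
    obtain rfl := hn1 hb.1
    refine cf_eq_zero (ng_ne c) ?_
    rw [hv, hb.2]; simp [mu]
  · right
    rw [abs_le] at hn
    refine hp.inv_short (s + n) (abs_le.2 ?_) ?_
    · omega
    · rw [co_add, co_add]; push_cast; linear_combination hv + hn'

lemma half_cond (hp : QE m1 m2 m3 p) {a : Sg N} {s : ℕ} (hs : 1 ≤ s)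
    (hs' : s ≤ m2) {v} (hv : co a v - co a.ng v = 2 * s - 1) (c) :
    cf m1 m2 m3 c v = 0 ∨ Inv p a a.ng (v + bv c) := by
  obtain ⟨n, hn, hn', hn1, -⟩ := short_bv a c
  by_cases hb : n = 1 ∧ s = m2
  · left
    obtain rfl := hn1 hb.1
    have : hf m2 c v = 0 := by
      rw [co_ng] at hv
      rw [hf, ← hb.2]
      have : co c v - s + 1/2 = 0 := by linear_combination hv / 2
      rw [this, zero_div]
    rw [cf, this, zero_mul]
  · right
    rw [abs_le] at hn
    refine hp.inv_half (s + n) (by omega) (by omega) ?_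
    rw [co_add, co_add]; push_cast; linear_combination hv + hn'

variable {g : MvPolynomial (Fin N) ℂ} (hg : ∀ v, Reg v → eval v g = df m1 m2 m3 p v)

include hg

lemma exceptional (hp : QE m1 m2 m3 p) {a : Sg N} (hm : 1 ≤ m2) {v} (hv : Gen a a.ng 1 v) :
    eval (act (rs a a.ng) v) g = eval v g := by
  have h := ng_ne a
  have hodd := rs_odd a a.ng h
  have hne : ∀ {c d : Sg N}, c ≠ d → co c v ≠ co d v := hv.reg_ne h (by norm_num)
  have ha : co a v = 1/2 := by
    have := hv.eq; rw [co_ng] at this; linear_combination this / 2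
  have hhalf : ∀ c, c ≠ a.ng → co c v + 1/2 ≠ 0 := by
    intro c hc
    by_cases h1 : c.1 = a.1
    · rw [(eq_or_eq_ng h1).resolve_right hc, ha]; norm_num
    · exact hv.half c (by simp [h1])
  have hreg : ∀ᶠ ε in 𝓝[≠] (0 : ℂ), Reg (v + ε • a.bv) := by
    refine eventually_reg (fun c d hcd => Or.inl (hne hcd)) fun c => ?_
    by_cases hc : c = a.ng
    · subst hc; right; rw [co_ng, co_bv_self]; norm_num
    · exact Or.inl (hhalf c hc)
  set H : MvPolynomial (Fin N) ℂ := actP (rs a a.ng) p - p with hH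
  have hHe : ∀ y, eval y H = eval (act (rs a a.ng) y) p - eval y p := fun y => by
    rw [hH, map_sub, eval_actP]
  have hH0 : eval v H = 0 := by
    rw [hHe, sub_eq_zero]
    exact hp.inv_half 1 (by omega) (by omega) (by rw [hv.eq]; norm_num)
  have hterm : ∀ c, Tendsto (fun ε : ℂ => cf m1 m2 m3 c (v + ε • a.bv) *
      (eval (v + ε • a.bv + bv c) H - eval (v + ε • a.bv) H)) (𝓝[≠] 0) (𝓝 0) := by
    intro c
    by_cases hc : c = a.ng
    · subst hc
      obtain ⟨K, hK⟩ : Polynomial.X ∣ linePoly v a.bv H := by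
        rw [Polynomial.X_dvd_iff, Polynomial.coeff_zero_eq_eval_zero, eval_linePoly]
        simpa using hH0
      have hK : ∀ ε, eval (v + ε • a.bv) H = ε * K.eval ε := fun ε => by
        rw [← eval_linePoly, hK]; simp
      have h2 : ∀ ε, eval (v + ε • a.bv + a.ng.bv) H = ε * K.eval (-ε) := by
        intro ε
        have h3 : act (rs a a.ng) (v + ε • a.bv + a.ng.bv) = v + (-ε) • a.bv := by
          rw [act_rs_ng, bv_ng, ← sub_eq_add_neg, co_sub, co_add, co_smul, co_bv_self, ha]
          module
        rw [hHe, h3]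
        have h4 := hK (-ε)
        rw [hHe, ← h3, act_act a _ h, h3] at h4
        linear_combination -h4
      have hpole : Tendsto (fun ε : ℂ => cf m1 m2 m3 a.ng (v + ε • a.bv) * ε) (𝓝[≠] 0)
          (𝓝 ((0 + m2) * ∏ d ∈ Finset.univ.erase a.ng, fac m1 m3 a.ng d v)) := by
        refine ((tendsto_id'.add_const (m2 : ℂ)).mul (tendsto_finsetProd (Finset.univ.erase a.ng)
          fun d hd => tendsto_fac (m1 := m1) (m3 := m3)
            (hne (Finset.ne_of_mem_erase hd).symm) a.bv)).congr' ?_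
        filter_upwards [self_mem_nhdsWithin] with ε hε
        have hε : ε ≠ 0 := hε
        have e1 : co a.ng (v + ε • a.bv) = -1/2 - ε := by
          rw [co_ng, co_add, co_smul, co_bv_self, ha]; ring
        rw [cf, hf, e1]
        have e2 : -1/2 - ε - m2 + 1/2 = -(ε + m2) := by ring
        have e3 : -1/2 - ε + 1/2 = -ε := by ring
        rw [e2, e3]
        field_simp
      have hKc : Tendsto (fun ε : ℂ => K.eval (-ε) - K.eval ε) (𝓝[≠] 0) (𝓝 0) := by
        have hc : Continuous fun ε : ℂ => K.eval (-ε) - K.eval ε :=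
          (K.continuous.comp continuous_neg).sub K.continuous
        have := hc.tendsto 0
        simp only [neg_zero, sub_self] at this
        exact this.mono_left nhdsWithin_le_nhds
      have := hpole.mul hKc
      rw [mul_zero] at this
      refine this.congr fun ε => ?_
      rw [h2, hK]; ring
    · have h1 := (tendsto_cf (m1 := m1) (m2 := m2) (m3 := m3)
        (fun d hd => hne hd) (hhalf c hc) a.bv).mul (tendsto_shift H v (bv a) (bv c))
      have h2 : cf m1 m2 m3 c v * (eval (v + bv c) H - eval v H) = 0 := by
        rcases half_cond (s := 1) hp le_rfl hm (by rw [hv.eq]; norm_num) c with e | e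
        · rw [e, zero_mul]
        · unfold Inv at e
          rw [hH0, hHe, e]; ring
      rwa [h2] at h1
  have hsum := tendsto_finsetSum Finset.univ fun c _ => hterm c
  simp only [Finset.sum_const_zero] at hsum
  have hlim := tendsto_eval_line (actP (rs a a.ng) g - g) v a.bv
  have := tendsto_nhds_unique hlim (hsum.congr' ?_)
  · rwa [map_sub, eval_actP, sub_eq_zero] at this
  · filter_upwards [hreg] with ε hε
    symm
    rw [map_sub, eval_actP, hg _ hε, hg _ (hε.act hodd), df_act h, df, ← Finset.sum_sub_distrib]
    refine Finset.sum_congr rfl fun c _ => ?_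
    rw [hHe, hHe]; ring

/-- The difference operator preserves quasi-invariance. -/
theorem QE.df (hp : QE m1 m2 m3 p) : QE m1 m2 m3 g := by
  have main : ∀ {a b : Sg N} (h : b ≠ a) (t : ℝ), (∀ v, Gen a b t v →
      eval (act (rs a b) v) g = eval v g) → ∀ y, co a y - co b y = t →
      eval (act (rs a b) y) g = eval y g := by
    intro a b h t hG y hy
    have := vanish_of_gen h t (actP (rs a b) g - g)
      (fun v hv => by rw [map_sub, eval_actP, hG v hv, sub_self]) y hy
    rwa [map_sub, eval_actP, sub_eq_zero] at this
  have core : ∀ {a b : Sg N} (h : b ≠ a) {v}, Reg v →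
      (∀ c, cf m1 m2 m3 c v = 0 ∨ Inv p a b (v + bv c)) → Inv p a b v →
      eval (act (rs a b) v) g = eval v g := by
    intro a b h v hv hc hi
    rw [hg _ hv, hg _ (hv.act (rs_odd a b h)), df_act_eq h hc hi]
  constructor
  · intro a s hs hs' y hy
    have h := ng_ne a
    refine main h (2 * s) (fun v hv => ?_) y (by rw [co_ng, hy]; push_cast; ring)
    push_cast at hv
    have ht : (2 : ℂ) * s ≠ 0 := mul_ne_zero two_ne_zero (by exact_mod_cast (by omega : s ≠ 0))
    have hodd : ∀ n : ℤ, (n : ℂ) + 1/2 ≠ 0 := fun n e => by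
      have : ((2 * n + 1 : ℤ) : ℂ) = 0 := by push_cast; linear_combination 2 * e
      have := Int.cast_eq_zero.1 this
      omega
    have ha : co a v = s := by
      have := hv.eq; rw [co_ng] at this; linear_combination this / 2
    refine core h ⟨fun c d hcd => hv.reg_ne h ht hcd, fun c => ?_⟩
      (short_cond hp hs hs' hv.eq) (hp.inv_short s (by rw [Nat.abs_cast]; omega) (by rw [hv.eq]; simp))
    by_cases h1 : c.1 = a.1
    · rcases eq_or_eq_ng h1 with rfl | rfl
      · rw [ha]; exact_mod_cast hodd s
      · rw [co_ng, ha]; simpa using hodd (-s)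
    · exact hv.half c (by simp [h1])
  · intro a s hs hs' y hy
    have h := ng_ne a
    refine main h (2 * s - 1) (fun v hv => ?_) y (by rw [co_ng, hy]; push_cast; ring)
    push_cast at hv
    by_cases hs1 : s = 1
    · subst hs1
      refine exceptional hg hp hs' ?_
      have e : (2 * ((1 : ℕ) : ℂ) - 1) = 1 := by norm_num
      rwa [e] at hv
    have ht : (2 : ℂ) * s - 1 ≠ 0 := fun e => by
      have : ((2 * s - 1 : ℤ) : ℂ) = 0 := by push_cast; exact e
      have := Int.cast_eq_zero.1 this
      omega
    have ha : co a v = s - 1/2 := by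
      have := hv.eq; rw [co_ng] at this; linear_combination this / 2
    refine core h ⟨fun c d hcd => hv.reg_ne h ht hcd, fun c => ?_⟩
      (half_cond hp hs hs' hv.eq) (hp.inv_half s (by omega) (by omega) (by rw [hv.eq]; simp))
    by_cases h1 : c.1 = a.1
    · rcases eq_or_eq_ng h1 with rfl | rfl
      · rw [ha, sub_add_cancel]; exact_mod_cast (by omega : s ≠ 0)
      · rw [co_ng, ha]
        intro e
        apply hs1
        have : (s : ℂ) = 1 := by linear_combination -e
        exact_mod_cast this
    · exact hv.half c (by simp [h1])
  · intro a b h h' s hs hs' y hy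
    refine main h s (fun v hv => ?_) y (by simpa using hy)
    have ht : ((s : ℝ) : ℂ) ≠ 0 := by exact_mod_cast (by omega : s ≠ 0)
    have he : co a v - co b v = s := by simpa using hv.eq
    exact core h ⟨fun c d hcd => hv.reg_ne h ht hcd, fun c => hv.half c (by simp [h'])⟩
      (long_cond hp h h' hs hs' he) (hp.inv_long h h' s (by rw [Nat.abs_cast]; omega) (by simpa using he))

end Sg

end

section

section Line

open Filter Topology

variable {n : ℕ}

/-- The derivation in the direction of a vector. -/
def dirDer (u : Fin n → ℂ) : Derivation ℂ (MvPolynomial (Fin n) ℂ) (MvPolynomial (Fin n) ℂ) :=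
  mkDerivation ℂ fun i => C (u i)

lemma derivative_linePoly (v u : Fin n → ℂ) (p : MvPolynomial (Fin n) ℂ) :
    Polynomial.derivative (linePoly v u p) = linePoly v u (dirDer u p) := by
  induction p using MvPolynomial.induction_on with
  | C a => simp [linePoly, dirDer]
  | add p q hp hq =>
    simp only [linePoly, map_add] at *
    rw [hp, hq]
  | mul_X p i hp =>
    simp only [linePoly, map_mul, aeval_X, Polynomial.derivative_mul, Derivation.leibniz, map_add,
      smul_eq_mul] at *
    rw [hp]
    simp [dirDer, mkDerivation_X]
    ring

lemma linePoly_expand (v u : Fin n → ℂ) (p : MvPolynomial (Fin n) ℂ) :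
    ∃ M : Polynomial ℂ, (∀ ε, eval (v + ε • u) p = eval v p + ε * (eval v (dirDer u p) + ε * M.eval ε)) ∧
      2 * M.eval 0 = eval v (dirDer u (dirDer u p)) := by
  set P := linePoly v u p with hP
  have hd0 : Polynomial.derivative P = linePoly v u (dirDer u p) := derivative_linePoly v u p
  have hd1 : Polynomial.derivative (Polynomial.derivative P) = linePoly v u (dirDer u (dirDer u p)) := by
    rw [hd0, derivative_linePoly]
  have h0 : ∀ q, (linePoly v u q).coeff 0 = eval v q := fun q => by
    rw [Polynomial.coeff_zero_eq_eval_zero, eval_linePoly]; simp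
  have e0 : P.coeff 0 = eval v p := h0 p
  have e1 : P.coeff 1 = eval v (dirDer u p) := by
    rw [← h0, ← hd0, Polynomial.coeff_derivative]; simp
  have e2 : 2 * P.coeff 2 = eval v (dirDer u (dirDer u p)) := by
    rw [← h0, ← hd1, Polynomial.coeff_derivative, Polynomial.coeff_derivative]; norm_num; ring
  refine ⟨P.divX.divX, fun ε => ?_, ?_⟩
  · have h1 := congrArg (Polynomial.eval ε) P.divX_mul_X_add
    have h2 := congrArg (Polynomial.eval ε) P.divX.divX_mul_X_add
    simp only [Polynomial.eval_add, Polynomial.eval_mul, Polynomial.eval_X, Polynomial.eval_C,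
      Polynomial.coeff_divX, zero_add] at h1 h2
    rw [← eval_linePoly, ← hP, ← e0, ← e1, ← h1, ← h2]; ring
  · rw [← Polynomial.coeff_zero_eq_eval_zero, Polynomial.coeff_divX, Polynomial.coeff_divX]
    exact e2

lemma coeff_of_tendsto (R : Polynomial ℂ) (k : ℕ) (f : ℂ → ℂ) (c : ℂ)
    (hf : Tendsto f (𝓝[≠] 0) (𝓝 c)) (h : ∀ᶠ ε in 𝓝[≠] (0 : ℂ), R.eval ε = ε ^ k * f ε) :
    (∀ i < k, R.coeff i = 0) ∧ R.coeff k = c := by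
  have hR : ∀ R : Polynomial ℂ, Tendsto (fun ε => R.eval ε) (𝓝[≠] 0) (𝓝 (R.coeff 0)) := by
    intro R
    rw [Polynomial.coeff_zero_eq_eval_zero]
    exact (R.continuous.tendsto 0).mono_left nhdsWithin_le_nhds
  have hid : Tendsto (fun ε : ℂ => ε) (𝓝[≠] 0) (𝓝 0) := tendsto_id.mono_left nhdsWithin_le_nhds
  induction k generalizing R with
  | zero =>
    refine ⟨by simp, tendsto_nhds_unique (hR R) (hf.congr' ?_)⟩
    filter_upwards [h] with ε hε
    rw [hε]; simp
  | succ k ih =>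
    have h0 : R.coeff 0 = 0 := by
      refine tendsto_nhds_unique (hR R) ?_
      have h1 := (hid.pow (k + 1)).mul hf
      rw [zero_pow (by omega), zero_mul] at h1
      refine h1.congr' ?_
      filter_upwards [h] with ε hε
      rw [hε]
    obtain ⟨S, rfl⟩ := Polynomial.X_dvd_iff.2 h0
    have := ih S (by
      filter_upwards [h, self_mem_nhdsWithin] with ε hε hε0
      have hε0 : ε ≠ 0 := hε0
      simp only [Polynomial.eval_mul, Polynomial.eval_X] at hε
      apply mul_left_cancel₀ hε0
      rw [hε]; ring)
    refine ⟨?_, ?_⟩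
    · rintro (_ | i) hi
      · simp
      · rw [Polynomial.coeff_X_mul]; exact this.1 i (by omega)
    · rw [Polynomial.coeff_X_mul]; exact this.2

lemma coeff_at_infinity (G : Polynomial ℂ) (d k : ℕ) (f : ℂ → ℂ) (c : ℂ)
    (hf : Tendsto f (𝓝[≠] 0) (𝓝 c))
    (h : ∀ᶠ ε in 𝓝[≠] (0 : ℂ), ε ^ d * G.eval ε⁻¹ = ε ^ k * f ε) :
    (∀ j, d < j + k → G.coeff j = 0) ∧ ∀ j, d = j + k → G.coeff j = c := by
  set M := G.natDegree + d with hM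
  have key := coeff_of_tendsto (G.reflect M) (M - d + k) f c hf (by
    filter_upwards [h, self_mem_nhdsWithin] with ε hε hε0
    have hε0 : ε ≠ 0 := hε0
    let _ := invertibleOfNonzero (inv_ne_zero hε0)
    have := Polynomial.eval₂_reflect_mul_pow (RingHom.id ℂ) ε⁻¹ M G (by omega)
    rw [Polynomial.eval₂_id, Polynomial.eval₂_id] at this
    simp only [invOf_eq_inv, inv_inv] at this
    rw [← this, inv_pow] at hε
    have h2 : ε ^ M ≠ 0 := pow_ne_zero _ hε0
    have h3 : ε ^ d ≠ 0 := pow_ne_zero _ hε0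
    apply mul_left_cancel₀ h3
    have h4 : ε ^ d * ε ^ (M - d + k) = ε ^ M * ε ^ k := by
      rw [← pow_add, ← pow_add]; congr 1; omega
    rw [← mul_assoc, h4]
    field_simp at hε
    linear_combination hε)
  have hrev : ∀ j ≤ M, (G.reflect M).coeff (M - j) = G.coeff j := fun j hj => by
    rw [Polynomial.coeff_reflect, Polynomial.revAt_le (by omega)]
    congr 1; omega
  refine ⟨fun j hj => ?_, fun j hj => ?_⟩
  · by_cases hjM : j ≤ M
    · rw [← hrev j hjM]
      exact key.1 _ (by omega)
    · exact Polynomial.coeff_eq_zero_of_natDegree_lt (by omega)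
  · rw [← hrev j (by omega), ← key.2]
    congr 1; omega

lemma eval_smul_of_isHomogeneous {p : MvPolynomial (Fin n) ℂ} {d : ℕ} (hp : p.IsHomogeneous d)
    (t : ℂ) (x : Fin n → ℂ) : eval (t • x) p = t ^ d * eval x p := by
  rw [eval_eq, eval_eq, Finset.mul_sum]
  refine Finset.sum_congr rfl fun s hs => ?_
  have h1 := hp (mem_support_iff.1 hs)
  simp only [Pi.smul_apply, smul_eq_mul, mul_pow, Finset.prod_mul_distrib, Finset.prod_pow_eq_pow_sum]
  rw [← h1, Finsupp.weight_apply, Finsupp.sum]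
  simp only [Pi.one_apply, smul_eq_mul, mul_one]; ring

lemma coeff_linePoly_zero (x : Fin n → ℂ) (p : MvPolynomial (Fin n) ℂ) (i : ℕ) :
    (linePoly 0 x p).coeff i = eval x (homogeneousComponent i p) := by
  have h1 : linePoly 0 x p = ∑ j ∈ Finset.range (p.totalDegree + 1),
      Polynomial.monomial j (eval x (homogeneousComponent j p)) := by
    apply Polynomial.funext
    intro t
    rw [eval_linePoly, Polynomial.eval_finsetSum, zero_add]
    nth_rewrite 1 [← sum_homogeneousComponent p]
    rw [map_sum]
    refine Finset.sum_congr rfl fun j _ => ?_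
    rw [eval_smul_of_isHomogeneous (homogeneousComponent_isHomogeneous j p), Polynomial.eval_monomial]
    ring
  rw [h1, Polynomial.finsetSum_coeff]
  simp only [Polynomial.coeff_monomial, Finset.sum_ite_eq', Finset.mem_range]
  split_ifs with h
  · rfl
  · rw [homogeneousComponent_eq_zero _ _ (by omega), map_zero]

end Line

namespace Sg

open Filter Topology

variable {N : ℕ} {m1 m2 m3 : ℕ} {p : MvPolynomial (Fin N) ℂ}

variable (m1 m2 m3) in
/-- First-order coefficient of the operator. -/
def ellAt (c : Sg N) (x : Fin N → ℂ) : ℂ :=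
  m2 / co c x + ∑ d ∈ Finset.univ.erase c, mu m1 m3 c d / (co c x - co d x)

variable (m1 m2 m3) in
/-- The rational Calogero–Moser operator. -/
def calAt (p : MvPolynomial (Fin N) ℂ) (x : Fin N → ℂ) : ℂ :=
  ∑ c, (eval x (dirDer (bv c) (dirDer (bv c) p)) / 2 - ellAt m1 m2 m3 c x * eval x (dirDer (bv c) p))

/-- Points off the reflection hyperplanes. -/
def Reg₀ (x : Fin N → ℂ) : Prop := ∀ c d : Sg N, c ≠ d → co c x ≠ co d x

lemma Reg₀.ne_zero {x : Fin N → ℂ} (hx : Reg₀ x) (c : Sg N) : co c x ≠ 0 := by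
  intro h
  exact hx _ _ (ng_ne c) (by rw [co_ng, h, neg_zero])

lemma reg_smul {x : Fin N → ℂ} (hx : Reg₀ x) : ∀ᶠ ε in 𝓝[≠] (0 : ℂ), Reg (ε⁻¹ • x) := by
  have h1 : ∀ᶠ ε in 𝓝[≠] (0 : ℂ), ∀ c : Sg N, co c x + ε * (1/2) ≠ 0 := by
    simp only [eventually_all]
    intro c
    have : Tendsto (fun ε : ℂ => co c x + ε * (1/2)) (𝓝[≠] 0) (𝓝 (co c x + 0 * (1/2))) :=
      (tendsto_id'.mul_const _).const_add _
    exact this.eventually_ne (by simpa using hx.ne_zero c)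
  filter_upwards [h1, self_mem_nhdsWithin] with ε h2 h3
  have h3 : ε ≠ 0 := h3
  refine ⟨fun c d hcd e => hx c d hcd ?_, fun c e => h2 c ?_⟩
  · rw [co_smul, co_smul] at e
    exact mul_left_cancel₀ (inv_ne_zero h3) e
  · rw [co_smul] at e
    field_simp at e
    linear_combination e / 2

lemma tendsto_slope_cf {x : Fin N → ℂ} (hx : Reg₀ x) (c : Sg N) :
    Tendsto (fun ε : ℂ => (cf m1 m2 m3 c (ε⁻¹ • x) - 1) / ε) (𝓝[≠] 0) (𝓝 (-ellAt m1 m2 m3 c x)) := by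
  have hc := hx.ne_zero c
  set A : ℂ → ℂ := fun ε => (co c x + ε * (1/2 - m2)) / (co c x + ε * (1/2)) *
    ∏ d ∈ Finset.univ.erase c, (1 - ε * (mu m1 m3 c d / (co c x - co d x))) with hA
  have h1 : HasDerivAt (fun ε : ℂ => (co c x + ε * (1/2 - m2)) / (co c x + ε * (1/2)))
      (-(m2 / co c x)) 0 := by
    have e1 := (((hasDerivAt_id (0 : ℂ)).mul_const (1/2 - (m2 : ℂ))).const_add (co c x)).div
      (((hasDerivAt_id (0 : ℂ)).mul_const (1/2 : ℂ)).const_add (co c x)) (by simpa using hc)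
    refine e1.congr_deriv ?_
    simp
    field_simp
    ring
  have h2 : HasDerivAt (fun ε : ℂ => ∏ d ∈ Finset.univ.erase c,
      (1 - ε * (mu m1 m3 c d / (co c x - co d x))))
      (-∑ d ∈ Finset.univ.erase c, mu m1 m3 c d / (co c x - co d x)) 0 := by
    have e1 := HasDerivAt.fun_finsetProd (u := Finset.univ.erase c) (x := (0 : ℂ))
      (f := fun d ε => 1 - ε * (mu m1 m3 c d / (co c x - co d x))) fun d _ =>
        ((hasDerivAt_id (0 : ℂ)).mul_const (mu m1 m3 c d / (co c x - co d x))).const_sub 1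
    refine e1.congr_deriv ?_
    simp
  have h3 : HasDerivAt A (-ellAt m1 m2 m3 c x) 0 := by
    have := h1.mul h2
    refine this.congr_deriv ?_
    simp [ellAt, hc]; ring
  rw [hasDerivAt_iff_tendsto_slope] at h3
  refine h3.congr' ?_
  filter_upwards [self_mem_nhdsWithin] with ε hε
  have hε : ε ≠ 0 := hε
  have hA0 : A 0 = 1 := by simp [hA, hc]
  rw [slope_def_field, hA0, sub_zero]
  congr 2
  rw [hA, cf]
  simp only
  congr 1
  · have a1 : ε * (ε⁻¹ * co c x - m2 + 1/2) = co c x + ε * (1/2 - m2) := by field_simp; ring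
    have a2 : ε * (ε⁻¹ * co c x + 1/2) = co c x + ε * (1/2) := by field_simp
    rw [hf, co_smul, ← a1, ← a2, mul_div_mul_left _ _ hε]
  · refine Finset.prod_congr rfl fun d hd => ?_
    have h4 : co c x - co d x ≠ 0 := sub_ne_zero.2 (hx c d (Finset.ne_of_mem_erase hd).symm)
    rw [fac, co_smul, co_smul, ← mul_sub]
    field_simp

lemma tendsto_df_homogeneous {x : Fin N → ℂ} (hx : Reg₀ x) {j : ℕ} (hp : p.IsHomogeneous j) :
    Tendsto (fun ε : ℂ => ε ^ j * df m1 m2 m3 p (ε⁻¹ • x) / ε ^ 2) (𝓝[≠] 0)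
      (𝓝 (calAt m1 m2 m3 p x)) := by
  choose M hM hM0 using fun c : Sg N => linePoly_expand x (bv c) p
  have hMc : ∀ c, Tendsto (fun ε => (M c).eval ε) (𝓝[≠] 0) (𝓝 ((M c).eval 0)) := fun c =>
    ((M c).continuous.tendsto 0).mono_left nhdsWithin_le_nhds
  have h1 : ∀ c, Tendsto (fun ε : ℂ => (cf m1 m2 m3 c (ε⁻¹ • x) - 1) / ε *
      (eval x (dirDer (bv c) p) + ε * (M c).eval ε) + (M c).eval ε) (𝓝[≠] 0)
      (𝓝 (-ellAt m1 m2 m3 c x * (eval x (dirDer (bv c) p) + 0 * (M c).eval 0) + (M c).eval 0)) :=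
    fun c => ((tendsto_slope_cf hx c).mul ((tendsto_id'.mul (hMc c)).const_add _)).add (hMc c)
  have h2 := tendsto_finsetSum Finset.univ fun c _ => h1 c
  have h3 : ∑ c, (-ellAt m1 m2 m3 c x * (eval x (dirDer (bv c) p) + 0 * (M c).eval 0) + (M c).eval 0) =
      calAt m1 m2 m3 p x := by
    refine Finset.sum_congr rfl fun c _ => ?_
    rw [← hM0]; ring
  rw [h3] at h2
  have h4 : ∑ c : Sg N, eval x (dirDer (bv c) p) = 0 := by
    have e1 : ∀ c : Sg N, eval x (dirDer (bv c.ng) p) = -eval x (dirDer (bv c) p) := by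
      intro c
      have : dirDer (bv c.ng) = -dirDer (bv c) := by
        apply derivation_ext
        intro i
        simp [dirDer, bv_ng, mkDerivation_X]
      rw [this]; simp
    refine Finset.sum_involution (fun c _ => c.ng) (fun c _ => by rw [e1]; ring)
      (fun c _ _ => ng_ne c) (by simp) (fun c _ => ng_ng c)
  refine h2.congr' ?_
  filter_upwards [self_mem_nhdsWithin] with ε hε
  have hε : ε ≠ 0 := hε
  have h5 : ∀ v, ε ^ j * eval (ε⁻¹ • v) p = eval v p := fun v => by
    rw [eval_smul_of_isHomogeneous hp, inv_pow, ← mul_assoc, mul_inv_cancel₀ (pow_ne_zero _ hε), one_mul]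
  have h6 : ∀ c : Sg N, ε⁻¹ • x + bv c = ε⁻¹ • (x + ε • bv c) := fun c => by
    rw [smul_add, smul_smul, inv_mul_cancel₀ hε, one_smul]
  have h7 : ε ^ j * df m1 m2 m3 p (ε⁻¹ • x) = ∑ c, cf m1 m2 m3 c (ε⁻¹ • x) *
      (ε * (eval x (dirDer (bv c) p) + ε * (M c).eval ε)) := by
    rw [df, Finset.mul_sum]
    refine Finset.sum_congr rfl fun c _ => ?_
    rw [h6, mul_left_comm, mul_sub, h5, h5, hM]; ring
  rw [h7, Finset.sum_div]
  have h8 : ∀ c, cf m1 m2 m3 c (ε⁻¹ • x) * (ε * (eval x (dirDer (bv c) p) + ε * (M c).eval ε)) / ε ^ 2 =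
      ((cf m1 m2 m3 c (ε⁻¹ • x) - 1) / ε * (eval x (dirDer (bv c) p) + ε * (M c).eval ε) +
        (M c).eval ε) + eval x (dirDer (bv c) p) / ε := by
    intro c; field_simp; ring
  simp only [h8]
  symm
  rw [Finset.sum_add_distrib, ← Finset.sum_div, h4, zero_div, add_zero]

lemma df_add (p q : MvPolynomial (Fin N) ℂ) (v) :
    df m1 m2 m3 (p + q) v = df m1 m2 m3 p v + df m1 m2 m3 q v := by
  simp only [df, map_add, ← Finset.sum_add_distrib]
  exact Finset.sum_congr rfl fun c _ => by ring

lemma df_zero (v) : df m1 m2 m3 (0 : MvPolynomial (Fin N) ℂ) v = 0 := by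
  simp [df]

lemma df_finsetSum {ι : Type} (s : Finset ι) (q : ι → MvPolynomial (Fin N) ℂ) (v) :
    df m1 m2 m3 (∑ i ∈ s, q i) v = ∑ i ∈ s, df m1 m2 m3 (q i) v := by
  classical
  induction s using Finset.induction_on with
  | empty => simp [df_zero]
  | insert a s ha ih => rw [Finset.sum_insert ha, Finset.sum_insert ha, df_add, ih]

lemma tendsto_df {x : Fin N → ℂ} (hx : Reg₀ x) {d : ℕ} (hp : p.totalDegree ≤ d) :
    Tendsto (fun ε : ℂ => ε ^ d * df m1 m2 m3 p (ε⁻¹ • x) / ε ^ 2) (𝓝[≠] 0)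
      (𝓝 (calAt m1 m2 m3 (homogeneousComponent d p) x)) := by
  have hdec : p = ∑ j ∈ Finset.range (d + 1), homogeneousComponent j p := by
    nth_rewrite 1 [← sum_homogeneousComponent p]
    refine Finset.sum_subset (Finset.range_mono (by omega)) fun j _ hj => ?_
    exact homogeneousComponent_eq_zero _ _ (by simpa using hj)
  have h1 : ∀ j ∈ Finset.range (d + 1), Tendsto (fun ε : ℂ => ε ^ (d - j) *
      (ε ^ j * df m1 m2 m3 (homogeneousComponent j p) (ε⁻¹ • x) / ε ^ 2)) (𝓝[≠] 0)
      (𝓝 (if j = d then calAt m1 m2 m3 (homogeneousComponent d p) x else 0)) := by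
    intro j hj
    have h2 := (tendsto_id'.pow (d - j)).mul (tendsto_df_homogeneous (m1 := m1) (m2 := m2) (m3 := m3)
      hx (homogeneousComponent_isHomogeneous j p))
    split_ifs with h
    · subst h; simpa using h2
    · have : d - j ≠ 0 := by simp at hj; omega
      simpa [this] using h2
  have h2 := tendsto_finsetSum _ h1
  simp only [Finset.sum_ite_eq', Finset.mem_range, Nat.lt_succ_self, if_true] at h2
  refine h2.congr' ?_
  filter_upwards [self_mem_nhdsWithin] with ε hε
  nth_rewrite 2 [hdec]
  rw [df_finsetSum, Finset.mul_sum, Finset.sum_div]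
  refine Finset.sum_congr rfl fun j hj => ?_
  rw [mul_div_assoc, ← mul_assoc, ← pow_add, ← mul_div_assoc]
  congr 3
  simp at hj; omega

/-- Nonvanishing locus of the discriminant. -/
def disc (N : ℕ) : MvPolynomial (Fin N) ℂ :=
  ∏ a : Sg N, ∏ b ∈ Finset.univ.erase a, (a.lin - b.lin)

lemma eval_disc_ne {x : Fin N → ℂ} : eval x (disc N) ≠ 0 ↔ Reg₀ x := by
  rw [disc, map_prod, Finset.prod_ne_zero_iff]
  simp only [Finset.mem_univ, true_imp_iff, map_prod, Finset.prod_ne_zero_iff, Finset.mem_erase,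
    and_true, map_sub, eval_lin, sub_ne_zero]
  exact ⟨fun h c d hcd => h c d hcd.symm, fun h c d hcd => h c d (Ne.symm hcd)⟩

lemma reg_base : Reg₀ (base : Fin N → ℂ) := by
  intro c d hcd h
  rw [co_base, co_base] at h
  have := mul_right_cancel₀ Complex.I_ne_zero h
  exact hcd (wt_inj (by exact_mod_cast this))

lemma disc_ne_zero : disc N ≠ 0 := fun h => by
  have := (eval_disc_ne (N := N) (x := base)).2 reg_base
  rw [h] at this; simp at this

lemma eq_zero_of_reg {q : MvPolynomial (Fin N) ℂ} (h : ∀ x, Reg₀ x → eval x q = 0) : q = 0 := by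
  have : disc N * q = 0 := by
    apply MvPolynomial.funext
    intro x
    rw [map_mul, map_zero]
    by_cases hx : Reg₀ x
    · rw [h x hx, mul_zero]
    · rw [not_not.1 (fun h => hx (eval_disc_ne.1 h)), zero_mul]
  exact (mul_eq_zero.1 this).resolve_left disc_ne_zero

variable {g : MvPolynomial (Fin N) ℂ} (hg : ∀ v, Reg v → eval v g = df m1 m2 m3 p v)

include hg

/-- Effect of the difference operator on leading terms. -/
theorem leading_df {d : ℕ} (hp : p.totalDegree ≤ d) :
    (∀ j, d < j + 2 → homogeneousComponent j g = 0) ∧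
    ∀ j, d = j + 2 → ∀ x, Reg₀ x → eval x (homogeneousComponent j g) =
      calAt m1 m2 m3 (homogeneousComponent d p) x := by
  have key : ∀ x, Reg₀ x → (∀ j, d < j + 2 → eval x (homogeneousComponent j g) = 0) ∧
      ∀ j, d = j + 2 → eval x (homogeneousComponent j g) =
        calAt m1 m2 m3 (homogeneousComponent d p) x := by
    intro x hx
    simp only [← coeff_linePoly_zero]
    refine coeff_at_infinity _ d 2 _ _ (tendsto_df hx hp) ?_
    filter_upwards [reg_smul hx, self_mem_nhdsWithin] with ε h1 h2
    have h2 : ε ≠ 0 := h2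
    rw [eval_linePoly, zero_add, hg _ h1]
    field_simp
  exact ⟨fun j hj => eq_zero_of_reg fun x hx => (key x hx).1 j hj, fun j hj x hx => (key x hx).2 j hj⟩

end Sg

end

section

section LocalizedDerivation

variable {A B : Type} [CommRing A] [CommRing B] [Algebra ℂ A] [Algebra ℂ B] [Algebra A B]
  [IsScalarTower ℂ A B] (M : Submonoid A) [IsLocalization M B]

/-- First-order Taylor expansion along a derivation. -/
def taylorHom (D : Derivation ℂ A A) : A →ₐ[ℂ] TrivSqZeroExt B B where
  toFun a := .inl (algebraMap A B a) + .inr (algebraMap A B (D a))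
  map_one' := by ext <;> simp
  map_zero' := by ext <;> simp
  map_add' a b := by
    ext
    · simp
    · simp only [map_add, TrivSqZeroExt.snd_add, TrivSqZeroExt.snd_inl, TrivSqZeroExt.snd_inr,
        zero_add]
  map_mul' a b := by
    ext
    · simp
    · simp only [Derivation.leibniz, smul_eq_mul, map_add, map_mul, TrivSqZeroExt.snd_add,
        TrivSqZeroExt.snd_inl, TrivSqZeroExt.snd_inr, TrivSqZeroExt.snd_mul, TrivSqZeroExt.fst_add,
        TrivSqZeroExt.fst_inl, TrivSqZeroExt.fst_inr, op_smul_eq_smul, smul_eq_mul]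
      ring
  commutes' c := by
    ext
    · simp [← IsScalarTower.algebraMap_apply, TrivSqZeroExt.algebraMap_eq_inl']
    · simp [TrivSqZeroExt.algebraMap_eq_inl']

lemma taylorHom_fst (D : Derivation ℂ A A) (a : A) :
    (taylorHom (B := B) D a).fst = algebraMap A B a := by
  simp [taylorHom]

lemma taylorHom_snd (D : Derivation ℂ A A) (a : A) :
    (taylorHom (B := B) D a).snd = algebraMap A B (D a) := by
  change (TrivSqZeroExt.inl _ + TrivSqZeroExt.inr _ : TrivSqZeroExt B B).snd = _
  rw [TrivSqZeroExt.snd_add, TrivSqZeroExt.snd_inl, TrivSqZeroExt.snd_inr, zero_add]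

/-- The Taylor expansion on the localization. -/
def taylorLift (D : Derivation ℂ A A) : B →ₐ[ℂ] TrivSqZeroExt B B :=
  IsLocalization.liftAlgHom (M := M) (f := taylorHom (B := B) D) fun y => by
    rw [TrivSqZeroExt.isUnit_iff_isUnit_fst]
    rw [taylorHom_fst]
    exact IsLocalization.map_units B y

lemma taylorLift_algebraMap (D : Derivation ℂ A A) (a : A) :
    taylorLift (B := B) M D (algebraMap A B a) = taylorHom D a := by
  rw [taylorLift, IsLocalization.liftAlgHom_apply]
  exact IsLocalization.lift_eq _ a

lemma taylorLift_fst (D : Derivation ℂ A A) (b : B) : (taylorLift M D b).fst = b := by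
  have : ((TrivSqZeroExt.fstHom ℂ B B).comp (taylorLift M D)).toRingHom = RingHom.id B := by
    apply IsLocalization.ringHom_ext M
    ext a
    change (taylorLift M D (algebraMap A B a)).fst = _
    rw [taylorLift_algebraMap, taylorHom_fst]; rfl
  exact DFunLike.congr_fun this b

/-- Extension of a derivation to a localization. -/
def locDer (D : Derivation ℂ A A) : Derivation ℂ B B :=
  Derivation.mk' ((TrivSqZeroExt.sndHom B B).restrictScalars ℂ ∘ₗ (taylorLift M D).toLinearMap)
    fun a b => by
      change (taylorLift M D (a * b)).snd = a • (taylorLift M D b).snd + b • (taylorLift M D a).snd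
      rw [map_mul, TrivSqZeroExt.snd_mul, taylorLift_fst, taylorLift_fst]
      simp [mul_comm]

lemma locDer_algebraMap (D : Derivation ℂ A A) (a : A) :
    locDer (B := B) M D (algebraMap A B a) = algebraMap A B (D a) := by
  change (taylorLift M D (algebraMap A B a)).snd = _
  rw [taylorLift_algebraMap, taylorHom_snd]

omit [Algebra ℂ A] [IsScalarTower ℂ A B] in
include M in
lemma locDer_ext {D E : Derivation ℂ B B}
    (h : ∀ a, D (algebraMap A B a) = E (algebraMap A B a)) : D = E := by
  ext b
  obtain ⟨⟨a, s⟩, hs⟩ := IsLocalization.surj M b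
  have hu := IsLocalization.map_units B s
  have h1 := congrArg D hs
  have h2 := congrArg E hs
  simp only [Derivation.leibniz, h, smul_eq_mul] at h1 h2
  apply hu.mul_left_cancel
  linear_combination h1 - h2

end LocalizedDerivation

namespace Sg

variable {N : ℕ}

/-- Regular functions off the reflection hyperplanes. -/
abbrev LR (N : ℕ) : Type := Localization.Away (disc N)

/-- The inclusion of polynomials. -/
def toLR : MvPolynomial (Fin N) ℂ →ₐ[ℂ] LR N :=
  IsScalarTower.toAlgHom ℂ (MvPolynomial (Fin N) ℂ) (LR N)

lemma isUnit_toLR_disc : IsUnit (toLR (disc N)) := IsLocalization.Away.algebraMap_isUnit (disc N)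

/-- Evaluation at a regular point. -/
def evLR (x : Fin N → ℂ) (hx : Reg₀ x) : LR N →ₐ[ℂ] ℂ :=
  IsLocalization.Away.liftAlgHom (disc N) (f := MvPolynomial.aeval x)
    (by
      have := eval_disc_ne.2 hx
      rw [MvPolynomial.aeval_eq_eval]
      exact isUnit_iff_ne_zero.2 this)

lemma evLR_toLR (x : Fin N → ℂ) (hx : Reg₀ x) (p) : evLR x hx (toLR p) = eval x p := by
  rw [evLR, IsLocalization.Away.liftAlgHom_apply]
  refine (IsLocalization.Away.lift_eq _ _ _).trans ?_
  simp

lemma exists_toLR (r : LR N) : ∃ n p, toLR (disc N ^ n) * r = toLR p := by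
  obtain ⟨n, p, h⟩ := IsLocalization.Away.surj (disc N) r
  refine ⟨n, p, ?_⟩
  rw [map_pow, mul_comm]; exact h

lemma toLR_injective : Function.Injective (toLR (N := N)) :=
  IsLocalization.injective _ (powers_le_nonZeroDivisors_of_noZeroDivisors disc_ne_zero)

lemma LR_eq_zero {r : LR N} (h : ∀ x hx, evLR x hx r = 0) : r = 0 := by
  obtain ⟨n, p, hp⟩ := exists_toLR r
  have : p = 0 := eq_zero_of_reg fun x hx => by
    rw [← evLR_toLR x hx, ← hp, map_mul, h, mul_zero]
  rw [this, map_zero, map_pow] at hp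
  exact (isUnit_toLR_disc.pow n).mul_right_eq_zero.1 hp

lemma LR_ext {r s : LR N} (h : ∀ x hx, evLR x hx r = evLR x hx s) : r = s :=
  sub_eq_zero.1 (LR_eq_zero fun x hx => by rw [map_sub, h, sub_self])

/-- The signed derivatives. -/
def dLR (a : Sg N) : Derivation ℂ (LR N) (LR N) :=
  locDer (Submonoid.powers (disc N)) (dirDer (bv a))

lemma dLR_toLR (a : Sg N) (p) : dLR a (toLR p) = toLR (dirDer (bv a) p) :=
  locDer_algebraMap _ _ _

lemma dirDer_X (u : Fin N → ℂ) (j : Fin N) : dirDer u (X j) = C (u j) := by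
  simp [dirDer]

lemma dirDer_comm (u v : Fin N → ℂ) (p) : dirDer u (dirDer v p) = dirDer v (dirDer u p) := by
  have : ⁅dirDer u, dirDer v⁆ = 0 := by
    apply MvPolynomial.derivation_ext
    intro i
    simp [Derivation.commutator_apply, dirDer_X]
  have h := DFunLike.congr_fun this p
  rw [Derivation.commutator_apply, Derivation.zero_apply, sub_eq_zero] at h
  exact h

lemma dirDer_neg (u : Fin N → ℂ) : dirDer (-u) = -dirDer u := by
  apply MvPolynomial.derivation_ext
  intro i
  simp [dirDer_X]

lemma dirDer_lin (u : Fin N → ℂ) (a : Sg N) : dirDer u a.lin = C (a.co u) := by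
  rw [lin, Derivation.leibniz, dirDer_X, show dirDer u (C a.sg) = 0 from derivation_C _ _, co, C_mul]
  simp

lemma isUnit_toLR_sub {a b : Sg N} (h : a ≠ b) : IsUnit (toLR (a.lin - b.lin)) := by
  have : a.lin - b.lin ∣ disc N :=
    Dvd.dvd.trans (b := ∏ b ∈ Finset.univ.erase a, (a.lin - b.lin))
      (Finset.dvd_prod_of_mem (fun b : Sg N => a.lin - b.lin)
        (Finset.mem_erase.2 ⟨h.symm, Finset.mem_univ b⟩))
      (Finset.dvd_prod_of_mem (fun a : Sg N => ∏ b ∈ Finset.univ.erase a, (a.lin - b.lin))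
        (Finset.mem_univ a))
  obtain ⟨q, hq⟩ := this
  have h1 := isUnit_toLR_disc (N := N)
  have h2 : toLR (disc N) = toLR (a.lin - b.lin) * toLR q := by rw [← map_mul, ← hq]
  rw [h2] at h1
  exact isUnit_of_mul_isUnit_left h1

variable (N) in
/-- The signed data of type `BC`. -/
def data (m k : ℕ) : SignedData (Sg N) (LR N) where
  neg := ng
  neg_neg := ng_ng
  neg_ne := ng_ne
  x a := toLR a.lin
  x_neg a := by rw [lin_ng, map_neg]
  d := dLR
  d_neg a := by
    apply locDer_ext (Submonoid.powers (disc N))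
    intro p
    have := dLR_toLR a p
    have h2 := dLR_toLR a.ng p
    rw [bv_ng, dirDer_neg, Derivation.neg_apply, map_neg, ← this] at h2
    exact h2
  d_comm a b f := by
    have : ⁅dLR a, dLR b⁆ = 0 := by
      apply locDer_ext (Submonoid.powers (disc N))
      intro p
      change ⁅dLR a, dLR b⁆ (toLR p) = 0
      rw [Derivation.commutator_apply, dLR_toLR, dLR_toLR, dLR_toLR, dLR_toLR, dirDer_comm, sub_self]
    have h := DFunLike.congr_fun this f
    rw [Derivation.commutator_apply, Derivation.zero_apply, sub_eq_zero] at h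
    exact h
  d_x a b := by
    rw [dLR_toLR, dirDer_lin, co_bv]
    have h1 : (a = b) = (b = a) := propext eq_comm
    have h2 : (a = b.ng) = (b = a.ng) := propext (by rw [eq_comm, ng_eq])
    simp only [h1, h2]
    split_ifs <;> simp
  w a b := if a = b then 0 else Ring.inverse (toLR (a.lin - b.lin))
  w_self a := by simp
  w_mul a b h := by
    rw [if_neg h, ← map_sub]
    exact Ring.inverse_mul_cancel _ (isUnit_toLR_sub h)
  m := m
  k := k

variable {m k : ℕ}

lemma evLR_w (x : Fin N → ℂ) (hx : Reg₀ x) (a b : Sg N) :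
    evLR x hx ((data N m k).w a b) = (co a x - co b x)⁻¹ := by
  by_cases h : a = b
  · subst h; rw [SignedData.w_self, map_zero, sub_self, inv_zero]
  · have h1 := congrArg (evLR x hx) ((data N m k).w_mul a b h)
    rw [map_mul, map_one] at h1
    rw [eq_inv_of_mul_eq_one_left h1]
    simp [data, evLR_toLR]

lemma isUnit_w {a b : Sg N} (h : a ≠ b) : IsUnit ((data N m k).w a b) :=
  IsUnit.of_mul_eq_one _ ((data N m k).w_mul a b h)

/-- Exponents of the weight. -/
def wexp (m k : ℕ) (a b : Sg N) : ℕ :=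
  if b = a.ng then (if a.2 = 1 then m else 0)
  else if a.2 = 1 ∧ a.1 < b.1 then k else 0

lemma wexp_sum {a b : Sg N} (h : b ≠ a) :
    wexp m k a b + wexp m k a.ng b.ng + wexp m k b a + wexp m k b.ng a.ng =
      if b = a.ng then 2 * m else k := by
  obtain ⟨i, s⟩ := a
  obtain ⟨j, t⟩ := b
  have h10 : (-1 : ℤˣ) ≠ 1 := by decide
  have h01 : (1 : ℤˣ) ≠ -1 := by decide
  rcases Int.units_eq_one_or s with rfl | rfl <;> rcases Int.units_eq_one_or t with rfl | rfl <;>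
  rcases lt_trichotomy i j with hij | rfl | hij <;>
  simp_all [wexp, ng, not_lt_of_gt, ne_of_gt, ne_of_lt, two_mul]

variable (N m k) in
/-- The weight. -/
def weight : LR N := ∏ a, ∏ b, (data N m k).w a b ^ wexp m k a b

lemma isUnit_weight : IsUnit (weight N m k) := by
  rw [weight, IsUnit.prod_iff]
  intro a _
  rw [IsUnit.prod_iff]
  intro b _
  by_cases h : a = b
  · subst h; simp [wexp, (ng_ne a).symm]
  · exact (isUnit_w h).pow _

lemma der_prod {ι B : Type} [CommRing B] [Algebra ℂ B] (D : Derivation ℂ B B) (s : Finset ι)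
    (f l : ι → B) (h : ∀ i ∈ s, D (f i) = l i * f i) :
    D (∏ i ∈ s, f i) = (∑ i ∈ s, l i) * ∏ i ∈ s, f i := by
  classical
  induction s using Finset.induction_on with
  | empty => simp
  | insert a s ha ih =>
    rw [Finset.prod_insert ha, Finset.sum_insert ha, Derivation.leibniz,
      ih fun i hi => h i (Finset.mem_insert_of_mem hi), h a (Finset.mem_insert_self _ _)]
    simp only [smul_eq_mul]; ring

lemma d_weight (c : Sg N) :
    (data N m k).d c (weight N m k) = -(data N m k).ell c * weight N m k := by
  set Z := data N m k with hZ
  have h1 : ∀ a b, Z.d c (Z.w a b ^ wexp m k a b) =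
      (-(wexp m k a b : LR N) * Z.w a b * (Z.g c a - Z.g c b)) * Z.w a b ^ wexp m k a b := by
    intro a b
    rw [Derivation.leibniz_pow, Z.d_w]
    rcases Nat.eq_zero_or_pos (wexp m k a b) with h | h
    · simp [h]
    · obtain ⟨e, he⟩ := Nat.exists_eq_succ_of_ne_zero h.ne'
      rw [he]
      simp only [nsmul_eq_mul, smul_eq_mul, Nat.succ_eq_add_one, Nat.add_sub_cancel, pow_succ]
      ring
  have h2 := der_prod (Z.d c) Finset.univ (fun a => ∏ b, Z.w a b ^ wexp m k a b) _
    fun a _ => der_prod (Z.d c) Finset.univ (fun b => Z.w a b ^ wexp m k a b) _ fun b _ => h1 a b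
  rw [weight, h2]
  congr 1
  have hg : ∀ a b, Z.g a b = (Z.g b a : LR N) := by
    intro a b
    have e1 : (b = a) = (a = b) := propext eq_comm
    have e2 : (b = Z.neg a) = (a = Z.neg b) := propext (by rw [eq_comm, Z.neg_eq])
    simp only [SignedData.g, e1, e2]
  have h3 : ∀ f : Sg N → LR N, ∑ a, f a * Z.g c a = f c - f c.ng := by
    intro f
    have := Z.sum_g_mul c f
    simp only [mul_comm (f _), hg c]; exact this
  have h4 : ∑ a, ∑ b, -(wexp m k a b : LR N) * Z.w a b * (Z.g c a - Z.g c b) =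
      (∑ b, ∑ a, (-(wexp m k a b : LR N) * Z.w a b) * Z.g c a) -
      ∑ a, ∑ b, (-(wexp m k a b : LR N) * Z.w a b) * Z.g c b := by
    rw [Finset.sum_comm, Finset.sum_comm (f := fun a b => (-(wexp m k a b : LR N) * Z.w a b) * Z.g c b),
      ← Finset.sum_sub_distrib]
    refine Finset.sum_congr rfl fun b _ => ?_
    rw [← Finset.sum_sub_distrib]
    exact Finset.sum_congr rfl fun a _ => by ring
  rw [h4]
  simp only [h3, Finset.sum_sub_distrib]
  rw [← Z.sum_neg fun b => -(wexp m k c.ng b : LR N) * Z.w c.ng b,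
    ← Z.sum_neg fun a => -(wexp m k a c.ng : LR N) * Z.w a c.ng]
  rw [← Finset.sum_sub_distrib, ← Finset.sum_sub_distrib, ← Finset.sum_sub_distrib,
    SignedData.ell, ← Finset.sum_neg_distrib]
  refine Finset.sum_congr rfl fun b _ => ?_
  have e1 : Z.w c.ng (Z.neg b) = -Z.w c b := Z.w_neg_neg c b
  have e2 : Z.w (Z.neg b) c.ng = Z.w c b := by
    have := Z.w_neg_neg b c
    rw [Z.w_symm c b, _root_.neg_neg] at this; exact this
  rw [e1, e2, Z.w_symm c b, SignedData.y]
  by_cases hb : b = c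
  · subst hb; simp [Z.w_self]
  have h5 : (Z.κ c b : LR N) = ((wexp m k c b + wexp m k c.ng b.ng + wexp m k b c +
      wexp m k b.ng c.ng : ℕ) : LR N) := by
    rw [wexp_sum hb, SignedData.κ, if_neg hb]
    change (if b = c.ng then 2 * (m : LR N) else (k : LR N)) = _
    split_ifs <;> push_cast <;> rfl
  rw [h5]
  have h6 : Z.neg b = b.ng := rfl
  rw [h6]
  push_cast
  ring

end Sg

end

section

namespace Sg

variable {N : ℕ} {m k : ℕ}

lemma sum_sg {M : Type} [AddCommMonoid M] (f : Sg N → M) :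
    ∑ a, f a = ∑ j, (f (j, 1) + f (j, -1)) := by
  rw [Fintype.sum_prod_type]
  refine Finset.sum_congr rfl fun j _ => ?_
  rw [show (Finset.univ : Finset ℤˣ) = {1, -1} from rfl, Finset.sum_pair (by decide)]

variable (N m k) in
/-- The weighted inclusion of polynomials. -/
def tau : MvPolynomial (Fin N) ℂ →ₗ[ℂ] LR N :=
  LinearMap.mulRight ℂ (weight N m k) ∘ₗ (toLR (N := N)).toLinearMap

lemma tau_apply (p) : tau N m k p = toLR p * weight N m k := rfl

lemma tau_injective : Function.Injective (tau N m k) := fun p q h => by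
  rw [tau_apply, tau_apply] at h
  exact toLR_injective (isUnit_weight.mul_right_cancel h)

variable (N) in
/-- Even power sums. -/
def powP (r : ℕ) : MvPolynomial (Fin N) ℂ := ∑ j, X j ^ (2 * r)

lemma powP_isHomogeneous (r : ℕ) : (powP N r).IsHomogeneous (2 * r) :=
  IsHomogeneous.sum _ _ _ fun j _ => isHomogeneous_X_pow j _

lemma psum_mul_tau (r : ℕ) (q) :
    (data N m k).psum (2 * r) * tau N m k q = (2 : ℂ) • tau N m k (powP N r * q) := by
  have : (data N m k).psum (2 * r) = toLR ((2 : ℂ) • powP N r) := by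
    rw [SignedData.psum, sum_sg, powP, Finset.smul_sum, map_sum]
    refine Finset.sum_congr rfl fun j _ => ?_
    change toLR (lin (j, 1)) ^ (2 * r) + toLR (lin (ng (j, 1))) ^ (2 * r) = _
    rw [lin_ng, map_neg, (even_two_mul r).neg_pow, ← map_pow, ← two_smul ℂ, ← map_smul]
    congr 3
    simp [lin, sg]
  rw [this, tau_apply, tau_apply, map_smul, map_mul, smul_mul_assoc, mul_assoc]

lemma sum_der_apply {ι B : Type} [CommRing B] [Algebra ℂ B] (s : Finset ι)
    (D : ι → Derivation ℂ B B) (p : B) : (∑ j ∈ s, D j) p = ∑ j ∈ s, D j p := by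
  change Derivation.coeFnAddMonoidHom (∑ j ∈ s, D j) p = _
  rw [map_sum, Finset.sum_apply]
  rfl

lemma dirDer_eq (u : Fin N → ℂ) (p) : dirDer u p = ∑ j, C (u j) * pderiv j p := by
  have : dirDer u = ∑ j, (C (u j) : MvPolynomial (Fin N) ℂ) • pderiv j := by
    apply MvPolynomial.derivation_ext
    intro i
    rw [dirDer_X, sum_der_apply, Finset.sum_eq_single i]
    · simp
    · intro j _ hj; simp [pderiv_X_of_ne hj.symm]
    · simp
  rw [this, sum_der_apply]
  rfl

lemma dirDer_bv (a : Sg N) (p) : dirDer (bv a) p = C a.sg * pderiv a.1 p := by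
  rw [dirDer_eq, Finset.sum_eq_single a.1]
  · simp [bv]
  · intro j _ hj; simp [bv, hj]
  · simp

lemma euler_toLR {d : ℕ} {q : MvPolynomial (Fin N) ℂ} (hq : q.IsHomogeneous d) :
    (data N m k).euler (toLR q) = (2 * (d : ℂ)) • toLR q := by
  have h1 : ∀ a : Sg N, (data N m k).x a * (data N m k).d a (toLR q) =
      toLR (X a.1 * pderiv a.1 q) := by
    intro a
    change toLR a.lin * dLR a (toLR q) = _
    rw [dLR_toLR, dirDer_bv, ← map_mul, lin]
    congr 1
    have : C a.sg * C a.sg = (1 : MvPolynomial (Fin N) ℂ) := by rw [← C_mul, sg_mul_self, C_1]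
    linear_combination X a.1 * pderiv a.1 q * this
  rw [SignedData.euler_apply]
  simp only [h1]
  rw [sum_sg]
  simp only [← two_smul ℂ]
  rw [← Finset.smul_sum, ← map_sum, hq.sum_X_mul_pderiv, map_nsmul, mul_smul]
  congr 1
  exact (Nat.cast_smul_eq_nsmul ℂ d (toLR q)).symm

lemma euler_tau {d : ℕ} {q : MvPolynomial (Fin N) ℂ} (hq : q.IsHomogeneous d) :
    (data N m k).euler (tau N m k q) =
      (2 * (d : ℂ) + (-(data N m k).weightDeg)) • tau N m k q := by
  rw [tau_apply, SignedData.euler_mul, euler_toLR hq, SignedData.euler_weight _ d_weight, add_smul,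
    smul_mul_assoc, mul_smul_comm]

lemma evLR_ell (m1 m2 m3 : ℕ) (x : Fin N → ℂ) (hx : Reg₀ x) (c : Sg N) :
    evLR x hx ((data N (m1 + m2) m3).ell c) = ellAt m1 m2 m3 c x := by
  have hc := hx.ne_zero c
  set Z := data N (m1 + m2) m3 with hZ
  have hk : ∀ d, evLR x hx (Z.κ c d) =
      if d = c then 0 else if d = c.ng then 2 * ((m1 : ℂ) + m2) else m3 := by
    intro d
    rw [SignedData.κ]
    change evLR x hx (if d = c then 0 else if d = c.ng then 2 * ((m1 + m2 : ℕ) : LR N) else (m3 : LR N)) = _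
    split_ifs <;> simp [map_ofNat]
  rw [SignedData.ell, map_sum, ellAt, ← Finset.add_sum_erase _ _ (Finset.mem_univ c),
    SignedData.y, SignedData.w_self, mul_zero, map_zero, zero_add]
  have hmem : c.ng ∈ Finset.univ.erase c := Finset.mem_erase.2 ⟨ng_ne c, Finset.mem_univ _⟩
  rw [← Finset.add_sum_erase _ _ hmem, ← Finset.add_sum_erase _ _ hmem, ← add_assoc]
  congr 1
  · rw [SignedData.y, map_mul, hk, evLR_w, if_neg (ng_ne c), if_pos rfl, mu, if_pos rfl, co_ng]
    field_simp
    ring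
  · refine Finset.sum_congr rfl fun d hd => ?_
    have h1 := Finset.mem_erase.1 hd
    have h2 := Finset.mem_erase.1 h1.2
    rw [SignedData.y, map_mul, hk, evLR_w, if_neg h2.1, if_neg h1.1, mu, if_neg h1.1, div_eq_mul_inv]

lemma evLR_ham₀ (m1 m2 m3 : ℕ) (x : Fin N → ℂ) (hx : Reg₀ x) (q) :
    evLR x hx ((data N (m1 + m2) m3).ham₀ (tau N (m1 + m2) m3 q)) =
      2 * calAt m1 m2 m3 q x * evLR x hx (weight N (m1 + m2) m3) := by
  rw [tau_apply, SignedData.ham₀_weight _ d_weight, map_mul, map_sub, map_mul, SignedData.lap_apply,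
    map_sum, map_sum, calAt, Finset.mul_sum, map_ofNat, Finset.mul_sum, ← Finset.sum_sub_distrib]
  congr 1
  refine Finset.sum_congr rfl fun c _ => ?_
  rw [map_mul, evLR_ell]
  change evLR x hx (dLR c (dLR c (toLR q))) - 2 * (_ * evLR x hx (dLR c (toLR q))) = _
  rw [dLR_toLR, dLR_toLR, evLR_toLR, evLR_toLR]
  ring

lemma ham₀_tau {m1 m2 m3 : ℕ} {q q' : MvPolynomial (Fin N) ℂ}
    (h : ∀ x, Reg₀ x → eval x q' = calAt m1 m2 m3 q x) :
    (data N (m1 + m2) m3).ham₀ (tau N (m1 + m2) m3 q) =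
      tau N (m1 + m2) m3 ((2 : ℂ) • q') := by
  apply LR_ext
  intro x hx
  rw [evLR_ham₀, ← h x hx, tau_apply, map_mul, evLR_toLR, smul_eval]

end Sg

end

section

namespace Sg

open MeasureTheory

variable {N : ℕ}

/-- The shifted real contour. -/
def ctr (t : Fin N → ℝ) : Fin N → ℂ := fun j => (t j : ℂ) + base j

lemma co_ctr_im (a : Sg N) (t : Fin N → ℝ) : (co a (ctr t)).im = wt a := by
  have h1 : co a (ctr t) = co a (fun j => (t j : ℂ)) + co a base := co_add a _ _
  rw [h1, co_base]
  have h2 : co a (fun j => (t j : ℂ)) = (((a.2 : ℤ) * t a.1 : ℝ) : ℂ) := by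
    simp [co, sg]
  rw [h2, Complex.add_im, Complex.ofReal_im]
  simp

lemma one_le_norm_sub {a b : Sg N} (h : a ≠ b) (t : Fin N → ℝ) :
    1 ≤ ‖co a (ctr t) - co b (ctr t)‖ := by
  refine le_trans ?_ (Complex.abs_im_le_norm _)
  rw [Complex.sub_im, co_ctr_im, co_ctr_im]
  have : wt a - wt b ≠ 0 := sub_ne_zero.2 fun h' => h (wt_inj h')
  exact_mod_cast Int.one_le_abs this

lemma reg_ctr (t : Fin N → ℝ) : Reg₀ (ctr t) := fun a b h h' => by
  have := one_le_norm_sub h t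
  rw [h', sub_self, norm_zero] at this
  linarith

lemma one_le_norm_disc (t : Fin N → ℝ) : 1 ≤ ‖eval (ctr t) (disc N)‖ := by
  rw [disc, map_prod, norm_prod]
  refine Finset.prod_induction _ (fun r : ℝ => 1 ≤ r) (fun _ _ => one_le_mul_of_one_le_of_one_le)
    le_rfl fun a _ => ?_
  rw [map_prod, norm_prod]
  refine Finset.prod_induction _ (fun r : ℝ => 1 ≤ r) (fun _ _ => one_le_mul_of_one_le_of_one_le)
    le_rfl fun b hb => ?_
  rw [map_sub, eval_lin, eval_lin]
  exact one_le_norm_sub (Finset.ne_of_mem_erase hb).symm t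

/-- The Gaussian density on the contour. -/
def dens (t : Fin N → ℝ) : ℂ := Complex.exp (-(∑ j, ctr t j ^ 2) / 2)

/-- The Gaussian integrand. -/
def gInt (f : LR N) (t : Fin N → ℝ) : ℂ := evLR (ctr t) (reg_ctr t) f * dens t

lemma continuous_ctr : Continuous (ctr (N := N)) := by
  unfold ctr
  fun_prop

lemma continuous_eval_ctr (p : MvPolynomial (Fin N) ℂ) : Continuous fun t => eval (ctr t) p :=
  (MvPolynomial.continuous_eval p).comp continuous_ctr

lemma integrable_pow_gauss (b : ℝ) (e : ℕ) :
    Integrable fun t : ℝ => ((t : ℂ) + b * Complex.I) ^ e *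
      Complex.exp (-((t : ℂ) + b * Complex.I) ^ 2 / 2) := by
  have h0 : ∀ k : ℕ, Integrable fun t : ℝ => (t : ℂ) ^ k *
      Complex.exp (-((t : ℂ) + b * Complex.I) ^ 2 / 2) := by
    intro k
    have h1 := (integrable_rpow_mul_exp_neg_mul_sq (b := 1 / 2) (by norm_num) (s := (k : ℝ))
      (by have := Nat.cast_nonneg (α := ℝ) k; linarith)).norm.mul_const (Real.exp (b ^ 2 / 2))
    refine h1.mono' (by fun_prop) (Filter.Eventually.of_forall fun t => ?_)
    rw [norm_mul, norm_mul, norm_pow, Complex.norm_real, Real.rpow_natCast, norm_pow,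
      Complex.norm_exp, Real.norm_eq_abs (Real.exp _), abs_of_pos (Real.exp_pos _), mul_assoc,
      ← Real.exp_add]
    refine le_of_eq ?_
    congr 2
    have : (-((t : ℂ) + b * Complex.I) ^ 2 / 2) =
        (((-(1/2) * t ^ 2 + b ^ 2 / 2 : ℝ)) : ℂ) + ((-(t * b) : ℝ) : ℂ) * Complex.I := by
      have := Complex.I_sq
      push_cast
      linear_combination (-(b : ℂ) ^ 2 / 2) * this
    rw [this]
    simp only [Complex.add_re, Complex.ofReal_re, Complex.mul_re, Complex.I_re, Complex.I_im,
      Complex.ofReal_im]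
    ring
  have h2 : ∀ t : ℝ, ((t : ℂ) + b * Complex.I) ^ e = _ := fun t => add_pow _ _ _
  simp only [h2, Finset.sum_mul]
  refine integrable_finsetSum _ fun k _ => ?_
  have := (h0 k).mul_const ((b * Complex.I) ^ (e - k) * (e.choose k : ℂ))
  refine this.congr (Filter.Eventually.of_forall fun t => ?_)
  simp only; ring

lemma dens_eq_prod (t : Fin N → ℝ) :
    dens t = ∏ j : Fin N, Complex.exp (-((t j : ℂ) + (((j : ℕ) + 1 : ℝ) : ℂ) * Complex.I) ^ 2 / 2) := by
  rw [← Complex.exp_sum, dens]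
  congr 1
  rw [← Finset.sum_div, Finset.sum_neg_distrib]
  simp [ctr, base]

lemma integrable_poly (p : MvPolynomial (Fin N) ℂ) : Integrable fun t => eval (ctr t) p * dens t := by
  have h0 : ∀ s : Fin N →₀ ℕ, Integrable fun t : Fin N → ℝ => (∏ j, ctr t j ^ s j) * dens t := by
    intro s
    have := Integrable.fintype_prod (μ := fun _ : Fin N => (volume : Measure ℝ))
      (fun j : Fin N => integrable_pow_gauss ((j : ℕ) + 1) (s j))
    refine this.congr (Filter.Eventually.of_forall fun t => ?_)
    simp only
    rw [dens_eq_prod, ← Finset.prod_mul_distrib]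
    refine Finset.prod_congr rfl fun j _ => ?_
    simp [ctr, base]
  simp only [eval_eq', Finset.sum_mul, mul_assoc]
  exact integrable_finsetSum _ fun s _ => (h0 s).const_mul _

lemma evLR_eq {n : ℕ} {f : LR N} {p} (h : toLR (disc N ^ n) * f = toLR p) (x) (hx : Reg₀ x) :
    evLR x hx f = (eval x (disc N) ^ n)⁻¹ * eval x p := by
  have h1 := congrArg (evLR x hx) h
  rw [map_mul, evLR_toLR, evLR_toLR, map_pow] at h1
  rw [← h1, inv_mul_cancel_left₀ (pow_ne_zero _ (eval_disc_ne.2 hx))]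

lemma integrable_gInt (f : LR N) : Integrable (gInt f) := by
  obtain ⟨n, p, h⟩ := exists_toLR f
  have := (integrable_poly p).bdd_mul (c := 1) (f := fun t => (eval (ctr t) (disc N) ^ n)⁻¹)
    (Continuous.aestronglyMeasurable (((continuous_eval_ctr _).pow n).inv₀ fun t =>
      pow_ne_zero _ (eval_disc_ne.2 (reg_ctr t))))
    (Filter.Eventually.of_forall fun t => by
      rw [norm_inv, norm_pow]
      exact inv_le_one_of_one_le₀ (one_le_pow₀ (one_le_norm_disc t)))
  refine this.congr (Filter.Eventually.of_forall fun t => ?_)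
  simp only [gInt]
  rw [evLR_eq h, mul_assoc]

variable (N) in
/-- The Gaussian functional. -/
def gaussI : LR N →ₗ[ℂ] ℂ where
  toFun f := ∫ t, gInt f t
  map_add' f g := by
    rw [← integral_add (integrable_gInt f) (integrable_gInt g)]
    simp only [gInt, map_add, add_mul]
  map_smul' c f := by
    rw [RingHom.id_apply, smul_eq_mul, ← integral_const_mul]
    simp only [gInt, map_smul, smul_eq_mul, mul_assoc]

lemma gaussI_one : gaussI N 1 ≠ 0 := by
  have h1 : gaussI N 1 = ∫ t : Fin N → ℝ, ∏ j : Fin N,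
      Complex.exp (-((t j : ℂ) + (((j : ℕ) + 1 : ℝ) : ℂ) * Complex.I) ^ 2 / 2) := by
    change ∫ t, gInt 1 t = _
    simp only [gInt, map_one, one_mul, dens_eq_prod]
  rw [h1, integral_fintype_prod_volume_eq_prod (fun (j : Fin N) (t : ℝ) =>
    Complex.exp (-((t : ℂ) + (((j : ℕ) + 1 : ℝ) : ℂ) * Complex.I) ^ 2 / 2))]
  refine Finset.prod_ne_zero_iff.2 fun j _ => ?_
  have h2 := GaussianFourier.integral_cexp_neg_mul_sq_add_real_mul_I (b := 1 / 2) (by norm_num)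
    ((j : ℕ) + 1)
  have h3 : ∀ t : ℝ, Complex.exp (-((t : ℂ) + (((j : ℕ) + 1 : ℝ) : ℂ) * Complex.I) ^ 2 / 2) =
      Complex.exp (-(1 / 2) * ((t : ℂ) + (((j : ℕ) + 1 : ℝ) : ℂ) * Complex.I) ^ 2) := by
    intro t; congr 1; ring
  simp only [h3, h2]
  rw [Complex.cpow_def_of_ne_zero (by simp [Real.pi_ne_zero])]
  exact Complex.exp_ne_zero _

lemma hasDerivAt_eval_line (u v : Fin N → ℂ) (p : MvPolynomial (Fin N) ℂ) (s : ℂ) :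
    HasDerivAt (fun s => eval (v + s • u) p) (eval (v + s • u) (dirDer u p)) s := by
  have := (linePoly v u p).hasDerivAt s
  rw [derivative_linePoly, eval_linePoly] at this
  simpa only [eval_linePoly] using this

lemma ctr_add (t u : Fin N → ℝ) (s : ℝ) : ctr (t + s • u) = ctr t + (s : ℂ) • fun j => (u j : ℂ) := by
  funext j; simp [ctr]; ring

lemma hasLineDerivAt_eval (u : Fin N → ℝ) (p : MvPolynomial (Fin N) ℂ) (t : Fin N → ℝ) :
    HasLineDerivAt ℝ (fun t => eval (ctr t) p)
      (eval (ctr t) (dirDer (fun j => (u j : ℂ)) p)) t u := by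
  have h1 : HasDerivAt (fun s : ℝ => eval (ctr t + (s : ℂ) • fun j => (u j : ℂ)) p) _ 0 :=
    (hasDerivAt_eval_line (fun j => (u j : ℂ)) (ctr t) p ((0 : ℝ) : ℂ)).comp_ofReal
  rw [Complex.ofReal_zero, zero_smul, add_zero] at h1
  unfold HasLineDerivAt
  simp only [ctr_add]
  exact h1

lemma hasLineDerivAt_dens (u : Fin N → ℝ) (t : Fin N → ℝ) :
    HasLineDerivAt ℝ dens (-(∑ j, ctr t j * u j) * dens t) t u := by
  have h1 : HasDerivAt (fun s : ℝ => -(∑ j, (ctr t j + (s : ℂ) * u j) ^ 2) / 2)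
      (-(∑ j, ctr t j * u j)) 0 := by
    have : ∀ j, HasDerivAt (fun s : ℝ => (ctr t j + (s : ℂ) * u j) ^ 2) (2 * (ctr t j * u j)) 0 := by
      intro j
      have h := ((((hasDerivAt_id (0 : ℝ)).ofReal_comp).mul_const (u j : ℂ)).const_add (ctr t j)).pow 2
      refine h.congr_deriv ?_
      simp; ring
    refine ((HasDerivAt.fun_sum (u := Finset.univ) fun j _ => this j).neg.div_const 2).congr_deriv ?_
    rw [← Finset.mul_sum]; ring
  have h2 := h1.cexp
  unfold HasLineDerivAt
  have h3 : (fun s : ℝ => dens (t + s • u)) =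
      fun s : ℝ => Complex.exp (-(∑ j, (ctr t j + (s : ℂ) * u j) ^ 2) / 2) := by
    funext s
    rw [dens, ctr_add]
    rfl
  rw [h3]
  refine h2.congr_deriv ?_
  simp only [Complex.ofReal_zero, zero_mul, add_zero]
  rw [mul_comm, dens]

lemma bv_real (a : Sg N) : ∃ u : Fin N → ℝ, (fun j => (u j : ℂ)) = bv a := by
  refine ⟨Pi.single a.1 ((a.2 : ℤ) : ℝ), ?_⟩
  funext j
  by_cases h : j = a.1
  · subst h; simp [bv, sg]
  · simp [bv, h]

lemma hasLineDerivAt_evLR (a : Sg N) {u : Fin N → ℝ} (hu : (fun j => (u j : ℂ)) = bv a) (f : LR N)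
    (t : Fin N → ℝ) :
    HasLineDerivAt ℝ (fun t => evLR (ctr t) (reg_ctr t) f)
      (evLR (ctr t) (reg_ctr t) (dLR a f)) t u := by
  obtain ⟨n, p, h⟩ := exists_toLR f
  have hne := pow_ne_zero n (eval_disc_ne.2 (reg_ctr t))
  have h1 : HasDerivAt _ _ _ := hasLineDerivAt_eval u p t
  have h2 : HasDerivAt _ _ _ := hasLineDerivAt_eval u (disc N ^ n) t
  rw [hu] at h1 h2
  have h3 := h1.div h2 (by simp only [zero_smul, add_zero, map_pow]; exact hne)
  unfold HasLineDerivAt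
  have h4 : (fun s : ℝ => evLR (ctr (t + s • u)) (reg_ctr (t + s • u)) f) =
      fun s : ℝ => eval (ctr (t + s • u)) p / eval (ctr (t + s • u)) (disc N ^ n) := by
    funext s
    rw [evLR_eq h, map_pow, div_eq_inv_mul]
  rw [h4]
  refine h3.congr_deriv ?_
  simp only [zero_smul, add_zero]
  have h5 := congrArg (evLR (ctr t) (reg_ctr t)) (congrArg (dLR a) h)
  simp only [Derivation.leibniz, smul_eq_mul, map_add, map_mul, evLR_toLR, dLR_toLR] at h5
  have h6 := congrArg (evLR (ctr t) (reg_ctr t)) h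
  simp only [map_mul, evLR_toLR] at h6
  rw [← map_pow] at hne
  rw [div_eq_iff (pow_ne_zero 2 hne), ← h5, ← h6]
  ring

theorem gaussI_isGaussian (m k : ℕ) : (data N m k).IsGaussian (gaussI N) := by
  intro a f
  change ∫ t, gInt (dLR a f) t = ∫ t, gInt (toLR a.lin * f) t
  obtain ⟨u, hu⟩ := bv_real a
  have hd : ∀ t, HasLineDerivAt ℝ (gInt f) (gInt (dLR a f) t - gInt (toLR a.lin * f) t) t u := by
    intro t
    have h1 : HasDerivAt _ _ _ := hasLineDerivAt_evLR a hu f t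
    have h2 : HasDerivAt _ _ _ := hasLineDerivAt_dens u t
    have h3 := h1.mul h2
    refine HasDerivAt.congr_deriv h3 ?_
    simp only [zero_smul, add_zero, gInt, map_mul, evLR_toLR, eval_lin]
    have : ∑ j, ctr t j * u j = co a (ctr t) := by
      have h5 : ∀ j, (u j : ℂ) = bv a j := fun j => congrFun hu j
      simp only [h5, bv]
      rw [Finset.sum_eq_single a.1]
      · simp [co, mul_comm]
      · intro j _ hj; simp [hj]
      · simp
    rw [this]; ring
  have hi := (integrable_gInt (dLR a f)).sub (integrable_gInt (toLR a.lin * f))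
  have key := integral_bilinear_hasLineDerivAt_right_eq_neg_left_of_integrable
    (B := ContinuousLinearMap.mul ℝ ℂ) (μ := volume) (f := gInt f)
    (f' := fun t => gInt (dLR a f) t - gInt (toLR a.lin * f) t) (g := fun _ => 1) (g' := fun _ => 0)
    (v := u) (by simp only [ContinuousLinearMap.mul_apply', mul_one]; exact hi) (by simp) (by simpa using integrable_gInt f) (fun t _ => hd t)
    (fun t _ => by unfold HasLineDerivAt; exact hasDerivAt_const _ _)
  simp only [ContinuousLinearMap.mul_apply', mul_zero, mul_one, integral_zero] at key
  rw [integral_sub (integrable_gInt _) (integrable_gInt _)] at key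
  linear_combination key

end Sg

end

section

lemma totalDegree_pderiv_lt {n : ℕ} (j : Fin n) {p : MvPolynomial (Fin n) ℂ}
    (h : pderiv j p ≠ 0) : (pderiv j p).totalDegree < p.totalDegree := by
  obtain ⟨m, hm, hd⟩ := Finset.exists_mem_eq_sup _ (support_nonempty.2 h)
    (fun s : Fin n →₀ ℕ => s.sum fun _ e => e)
  have h1 : coeff (m + Finsupp.single j 1) p ≠ 0 := fun h0 => by
    rw [mem_support_iff, coeff_pderiv, h0, zero_mul] at hm
    exact hm rfl
  have h2 := le_totalDegree (mem_support_iff.2 h1)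
  have h3 : (m + Finsupp.single j 1).sum (fun _ e => e) = m.sum (fun _ e => e) + 1 := by
    rw [Finsupp.sum_add_index' (fun _ => rfl) (fun _ _ _ => rfl), Finsupp.sum_single_index rfl]
  have h4 : (pderiv j p).totalDegree = m.sum (fun _ e => e) := hd
  omega

lemma exists_pderiv_ne_zero {n : ℕ} {p : MvPolynomial (Fin n) ℂ} (h : p.totalDegree ≠ 0) :
    ∃ j, pderiv j p ≠ 0 := by
  by_contra! hc
  refine h (totalDegree_eq_zero_iff_eq_C.2 ?_)
  ext m
  rw [coeff_C]
  split_ifs with h0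
  · rw [h0]
  · obtain ⟨j, hj⟩ : ∃ j, m j ≠ 0 := by
      by_contra! h1
      exact h0 (Finsupp.ext fun j => (h1 j).symm)
    have h1 : m - Finsupp.single j 1 + Finsupp.single j 1 = m :=
      tsub_add_cancel_of_le (Finsupp.single_le_iff.2 (Nat.one_le_iff_ne_zero.2 hj))
    have h2 := congrArg (coeff (m - Finsupp.single j 1)) (hc j)
    rw [coeff_pderiv, h1, coeff_zero] at h2
    exact (mul_eq_zero.1 h2).resolve_right (Nat.cast_add_one_ne_zero _)

namespace Sg
variable {N : ℕ}

/-- A nonzero subspace stable under polynomial multiplication and differentiation contains `1`. -/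
lemma one_mem_of_stable (J : Submodule ℂ (LR N)) (hmul : ∀ p, ∀ r ∈ J, toLR p * r ∈ J)
    (hd : ∀ a, ∀ r ∈ J, dLR a r ∈ J) {r : LR N} (hr : r ∈ J) (h0 : r ≠ 0) : (1 : LR N) ∈ J := by
  obtain ⟨n, p, hp⟩ := exists_toLR r
  have hpJ : toLR p ∈ J := hp ▸ hmul _ _ hr
  have hp0 : p ≠ 0 := by
    rintro rfl
    rw [map_zero, map_pow] at hp
    exact h0 (((isUnit_toLR_disc (N := N)).pow n).mul_right_eq_zero.1 hp)
  clear hp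
  induction hk : p.totalDegree using Nat.strong_induction_on generalizing p with
  | _ k ih =>
    by_cases hk0 : p.totalDegree = 0
    · obtain ⟨c, rfl⟩ : ∃ c, p = C c := ⟨_, totalDegree_eq_zero_iff_eq_C.1 hk0⟩
      have hc : c ≠ 0 := fun h => hp0 (by rw [h, map_zero])
      have := J.smul_mem c⁻¹ hpJ
      rwa [← MvPolynomial.algebraMap_eq, AlgHom.commutes, Algebra.algebraMap_eq_smul_one, smul_smul,
        inv_mul_cancel₀ hc, one_smul] at this
    · obtain ⟨j, hj⟩ := exists_pderiv_ne_zero hk0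
      refine ih _ (hk ▸ totalDegree_pderiv_lt j hj) (pderiv j p) ?_ hj rfl
      have := hd (j, 1) _ hpJ
      rw [dLR_toLR, dirDer_bv] at this
      simpa [sg] using this

theorem gaussI_nondeg {m k : ℕ} {u r : LR N} (hu : IsUnit u)
    (h : ∀ p, gaussI N (toLR p * (u * r)) = 0) : r = 0 := by
  rw [← hu.mul_right_eq_zero]
  by_contra h0
  let J : Submodule ℂ (LR N) :=
    { carrier := {r | ∀ p, gaussI N (toLR p * r) = 0}
      add_mem' := fun {a b} ha hb p => by rw [mul_add, map_add, ha, hb, add_zero]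
      zero_mem' := fun p => by rw [mul_zero, map_zero]
      smul_mem' := fun c a ha p => by rw [mul_smul_comm, map_smul, ha, smul_zero] }
  have h1 : (1 : LR N) ∈ J := by
    refine one_mem_of_stable J (fun p r hr q => ?_) (fun a r hr p => ?_) (r := u * r) h h0
    · rw [← mul_assoc, ← map_mul]; exact hr _
    · have h2 := gaussI_isGaussian m k a (toLR p * r)
      change gaussI N (dLR a (toLR p * r)) = gaussI N (toLR a.lin * (toLR p * r)) at h2
      rw [Derivation.leibniz, map_add, smul_eq_mul, smul_eq_mul, dLR_toLR, mul_comm r, hr, add_zero,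
        ← mul_assoc, ← map_mul, hr] at h2
      exact h2
  have := h1 1
  rw [map_one, one_mul] at this
  exact gaussI_one this

/-- An element of `LR N` all of whose derivatives vanish at a point is zero. -/
lemma eq_zero_of_derivatives {x : Fin N → ℂ} (hx : Reg₀ x) (K : Submodule ℂ (LR N))
    (hd : ∀ a, ∀ r ∈ K, dLR a r ∈ K) (hK : ∀ r ∈ K, evLR x hx r = 0) {r : LR N} (hr : r ∈ K) :
    r = 0 := by
  by_contra h0
  let J : Submodule ℂ (LR N) := Submodule.span ℂ {s | ∃ p, ∃ r ∈ K, s = toLR p * r}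
  have h1 : (1 : LR N) ∈ J := by
    refine one_mem_of_stable J (fun p r hr => ?_) (fun a r hr => ?_) (r := r)
      (Submodule.subset_span ⟨1, r, hr, by rw [map_one, one_mul]⟩) h0
    · induction hr using Submodule.span_induction with
      | mem s hs =>
        obtain ⟨q, r, hr, rfl⟩ := hs
        exact Submodule.subset_span ⟨p * q, r, hr, by rw [map_mul, mul_assoc]⟩
      | zero => rw [mul_zero]; exact J.zero_mem
      | add a b _ _ ha hb => rw [mul_add]; exact J.add_mem ha hb
      | smul c a _ ha => rw [mul_smul_comm]; exact J.smul_mem c ha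
    · induction hr using Submodule.span_induction with
      | mem s hs =>
        obtain ⟨q, r, hr, rfl⟩ := hs
        rw [Derivation.leibniz, smul_eq_mul, smul_eq_mul, dLR_toLR, mul_comm r]
        exact J.add_mem (Submodule.subset_span ⟨q, _, hd a r hr, rfl⟩)
          (Submodule.subset_span ⟨_, r, hr, rfl⟩)
      | zero => rw [map_zero]; exact J.zero_mem
      | add a b _ _ ha hb => rw [map_add]; exact J.add_mem ha hb
      | smul c a _ ha => rw [Derivation.map_smul]; exact J.smul_mem c ha
  have h2 : ∀ s ∈ J, evLR x hx s = 0 := fun s hs => by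
    induction hs using Submodule.span_induction with
    | mem s hs =>
      obtain ⟨q, r, hr, rfl⟩ := hs
      rw [map_mul, hK r hr, mul_zero]
    | zero => rw [map_zero]
    | add a b _ _ ha hb => rw [map_add, ha, hb, add_zero]
    | smul c a _ ha => rw [map_smul, ha, smul_zero]
  have := h2 1 h1
  rw [map_one] at this
  exact one_ne_zero this

end Sg

end

section

section Top
variable {n : ℕ}

/-- `q` is the component of degree `d` of `p`, a polynomial of degree at most `d`. -/
structure HasLeading (d : ℕ) (p q : MvPolynomial (Fin n) ℂ) : Prop where
  le : p.totalDegree ≤ d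
  top : homogeneousComponent d p = q

lemma HasLeading.isHomogeneous {d : ℕ} {p q : MvPolynomial (Fin n) ℂ} (h : HasLeading d p q) :
    q.IsHomogeneous d := h.top ▸ homogeneousComponent_isHomogeneous d p

lemma HasLeading.of_isHomogeneous {d : ℕ} {p : MvPolynomial (Fin n) ℂ} (h : p.IsHomogeneous d) :
    HasLeading d p p := ⟨h.totalDegree_le, homogeneousComponent_eq_self h⟩

lemma HasLeading.add {d : ℕ} {p q p' q' : MvPolynomial (Fin n) ℂ} (h : HasLeading d p q)
    (h' : HasLeading d p' q') : HasLeading d (p + p') (q + q') :=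
  ⟨(totalDegree_add _ _).trans (max_le h.le h'.le), by rw [map_add, h.top, h'.top]⟩

lemma HasLeading.smul {d : ℕ} {p q : MvPolynomial (Fin n) ℂ} (c : ℂ) (h : HasLeading d p q) :
    HasLeading d (c • p) (c • q) :=
  ⟨(totalDegree_smul_le _ _).trans h.le, by rw [map_smul, h.top]⟩

lemma HasLeading.mul {d e : ℕ} {p q p' q' : MvPolynomial (Fin n) ℂ} (h : HasLeading d p q)
    (h' : HasLeading e p' q') : HasLeading (d + e) (p * p') (q * q') := by
  refine ⟨(totalDegree_mul _ _).trans (Nat.add_le_add h.le h'.le), ?_⟩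
  have key : ∀ {d : ℕ} {p q : MvPolynomial (Fin n) ℂ}, HasLeading d p q →
      p = q ∨ (p - q).totalDegree < d := by
    intro d p q h
    rw [or_iff_not_imp_left]
    intro hne
    obtain ⟨m, hm, hd⟩ := Finset.exists_mem_eq_sup _ (support_nonempty.2 (sub_ne_zero.2 hne))
      (fun s : Fin n →₀ ℕ => s.sum fun _ e => e)
    have h1 : (p - q).totalDegree ≤ d := by
      have := (totalDegree_sub p q).trans (max_le h.le h.isHomogeneous.totalDegree_le)
      exact this
    refine lt_of_le_of_ne h1 fun h2 => ?_
    have h3 : m.degree = d := by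
      rw [← h2]; exact hd.symm
    rw [mem_support_iff, coeff_sub, ← h.top, coeff_homogeneousComponent, if_pos h3, sub_self] at hm
    exact hm rfl
  rcases key h with rfl | h1
  · rcases key h' with rfl | h2
    · exact homogeneousComponent_eq_self (h.isHomogeneous.mul h'.isHomogeneous)
    · have e : p * p' = p * q' + p * (p' - q') := by ring
      rw [e, map_add, homogeneousComponent_eq_self (h.isHomogeneous.mul h'.isHomogeneous),
        homogeneousComponent_eq_zero, add_zero]
      exact (totalDegree_mul _ _).trans_lt (by have := h.le; omega)
  · have e₁ : p * p' = q * p' + (p - q) * p' := by ring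
    have h3 : homogeneousComponent (d + e) (q * p') = q * q' := by
      have hq := h.isHomogeneous
      rcases key h' with rfl | h2
      · exact homogeneousComponent_eq_self (hq.mul h'.isHomogeneous)
      · have e : q * p' = q * q' + q * (p' - q') := by ring
        rw [e, map_add, homogeneousComponent_eq_self (hq.mul h'.isHomogeneous),
          homogeneousComponent_eq_zero, add_zero]
        exact (totalDegree_mul _ _).trans_lt (by have := hq.totalDegree_le; omega)
    rw [e₁, map_add, h3, homogeneousComponent_eq_zero, add_zero]
    exact (totalDegree_mul _ _).trans_lt (by have := h'.le; omega)

lemma HasLeading.prod {ι : Type} (s : Finset ι) (d : ι → ℕ) (p q : ι → MvPolynomial (Fin n) ℂ)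
    (h : ∀ i ∈ s, HasLeading (d i) (p i) (q i)) :
    HasLeading (∑ i ∈ s, d i) (∏ i ∈ s, p i) (∏ i ∈ s, q i) := by
  classical
  induction s using Finset.induction_on with
  | empty =>
    simp only [Finset.sum_empty, Finset.prod_empty]
    exact .of_isHomogeneous (isHomogeneous_one _ _)
  | insert a s ha ih =>
    rw [Finset.sum_insert ha, Finset.prod_insert ha, Finset.prod_insert ha]
    exact (h a (Finset.mem_insert_self a s)).mul
      (ih fun i hi => h i (Finset.mem_insert_of_mem hi))

lemma totalDegree_le_of_homogeneousComponent {d : ℕ} {p : MvPolynomial (Fin n) ℂ}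
    (h : ∀ j, d < j → homogeneousComponent j p = 0) : p.totalDegree ≤ d := by
  by_contra! hd
  have h1 : p ≠ 0 := by rintro rfl; simp at hd
  obtain ⟨m, hm, hm'⟩ := Finset.exists_mem_eq_sup _ (support_nonempty.2 h1)
    (fun s : Fin n →₀ ℕ => s.sum fun _ e => e)
  have h3 : m.degree = p.totalDegree := hm'.symm
  have := congrArg (coeff m) (h _ hd)
  rw [coeff_homogeneousComponent, if_pos h3, coeff_zero] at this
  exact mem_support_iff.1 hm this

end Top

namespace Sg
variable {N : ℕ} {m1 m2 m3 : ℕ}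

lemma QE.add {p q : MvPolynomial (Fin N) ℂ} (hp : QE m1 m2 m3 p) (hq : QE m1 m2 m3 q) :
    QE m1 m2 m3 (p + q) where
  short a s h h' y hy := by rw [map_add, map_add, hp.short a s h h' y hy, hq.short a s h h' y hy]
  half a s h h' y hy := by rw [map_add, map_add, hp.half a s h h' y hy, hq.half a s h h' y hy]
  long a b hab hab' s h h' y hy := by
    rw [map_add, map_add, hp.long a b hab hab' s h h' y hy, hq.long a b hab hab' s h h' y hy]

lemma QE.mul {p q : MvPolynomial (Fin N) ℂ} (hp : QE m1 m2 m3 p) (hq : QE m1 m2 m3 q) :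
    QE m1 m2 m3 (p * q) where
  short a s h h' y hy := by rw [map_mul, map_mul, hp.short a s h h' y hy, hq.short a s h h' y hy]
  half a s h h' y hy := by rw [map_mul, map_mul, hp.half a s h h' y hy, hq.half a s h h' y hy]
  long a b hab hab' s h h' y hy := by
    rw [map_mul, map_mul, hp.long a b hab hab' s h h' y hy, hq.long a b hab hab' s h h' y hy]

/-- Polynomials invariant under all signed permutations are quasi-invariant. -/
lemma QE.of_invariant {p : MvPolynomial (Fin N) ℂ}
    (h : ∀ π : Equiv.Perm (Sg N), Odd π → ∀ y, eval (act π y) p = eval y p) : QE m1 m2 m3 p where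
  short a _ _ _ y _ := h _ (rs_odd a a.ng (ng_ne a)) y
  half a _ _ _ y _ := h _ (rs_odd a a.ng (ng_ne a)) y
  long a b hab _ _ _ _ y _ := h _ (rs_odd a b hab) y

lemma QE.const (c : ℂ) : QE m1 m2 m3 (C c : MvPolynomial (Fin N) ℂ) :=
  .of_invariant fun _ _ _ => by rw [eval_C, eval_C]

lemma QE.smul {p : MvPolynomial (Fin N) ℂ} (c : ℂ) (hp : QE m1 m2 m3 p) :
    QE m1 m2 m3 (c • p) := by
  rw [smul_eq_C_mul]; exact (QE.const c).mul hp

lemma sum_co_pow (k : ℕ) (y : Fin N → ℂ) :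
    ∑ a : Sg N, co a y ^ (2 * k) = 2 * eval y (powP N k) := by
  rw [sum_sg, powP, map_sum, Finset.mul_sum]
  refine Finset.sum_congr rfl fun j _ => ?_
  simp only [co, sg, Units.val_one, Int.cast_one, one_mul, Units.val_neg, Int.cast_neg, neg_mul,
    map_pow, eval_X, (even_two_mul k).neg_pow]
  ring

lemma eval_act_powP (k : ℕ) {π : Equiv.Perm (Sg N)} (h : Odd π) (y : Fin N → ℂ) :
    eval (act π y) (powP N k) = eval y (powP N k) := by
  have h2 : (2 : ℂ) ≠ 0 := two_ne_zero
  apply mul_left_cancel₀ h2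
  rw [← sum_co_pow, ← sum_co_pow, ← Equiv.sum_comp π.symm fun a => co a y ^ (2 * k)]
  exact Finset.sum_congr rfl fun a _ => by rw [co_act h]

variable (N) in
/-- A polynomial multiplying everything into the quasi-invariants. -/
def conductor (M : ℕ) : MvPolynomial (Fin N) ℂ :=
  ∏ a : Sg N, ∏ b ∈ Finset.univ.erase a, ∏ t ∈ Finset.range M, (a.lin - b.lin - C (t : ℂ))

lemma eval_conductor {M : ℕ} {a b : Sg N} (hab : b ≠ a) {t : ℕ} (ht : t < M) {y : Fin N → ℂ}
    (hy : co a y - co b y = t) : eval y (conductor N M) = 0 := by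
  simp only [conductor, map_prod]
  refine Finset.prod_eq_zero (Finset.mem_univ a) (Finset.prod_eq_zero
    (Finset.mem_erase.2 ⟨hab, Finset.mem_univ b⟩) (Finset.prod_eq_zero (Finset.mem_range.2 ht) ?_))
  rw [map_sub, map_sub, eval_lin, eval_lin, eval_C, hy, sub_self]

lemma QE.conductor_mul {M : ℕ} (hM : 2 * (m1 + m2 + m3) < M) (p : MvPolynomial (Fin N) ℂ) :
    QE m1 m2 m3 (conductor N M * p) := by
  have key : ∀ (a b : Sg N), b ≠ a → ∀ t : ℕ, t < M → ∀ y, co a y - co b y = t →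
      eval (act (rs a b) y) (conductor N M * p) = eval y (conductor N M * p) := by
    intro a b hab t ht y hy
    rw [map_mul, map_mul, eval_conductor hab ht hy, eval_conductor hab.symm ht, zero_mul, zero_mul]
    rw [co_act (rs_odd a b hab), co_act (rs_odd a b hab), rs_symm a b hab]
    have e1 : rs a b a = b := by
      by_cases h : b = a.ng
      · subst h; simp [rs_ng]
      · rw [rs_apply hab h]; simp
    have e2 : rs a b b = a := by
      rw [← Equiv.eq_symm_apply, rs_symm a b hab, e1]
    rw [e1, e2, hy]
  refine ⟨fun a s h h' y hy => key a a.ng (ng_ne a) (2 * s) (by omega) y ?_,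
    fun a s h h' y hy => key a a.ng (ng_ne a) (2 * s - 1) (by omega) y ?_,
    fun a b hab _ s h h' y hy => key a b hab s (by omega) y hy⟩
  · rw [co_ng, hy]; push_cast; ring
  · rw [co_ng, hy]; push_cast [show 1 ≤ 2 * s by omega]; ring

lemma hasLeading_conductor (M : ℕ) : ∃ d, HasLeading d (conductor N M) (disc N ^ M) := by
  have h0 : ∀ (a b : Sg N) (t : ℂ), HasLeading 1 (a.lin - b.lin - C t) (a.lin - b.lin) := by
    intro a b t
    have h1 : (a.lin - b.lin : MvPolynomial (Fin N) ℂ).IsHomogeneous 1 := by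
      have h2 : ∀ c : Sg N, c.lin.IsHomogeneous 1 := fun c => by
        have := (isHomogeneous_C (Fin N) c.sg).mul (isHomogeneous_X ℂ c.1)
        rwa [zero_add] at this
      exact (h2 a).sub (h2 b)
    refine ⟨(totalDegree_sub _ _).trans (max_le h1.totalDegree_le (by simp)), ?_⟩
    rw [map_sub, homogeneousComponent_eq_self h1, homogeneousComponent_eq_zero _ _ (by simp),
      sub_zero]
  have := HasLeading.prod Finset.univ _ _ _ fun (a : Sg N) _ =>
    HasLeading.prod (Finset.univ.erase a) _ _ _ fun (b : Sg N) _ =>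
      HasLeading.prod (Finset.range M) _ _ _ fun (t : ℕ) _ => h0 a b t
  simp only [Finset.prod_const, Finset.card_range, Finset.prod_pow] at this
  exact ⟨_, this⟩

variable (N m1 m2 m3) in
/-- Leading terms of degree `d` of quasi-invariants. -/
def piece (d : ℕ) : Submodule ℂ (MvPolynomial (Fin N) ℂ) where
  carrier := {q : MvPolynomial (Fin N) ℂ | ∃ p, QE m1 m2 m3 p ∧ HasLeading d p q}
  add_mem' := by
    rintro q q' ⟨p, hp, h⟩ ⟨p', hp', h'⟩
    exact ⟨p + p', hp.add hp', h.add h'⟩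
  zero_mem' := ⟨C 0, QE.const 0, by simp, by simp⟩
  smul_mem' := by
    rintro c q ⟨p, hp, h⟩
    exact ⟨c • p, hp.smul c, h.smul c⟩

lemma piece_le (d : ℕ) : piece N m1 m2 m3 d ≤ homogeneousSubmodule (Fin N) ℂ d := by
  rintro q ⟨p, _, h⟩
  exact h.isHomogeneous

lemma powP_mul_mem_piece {k d : ℕ} {q : MvPolynomial (Fin N) ℂ} (h : q ∈ piece N m1 m2 m3 d) :
    powP N k * q ∈ piece N m1 m2 m3 (d + 2 * k) := by
  obtain ⟨p, hp, h⟩ := h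
  rw [add_comm]
  exact ⟨powP N k * p, (QE.of_invariant fun _ hπ y => eval_act_powP k hπ y).mul hp,
    (HasLeading.of_isHomogeneous (powP_isHomogeneous k)).mul h⟩

lemma ham_mem_piece {d : ℕ} {q : MvPolynomial (Fin N) ℂ} (h : q ∈ piece N m1 m2 m3 (d + 2)) :
    ∃ q' ∈ piece N m1 m2 m3 d,
      (data N (m1 + m2) m3).ham₀ (tau N (m1 + m2) m3 q) = tau N (m1 + m2) m3 q' := by
  obtain ⟨p, hp, h⟩ := h
  obtain ⟨g, hg⟩ := exists_df hp
  have h1 := leading_df hg h.le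
  refine ⟨(2 : ℂ) • homogeneousComponent d g, Submodule.smul_mem _ _
    ⟨g, QE.df hg hp, totalDegree_le_of_homogeneousComponent fun j hj => h1.1 j (by omega), rfl⟩, ?_⟩
  · refine ham₀_tau fun x hx => ?_
    rw [h1.2 d rfl x hx, h.top]

lemma ham_piece_eq_zero {d : ℕ} (hd : d < 2) {q : MvPolynomial (Fin N) ℂ}
    (h : q ∈ piece N m1 m2 m3 d) :
    (data N (m1 + m2) m3).ham₀ (tau N (m1 + m2) m3 q) = 0 := by
  obtain ⟨p, hp, h⟩ := h
  obtain ⟨g, hg⟩ := exists_df hp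
  have hg0 : g = 0 := by
    rw [← sum_homogeneousComponent g]
    exact Finset.sum_eq_zero fun j _ => (leading_df hg h.le).1 j (by omega)
  have h1 : ∀ x, Reg₀ x → eval x (0 : MvPolynomial (Fin N) ℂ) = calAt m1 m2 m3 q x := by
    intro x hx
    rw [map_zero, ← h.top]
    refine tendsto_nhds_unique (Filter.Tendsto.congr' ?_ tendsto_const_nhds) (tendsto_df hx h.le)
    filter_upwards [reg_smul hx] with ε hε
    rw [← hg _ hε, hg0, map_zero, mul_zero, zero_div]
  rw [ham₀_tau h1, smul_zero, map_zero]

theorem piece_nondeg {r : LR N}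
    (h : ∀ d, ∀ q ∈ piece N m1 m2 m3 d, gaussI N (tau N (m1 + m2) m3 q * r) = 0) : r = 0 := by
  obtain ⟨e, he⟩ := hasLeading_conductor (N := N) (2 * (m1 + m2 + m3) + 1)
  refine gaussI_nondeg (m := 0) (k := 0) (u := toLR (disc N ^ (2 * (m1 + m2 + m3) + 1)) *
    weight N (m1 + m2) m3) ((map_pow (toLR (N := N)) _ _ ▸ isUnit_toLR_disc.pow _).mul isUnit_weight) fun p => ?_
  rw [← sum_homogeneousComponent p, map_sum, Finset.sum_mul, map_sum]
  refine Finset.sum_eq_zero fun d _ => ?_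
  have := h (e + d) _ ⟨_, QE.conductor_mul (Nat.lt_succ_self _) _,
    he.mul (HasLeading.of_isHomogeneous (homogeneousComponent_isHomogeneous d p))⟩
  rw [← this, tau_apply]
  congr 1
  rw [map_mul]
  ring

end Sg

end

section

namespace Coinvariant
open Polynomial (natDegree_X_sub_C)

variable {A : Type} [CommRing A] [Algebra ℂ A] (N : ℕ) (x : ℕ → A)

/-- Partial products `∏ (T - xᵢ²)`. -/
def tailPoly (j : ℕ) : Polynomial A := ∏ i ∈ Finset.Ico j N, (Polynomial.X - Polynomial.C (x i ^ 2))

omit [Algebra ℂ A] in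
lemma tailPoly_monic (j : ℕ) : (tailPoly N x j).Monic :=
  Polynomial.monic_prod_of_monic _ _ fun _ _ => Polynomial.monic_X_sub_C _

omit [Algebra ℂ A] in
lemma natDegree_tailPoly [Nontrivial A] (j : ℕ) : (tailPoly N x j).natDegree = N - j := by
  rw [tailPoly, Polynomial.natDegree_prod_of_monic _ _ fun _ _ => Polynomial.monic_X_sub_C _]
  simp only [natDegree_X_sub_C, Finset.sum_const, Nat.card_Ico, smul_eq_mul, mul_one]

omit [Algebra ℂ A] in
lemma tailPoly_succ {j : ℕ} (hj : j < N) :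
    tailPoly N x j = (Polynomial.X - Polynomial.C (x j ^ 2)) * tailPoly N x (j + 1) := by
  rw [tailPoly, tailPoly, Finset.prod_eq_prod_Ico_succ_bot hj]

variable {N x} (hx : ∀ k, 1 ≤ k → ∑ i ∈ Finset.range N, x i ^ (2 * k) = 0)
include hx

lemma tailPoly_zero : tailPoly N x 0 = Polynomial.X ^ N := by
  let y : Fin N → A := fun i => x i ^ 2
  have h1 : ∀ k, 1 ≤ k → aeval y (psum (Fin N) ℂ k) = 0 := by
    intro k hk
    rw [psum, map_sum, ← hx k hk, Finset.sum_range]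
    simp only [map_pow, aeval_X, y, pow_mul]
  have h2 : ∀ k, 1 ≤ k → aeval y (esymm (Fin N) ℂ k) = 0 := by
    intro k hk
    have h3 := congrArg (aeval y) (mul_esymm_eq_sum (Fin N) ℂ k)
    rw [map_mul, map_mul, map_sum, Finset.sum_eq_zero, mul_zero, map_natCast] at h3
    · have hu : IsUnit ((k : ℕ) : A) := by
        have := (IsUnit.mk0 (k : ℂ) (by exact_mod_cast (by omega : k ≠ 0))).map (algebraMap ℂ A)
        simpa using this
      exact hu.mul_right_eq_zero.1 h3
    · intro a ha
      have := Finset.mem_filter.1 ha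
      have h4 := Finset.HasAntidiagonal.mem_antidiagonal.1 this.1
      rw [map_mul, h1 a.2 (by have h5 : a.1 < k := this.2; omega), mul_zero]
  have h3 : tailPoly N x 0 = ((Finset.univ.val.map y).map fun t => Polynomial.X - Polynomial.C t).prod := by
    rw [Multiset.map_map, tailPoly, ← Finset.range_eq_Ico, Finset.prod_range]
    rfl
  rw [h3, Multiset.prod_X_sub_X_eq_sum_esymm, Finset.sum_range_succ', Finset.sum_eq_zero]
  · rw [Multiset.esymm, Multiset.powersetCard_zero_left]
    simp
  · intro j _
    rw [← aeval_esymm_eq_multiset_esymm (Fin N) ℂ, h2 _ (by omega)]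
    simp

lemma coeff_tailPoly_mem {j : ℕ} (hj : j ≤ N) (n : ℕ) :
    (tailPoly N x j).coeff n ∈ Algebra.adjoin ℂ (x '' Set.Iio j) := by
  nontriviality A
  induction j generalizing n with
  | zero =>
    rw [tailPoly_zero hx, Polynomial.coeff_X_pow]
    split_ifs
    · exact one_mem _
    · exact zero_mem _
  | succ j ih =>
    have h0 : ∀ k n, N - (j + 1) < n + k →
        (tailPoly N x (j + 1)).coeff n ∈ Algebra.adjoin ℂ (x '' Set.Iio (j + 1)) := by
      intro k
      induction k with
      | zero =>
        intro n hn
        rw [Polynomial.coeff_eq_zero_of_natDegree_lt (by rwa [natDegree_tailPoly])]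
        exact zero_mem _
      | succ k ihk =>
        intro n hn
        have h1 := congrArg (fun p => Polynomial.coeff p (n + 1)) (tailPoly_succ N x (j := j) hj)
        simp only [sub_mul, Polynomial.coeff_sub, Polynomial.coeff_X_mul, Polynomial.coeff_C_mul] at h1
        have h2 : (tailPoly N x (j + 1)).coeff n =
            (tailPoly N x j).coeff (n + 1) + x j ^ 2 * (tailPoly N x (j + 1)).coeff (n + 1) := by
          rw [h1]; ring
        rw [h2]
        refine add_mem (Algebra.adjoin_mono (Set.image_mono (Set.Iio_subset_Iio (Nat.le_succ j)))
          (ih (by omega) _)) (mul_mem (pow_mem (Algebra.subset_adjoin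
            (Set.mem_image_of_mem x (Set.mem_Iio.2 (Nat.lt_succ_self j)))) 2)
          (ihk (n + 1) (by omega)))
    exact h0 (N + 1) n (by omega)

omit hx in
variable (N x) in
/-- Span of the monomials in the first `j` variables with exponents in the box. -/
def boxSpan : ℕ → Submodule ℂ A
  | 0 => Submodule.span ℂ {1}
  | j + 1 => ⨆ i : Fin (2 * (N - j)), (boxSpan j).map (LinearMap.mulLeft ℂ (x j ^ (i : ℕ)))

omit hx in
lemma mul_mem_boxSpan_succ {j i : ℕ} (hi : i < 2 * (N - j)) {u : A} (hu : u ∈ boxSpan N x j) :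
    x j ^ i * u ∈ boxSpan N x (j + 1) :=
  (le_iSup (fun i : Fin (2 * (N - j)) => (boxSpan N x j).map (LinearMap.mulLeft ℂ (x j ^ (i : ℕ))))
    ⟨i, hi⟩) ⟨u, hu, rfl⟩

lemma x_mul_mem_boxSpan {j : ℕ} (hj : j ≤ N) {l : ℕ} (hl : l < j) {u : A}
    (hu : u ∈ boxSpan N x j) : x l * u ∈ boxSpan N x j := by
  nontriviality A
  induction j generalizing l u with
  | zero => omega
  | succ j ih =>
    have hadj : ∀ c ∈ Algebra.adjoin ℂ (x '' Set.Iio j), ∀ v ∈ boxSpan N x j, c * v ∈ boxSpan N x j := by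
      intro c hc
      induction hc using Algebra.adjoin_induction with
      | mem c hc =>
        obtain ⟨l, hl, rfl⟩ := hc
        exact fun v hv => ih (by omega) hl hv
      | algebraMap r =>
        intro v hv
        rw [← Algebra.smul_def]
        exact Submodule.smul_mem _ _ hv
      | add a b _ _ ha hb => intro v hv; rw [add_mul]; exact add_mem (ha v hv) (hb v hv)
      | mul a b _ _ ha hb => intro v hv; rw [mul_assoc]; exact ha _ (hb v hv)
    suffices boxSpan N x (j + 1) ≤ (boxSpan N x (j + 1)).comap (LinearMap.mulLeft ℂ (x l)) from
      this hu
    refine iSup_le fun i => ?_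
    rintro _ ⟨v, hv, rfl⟩
    change x l * (x j ^ (i : ℕ) * v) ∈ boxSpan N x (j + 1)
    rcases Nat.lt_succ_iff_lt_or_eq.1 hl with h | rfl
    · rw [mul_left_comm]
      exact mul_mem_boxSpan_succ i.2 (ih (by omega) h hv)
    · by_cases hi : (i : ℕ) + 1 < 2 * (N - l)
      · rw [← mul_assoc, ← pow_succ']
        exact mul_mem_boxSpan_succ hi hv
      · have hi' : (i : ℕ) + 1 = 2 * (N - l) := by have := i.2; omega
        rw [← mul_assoc, ← pow_succ', hi', pow_mul]
        have h1 : (tailPoly N x l).eval (x l ^ 2) = 0 := by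
          rw [tailPoly_succ N x hj]; simp
        rw [(tailPoly_monic N x l).as_sum, natDegree_tailPoly, Polynomial.eval_add,
          Polynomial.eval_finsetSum] at h1
        simp only [Polynomial.eval_pow, Polynomial.eval_X, Polynomial.eval_mul, Polynomial.eval_C] at h1
        rw [eq_neg_of_add_eq_zero_left h1, neg_mul, Finset.sum_mul]
        refine neg_mem (sum_mem fun i hi => ?_)
        rw [mul_comm (Polynomial.coeff _ _), mul_assoc, ← pow_mul]
        exact mul_mem_boxSpan_succ (by have := Finset.mem_range.1 hi; omega)
          (hadj _ (coeff_tailPoly_mem hx (by omega) _) _ hv)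

omit hx in
lemma boxSpan_le (j : ℕ) : boxSpan N x j ≤ Submodule.span ℂ {m | ∃ e : ℕ → ℕ,
    (∀ i < j, e i < 2 * (N - i)) ∧ m = ∏ i ∈ Finset.range j, x i ^ e i} := by
  induction j with
  | zero =>
    refine Submodule.span_mono ?_
    rintro _ rfl
    exact ⟨fun _ => 0, by simp, by simp⟩
  | succ j ih =>
    refine iSup_le fun i => ?_
    rw [Submodule.map_le_iff_le_comap]
    refine ih.trans (Submodule.span_le.2 ?_)
    rintro _ ⟨e, he, rfl⟩
    refine Submodule.subset_span ⟨Function.update e j i, fun l hl => ?_, ?_⟩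
    · by_cases h : l = j
      · subst h; simp
      · rw [Function.update_of_ne h]; exact he l (by omega)
    · rw [LinearMap.mulLeft_apply, Finset.prod_range_succ, Function.update_self, mul_comm]
      congr 1
      refine Finset.prod_congr rfl fun l hl => ?_
      rw [Function.update_of_ne (Finset.mem_range.1 hl).ne]

theorem aeval_mem_boxSpan (p : MvPolynomial (Fin N) ℂ) :
    aeval (fun i : Fin N => x i) p ∈ Submodule.span ℂ {m | ∃ e : ℕ → ℕ,
      (∀ i < N, e i < 2 * (N - i)) ∧ m = ∏ i ∈ Finset.range N, x i ^ e i} := by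
  refine boxSpan_le N ?_
  have hone : ∀ j ≤ N, (1 : A) ∈ boxSpan N x j := by
    intro j hj
    induction j with
    | zero => exact Submodule.subset_span rfl
    | succ j ih =>
      have := mul_mem_boxSpan_succ (x := x) (i := 0) (by omega) (ih (by omega))
      simpa using this
  induction p using MvPolynomial.induction_on with
  | C c =>
    rw [← algebraMap_eq, AlgHom.commutes, Algebra.algebraMap_eq_smul_one]
    exact Submodule.smul_mem _ _ (hone N le_rfl)
  | add p q hp hq => rw [map_add]; exact add_mem hp hq
  | mul_X p i hp =>
    rw [map_mul, aeval_X, mul_comm]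
    exact x_mul_mem_boxSpan hx le_rfl i.2 hp

end Coinvariant

/-- Exponents of the monomials spanning the coinvariants. -/
abbrev Box (N : ℕ) : Type := (i : Fin N) → Fin (2 * (N - i))

lemma card_box (N : ℕ) : Fintype.card (Box N) = 2 ^ N * N.factorial := by
  rw [Fintype.card_pi]
  simp only [Fintype.card_fin, Finset.prod_mul_distrib, Finset.prod_const, Finset.card_univ]
  congr 1
  rw [← Finset.prod_range (fun i => N - i), ← Finset.prod_range_add_one_eq_factorial,
    ← Finset.prod_range_reflect]
  exact Finset.prod_congr rfl fun i hi => by have := Finset.mem_range.1 hi; omega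

variable {N : ℕ}

/-- The monomials spanning the coinvariants. -/
def boxMonomial (e : Box N) : MvPolynomial (Fin N) ℂ := ∏ i, X i ^ (e i : ℕ)

lemma boxMonomial_isHomogeneous (e : Box N) :
    (boxMonomial e).IsHomogeneous (∑ i, (e i : ℕ)) :=
  .prod _ _ _ fun i _ => by simpa using (isHomogeneous_X ℂ i).pow (e i : ℕ)

theorem homogeneous_mem_span {d : ℕ} {p : MvPolynomial (Fin N) ℂ} (hp : p.IsHomogeneous d) :
    p ∈ Submodule.span ℂ ({q | ∃ k e, ∃ p : MvPolynomial (Fin N) ℂ, p.IsHomogeneous e ∧ 1 ≤ k ∧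
      d = e + 2 * k ∧ q = p * ∑ j, X j ^ (2 * k)} ∪ Set.range boxMonomial) := by
  let J : Ideal (MvPolynomial (Fin N) ℂ) := Ideal.span {q | ∃ k, 1 ≤ k ∧ q = ∑ j, X j ^ (2 * k)}
  let x : ℕ → MvPolynomial (Fin N) ℂ ⧸ J := fun i =>
    if h : i < N then Ideal.Quotient.mk J (X ⟨i, h⟩) else 0
  have hx : ∀ i : Fin N, x i = Ideal.Quotient.mk J (X i) := fun i => by simp [x]
  have hx0 : ∀ k, 1 ≤ k → ∑ i ∈ Finset.range N, x i ^ (2 * k) = 0 := by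
    intro k hk
    rw [Finset.sum_range]
    simp only [hx, ← map_pow, ← map_sum]
    exact Ideal.Quotient.eq_zero_iff_mem.2 (Ideal.subset_span ⟨k, hk, rfl⟩)
  have h1 := Coinvariant.aeval_mem_boxSpan hx0 p
  have h2 : aeval (fun i : Fin N => x i) = Ideal.Quotient.mkₐ ℂ J := by
    ext i
    rw [aeval_X, hx]; rfl
  rw [h2] at h1
  have h3 : Submodule.span ℂ {m | ∃ e : ℕ → ℕ,
      (∀ i < N, e i < 2 * (N - i)) ∧ m = ∏ i ∈ Finset.range N, x i ^ e i} ≤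
      (Submodule.span ℂ (Set.range boxMonomial)).map (Ideal.Quotient.mkₐ ℂ J).toLinearMap := by
    refine Submodule.span_le.2 ?_
    rintro _ ⟨e, he, rfl⟩
    refine ⟨_, Submodule.subset_span ⟨fun i => ⟨e i, he i i.2⟩, rfl⟩, ?_⟩
    rw [Finset.prod_range]
    simp only [hx, boxMonomial]
    simp
  obtain ⟨b, hb, hbp⟩ := h3 h1
  have h4 : p - b ∈ J := by
    rw [← Ideal.Quotient.eq_zero_iff_mem, map_sub, sub_eq_zero]
    exact hbp.symm
  set T := Submodule.span ℂ ({q | ∃ k e, ∃ p : MvPolynomial (Fin N) ℂ, p.IsHomogeneous e ∧ 1 ≤ k ∧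
      d = e + 2 * k ∧ q = p * ∑ j, X j ^ (2 * k)} ∪ Set.range boxMonomial) with hT
  have h5 : homogeneousComponent d b ∈ T := by
    suffices Submodule.span ℂ (Set.range boxMonomial) ≤ T.comap (homogeneousComponent d) from this hb
    refine Submodule.span_le.2 ?_
    rintro _ ⟨e, rfl⟩
    change homogeneousComponent d _ ∈ T
    rw [homogeneousComponent_of_mem (boxMonomial_isHomogeneous e)]
    split_ifs
    · exact Submodule.subset_span (.inr ⟨e, rfl⟩)
    · exact zero_mem _
  have h6 : ∀ r ∈ J, ∀ q, homogeneousComponent d (q * r) ∈ T := by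
    intro r hr
    induction hr using Submodule.span_induction with
    | mem r hr =>
      obtain ⟨k, hk, rfl⟩ := hr
      intro q
      rw [← sum_homogeneousComponent q, Finset.sum_mul, map_sum]
      refine sum_mem fun e _ => ?_
      have h7 : (∑ j, X j ^ (2 * k) : MvPolynomial (Fin N) ℂ).IsHomogeneous (2 * k) :=
        .sum _ _ _ fun j _ => by simpa using (isHomogeneous_X ℂ j).pow (2 * k)
      have h8 := homogeneousComponent_isHomogeneous e q
      rw [homogeneousComponent_of_mem (h8.mul h7)]
      split_ifs with h
      · exact Submodule.subset_span (.inl ⟨k, e, _, h8, hk, h, rfl⟩)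
      · exact zero_mem _
    | zero => intro q; rw [mul_zero, map_zero]; exact zero_mem _
    | add a b _ _ ha hb => intro q; rw [mul_add, map_add]; exact add_mem (ha q) (hb q)
    | smul a r _ ih => intro q; rw [smul_eq_mul, ← mul_assoc]; exact ih _
  replace h6 := h6 _ h4 1
  rw [one_mul] at h6
  rw [map_sub, homogeneousComponent_eq_self hp] at h6
  simpa using add_mem h6 h5

end

section

lemma exists_algHom_of_commute {σ A : Type} [Ring A] [Algebra ℂ A] (f : σ → A)
    (hf : ∀ i j, f i * f j = f j * f i) :
    ∃ Φ : MvPolynomial σ ℂ →ₐ[ℂ] A, ∀ j, Φ (X j) = f j := by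
  have hcomm : ∀ a ∈ Set.range f, ∀ b ∈ Set.range f, a * b = b * a := by
    rintro _ ⟨i, rfl⟩ _ ⟨j, rfl⟩
    exact hf i j
  let S := Algebra.adjoin ℂ (Set.range f)
  let : CommRing S :=
    { (inferInstance : Ring S) with mul_comm := (Algebra.isMulCommutative_adjoin ℂ hcomm).is_comm.comm }
  let g : σ → S := fun j => ⟨f j, Algebra.subset_adjoin ⟨j, rfl⟩⟩
  exact ⟨S.val.comp (aeval g), fun j => by simp [g]⟩

namespace Sg
variable {N : ℕ}

lemma exists_constCoeffOp (N : ℕ) : ∃ Φ : MvPolynomial (Fin N) ℂ →ₐ[ℂ] Module.End ℂ (LR N),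
    ∀ j : Fin N, Φ (X j) = (dLR (j, 1)).toLinearMap :=
  exists_algHom_of_commute _ fun i j => by
    ext r
    exact (data N 0 0).d_comm (i, 1) (j, 1) r

/-- The constant-coefficient differential operator with a given symbol. -/
def constCoeffOp (N : ℕ) : MvPolynomial (Fin N) ℂ →ₐ[ℂ] Module.End ℂ (LR N) :=
  (exists_constCoeffOp N).choose

lemma constCoeffOp_X (j : Fin N) (r : LR N) : constCoeffOp N (X j) r = dLR (j, 1) r := by
  rw [constCoeffOp, (exists_constCoeffOp N).choose_spec j]; rfl

lemma constCoeffOp_mul (p q : MvPolynomial (Fin N) ℂ) (r : LR N) :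
    constCoeffOp N (p * q) r = constCoeffOp N p (constCoeffOp N q r) := by
  rw [map_mul]; rfl

lemma constCoeffOp_lin (a : Sg N) (r : LR N) : constCoeffOp N a.lin r = dLR a r := by
  rcases eq_or_eq_ng (a := a) (b := (a.1, 1)) rfl with h | h
  · rw [h, lin, constCoeffOp_mul, constCoeffOp_X]
    simp [sg]
  · have := (data N 0 0).d_neg (a.1, 1)
    change dLR (ng (a.1, 1)) = -dLR (a.1, 1) at this
    rw [h, this, lin_ng, map_neg, LinearMap.neg_apply, lin, constCoeffOp_mul, constCoeffOp_X]
    simp [sg]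

/-- The ideal generated by the derivatives of `h` of order less than `k`. -/
def derivIdeal (h : LR N) (k : ℕ) : Ideal (LR N) :=
  Ideal.span {r | ∃ p : MvPolynomial (Fin N) ℂ, p.totalDegree < k ∧ r = constCoeffOp N p h}

lemma derivIdeal_mono (h : LR N) {k l : ℕ} (hkl : k ≤ l) : derivIdeal h k ≤ derivIdeal h l :=
  Ideal.span_mono fun _ ⟨p, hp, hr⟩ => ⟨p, by omega, hr⟩

lemma mem_derivIdeal (h : LR N) {k : ℕ} {p : MvPolynomial (Fin N) ℂ} (hp : p.totalDegree < k) :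
    constCoeffOp N p h ∈ derivIdeal h k := Ideal.subset_span ⟨p, hp, rfl⟩

lemma totalDegree_lin_le (a : Sg N) : a.lin.totalDegree ≤ 1 := by
  rw [lin]
  exact (totalDegree_mul _ _).trans (by rw [totalDegree_C, totalDegree_X])

lemma dLR_mem_derivIdeal {h : LR N} (a : Sg N) {k : ℕ} {r : LR N} (hr : r ∈ derivIdeal h k) :
    dLR a r ∈ derivIdeal h (k + 1) := by
  induction hr using Submodule.span_induction with
  | mem s hs =>
    obtain ⟨p, hp, rfl⟩ := hs
    rw [← constCoeffOp_lin, ← constCoeffOp_mul]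
    refine mem_derivIdeal h ((totalDegree_mul _ _).trans_lt ?_)
    have := totalDegree_lin_le a
    omega
  | zero => rw [map_zero]; exact zero_mem _
  | add x y _ _ hx hy => rw [map_add]; exact add_mem hx hy
  | smul c x hx hx' =>
    rw [smul_eq_mul, Derivation.leibniz]
    exact add_mem (Submodule.smul_mem _ _ hx')
      (derivIdeal_mono h k.le_succ (Ideal.mul_mem_right _ _ hx))

lemma constCoeffOp_mem_derivIdeal {h : LR N} (q : MvPolynomial (Fin N) ℂ) {e m : ℕ}
    (hq : q.totalDegree ≤ e) {r : LR N} (hr : r ∈ derivIdeal h m) :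
    constCoeffOp N q r ∈ derivIdeal h (m + e) := by
  have key : ∀ (s : Fin N →₀ ℕ) (m : ℕ) (r : LR N), r ∈ derivIdeal h m →
      constCoeffOp N (monomial s 1) r ∈ derivIdeal h (m + s.degree) := by
    intro s
    induction s using Finsupp.induction_linear with
    | zero => intro m r hr; simpa using hr
    | add s t hs ht =>
      intro m r hr
      rw [← one_mul (1 : ℂ), ← monomial_mul, constCoeffOp_mul, map_add, add_comm s.degree,
        ← add_assoc]
      exact hs _ _ (ht _ _ hr)
    | single i n =>
      intro m r hr
      rw [Finsupp.degree_single, ← X_pow_eq_monomial]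
      induction n with
      | zero => simpa using hr
      | succ n ih =>
        rw [pow_succ', constCoeffOp_mul, constCoeffOp_X, ← add_assoc]
        exact dLR_mem_derivIdeal _ ih
  rw [q.as_sum, map_sum, LinearMap.sum_apply]
  refine sum_mem fun s hs => ?_
  rw [← mul_one (coeff s q), ← C_mul_monomial, ← smul_eq_C_mul, map_smul, LinearMap.smul_apply,
    Algebra.smul_def]
  refine Ideal.mul_mem_left _ _ (derivIdeal_mono h ?_ (key s m r hr))
  have := le_totalDegree hs
  change s.degree ≤ _ at this
  omega

section
variable (m k : ℕ)

lemma lax_pow_sub_mem (h : LR N) (n : ℕ) (a : Sg N) :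
    ((data N m k).lax ^ n) (SignedData.const h) a - constCoeffOp N (a.lin ^ n) h
      ∈ derivIdeal h n := by
  induction n generalizing a with
  | zero =>
    simp only [pow_zero, map_one, Module.End.one_apply]
    rw [SignedData.const_apply, sub_self]
    exact zero_mem _
  | succ n ih =>
    have hmem : ∀ b, ((data N m k).lax ^ n) (SignedData.const h) b ∈ derivIdeal h (n + 1) := by
      intro b
      refine (Submodule.sub_mem_iff_left _ (mem_derivIdeal h ?_)).1
        (derivIdeal_mono h n.le_succ (ih b))
      refine (totalDegree_pow _ _).trans_lt ?_
      have := totalDegree_lin_le b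
      nlinarith
    have h1 := dLR_mem_derivIdeal a (ih a)
    rw [pow_succ' (SignedData.lax _), Module.End.mul_apply, SignedData.lax_apply, pow_succ' a.lin, constCoeffOp_mul,
      constCoeffOp_lin, add_sub_right_comm]
    rw [map_sub (dLR a)] at h1
    exact add_mem h1 (sum_mem fun b _ => Ideal.mul_mem_left _ _ (hmem b))

lemma powP_mem_derivIdeal {h : LR N} {r : ℕ} (hh : (data N m k).integral (2 * r) h = 0) :
    constCoeffOp N (powP N r) h ∈ derivIdeal h (2 * r) := by
  have h1 : ∑ a : Sg N, (a.lin ^ (2 * r) : MvPolynomial (Fin N) ℂ) = (2 : ℂ) • powP N r := by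
    rw [sum_sg, powP, Finset.smul_sum]
    refine Finset.sum_congr rfl fun j _ => ?_
    simp only [lin, sg, mul_pow, ← map_pow]
    norm_num [pow_mul]
    rw [two_smul]
  have h2 : ∑ a : Sg N, (((data N m k).lax ^ (2 * r)) (SignedData.const h) a
      - constCoeffOp N (a.lin ^ (2 * r)) h) ∈ derivIdeal h (2 * r) :=
    sum_mem fun a _ => lax_pow_sub_mem m k h _ a
  rw [SignedData.integral_apply, SignedData.total_apply] at hh
  rw [Finset.sum_sub_distrib, hh, zero_sub, ← LinearMap.sum_apply, ← map_sum, h1, map_smul,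
    LinearMap.smul_apply] at h2
  have h3 := neg_mem h2
  rw [neg_neg, Algebra.smul_def] at h3
  have h4 := Ideal.mul_mem_left _ (algebraMap ℂ (LR N) (1 / 2)) h3
  rw [← mul_assoc, ← map_mul] at h4
  norm_num at h4
  exact h4

/-- Functions annihilated by the conserved quantities of positive even order. -/
def hol (N m k : ℕ) : Submodule ℂ (LR N) :=
  ⨅ r : {r : ℕ // 1 ≤ r}, LinearMap.ker ((data N m k).integral (2 * r.1))

lemma mem_hol {h : LR N} : h ∈ hol N m k ↔ ∀ r, 1 ≤ r → (data N m k).integral (2 * r) h = 0 := by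
  simp [hol]

variable {m k}

lemma constCoeffOp_mem_box {h : LR N} (hh : h ∈ hol N m k) (p : MvPolynomial (Fin N) ℂ) :
    constCoeffOp N p h ∈
      Ideal.span (Set.range fun e : Box N => constCoeffOp N (boxMonomial e) h) := by
  set B := Ideal.span (Set.range fun e : Box N =>
    constCoeffOp N (boxMonomial e) h) with hB
  have hsmul : ∀ (c : ℂ) (r : LR N), r ∈ B → c • r ∈ B := fun c r hr => by
    rw [Algebra.smul_def]; exact Ideal.mul_mem_left _ _ hr
  have key : ∀ d, ∀ p : MvPolynomial (Fin N) ℂ, p.IsHomogeneous d → constCoeffOp N p h ∈ B := by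
    intro d
    induction d using Nat.strong_induction_on with
    | _ d ih =>
    have hI : derivIdeal h d ≤ B := by
      refine Ideal.span_le.2 ?_
      rintro _ ⟨p, hp, rfl⟩
      rw [← sum_homogeneousComponent p, map_sum, LinearMap.sum_apply]
      exact sum_mem fun i hi => ih i (by rw [Finset.mem_range] at hi; omega) _
        (homogeneousComponent_isHomogeneous i p)
    intro p hp
    have := homogeneous_mem_span hp
    clear hp
    induction this using Submodule.span_induction with
    | mem q hq =>
      rcases hq with ⟨r, e, p', hp', hr, hd, rfl⟩ | ⟨e, rfl⟩
      · refine hI ?_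
        rw [constCoeffOp_mul]
        have := constCoeffOp_mem_derivIdeal p' hp'.totalDegree_le
          (powP_mem_derivIdeal m k ((mem_hol m k).1 hh r hr))
        rwa [hd, add_comm e]
      · exact Ideal.subset_span ⟨e, rfl⟩
    | zero => rw [map_zero]; exact zero_mem _
    | add x y _ _ hx hy => rw [map_add]; exact add_mem hx hy
    | smul c x _ hx => rw [map_smul]; exact hsmul c _ hx
  rw [← sum_homogeneousComponent p, map_sum, LinearMap.sum_apply]
  exact sum_mem fun i _ => key i _ (homogeneousComponent_isHomogeneous i p)

variable (N m k)

/-- The jet at the base point along the box monomials. -/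
def holJet : hol N m k →ₗ[ℂ] Box N → ℂ :=
  LinearMap.pi fun e => (evLR base reg_base).toLinearMap ∘ₗ
    constCoeffOp N (boxMonomial e) ∘ₗ (hol N m k).subtype

lemma holJet_injective : Function.Injective (holJet N m k) := by
  rw [injective_iff_map_eq_zero]
  rintro ⟨h, hh⟩ h0
  have h1 : ∀ e, evLR base reg_base (constCoeffOp N (boxMonomial e) h) = 0 :=
    fun e => congrFun h0 e
  have h2 : ∀ p, evLR base reg_base (constCoeffOp N p h) = 0 := by
    intro p
    have : Ideal.span (Set.range fun e : Box N =>
        constCoeffOp N (boxMonomial e) h) ≤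
        RingHom.ker (evLR base reg_base).toRingHom := by
      rw [Ideal.span_le]
      rintro _ ⟨e, rfl⟩
      exact h1 e
    exact this (constCoeffOp_mem_box hh p)
  let K : Submodule ℂ (LR N) :=
    LinearMap.range ((LinearMap.applyₗ h).comp (constCoeffOp N).toLinearMap)
  have h3 : h = 0 := by
    refine eq_zero_of_derivatives reg_base K ?_ ?_ ⟨1, by simp⟩
    · rintro a _ ⟨p, rfl⟩
      exact ⟨a.lin * p, by simpa using constCoeffOp_lin a _⟩
    · rintro _ ⟨p, rfl⟩
      exact h2 p
  exact Subtype.ext h3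

instance finiteDimensional_hol : FiniteDimensional ℂ (hol N m k) :=
  FiniteDimensional.of_injective _ (holJet_injective N m k)

lemma finrank_hol_le : Module.finrank ℂ (hol N m k) ≤ 2 ^ N * N.factorial := by
  have := LinearMap.finrank_le_finrank_of_injective (holJet_injective N m k)
  rwa [Module.finrank_fintype_fun_eq_card, card_box] at this

end
end Sg

end

section

section Invariants
variable {N : ℕ}

variable (N) in
/-- The ring of invariants of the hyperoctahedral group. -/
def invariantSubalgebra : Subalgebra ℂ (MvPolynomial (Fin N) ℂ) where
  carrier := {p | BInv p}
  mul_mem' hp hq := ⟨fun j => by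
      rw [sigmaP, map_mul]; exact congrArg₂ _ (hp.1 j) (hq.1 j),
    fun i j h => by rw [swapP, map_mul]; exact congrArg₂ _ (hp.2 i j h) (hq.2 i j h)⟩
  add_mem' hp hq := ⟨fun j => by
      rw [sigmaP, map_add]; exact congrArg₂ _ (hp.1 j) (hq.1 j),
    fun i j h => by rw [swapP, map_add]; exact congrArg₂ _ (hp.2 i j h) (hq.2 i j h)⟩
  algebraMap_mem' r := ⟨fun j => by rw [sigmaP, AlgHom.commutes],
    fun i j _ => by rw [swapP, AlgHom.commutes]⟩

lemma bInv_powP (k : ℕ) : BInv (Sg.powP N k) := by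
  refine ⟨fun j => ?_, fun i j _ => ?_⟩
  · rw [sigmaP, Sg.powP, map_sum]
    refine Finset.sum_congr rfl fun l _ => ?_
    rw [map_pow, aeval_X]
    split_ifs with h
    · rw [h, pow_mul, neg_sq, ← pow_mul]
    · rfl
  · rw [swapP, Sg.powP, map_sum, ← Equiv.sum_comp (Equiv.swap i j) fun l => X l ^ (2 * k)]
    refine Finset.sum_congr rfl fun l _ => ?_
    rw [map_pow, aeval_X, Equiv.swap_apply_def]
    split_ifs <;> rfl

/-- The action of a signed permutation on polynomials. -/
def signedHom (σ : Equiv.Perm (Fin N)) (ε : Fin N → ℤˣ) :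
    MvPolynomial (Fin N) ℂ →ₐ[ℂ] MvPolynomial (Fin N) ℂ :=
  aeval fun j => C (((ε j : ℤˣ) : ℤ) : ℂ) * X (σ j)

lemma BInv.rename_eq {p : MvPolynomial (Fin N) ℂ} (hp : BInv p) (σ : Equiv.Perm (Fin N)) :
    rename σ p = p := by
  induction σ using Equiv.Perm.swap_induction_on with
  | one => exact rename_id_apply p
  | swap_mul σ i j hij ih =>
    rw [Equiv.Perm.coe_mul, ← rename_rename, ih]
    conv_rhs => rw [← hp.2 i j hij]
    rw [swapP, rename_eq_aeval]
    congr 2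
    funext k
    rw [Function.comp_apply, Equiv.swap_apply_def]
    split_ifs <;> rfl

lemma BInv.sign_eq {p : MvPolynomial (Fin N) ℂ} (hp : BInv p) (s : Finset (Fin N)) :
    aeval (fun j => if j ∈ s then -X j else (X j : MvPolynomial (Fin N) ℂ)) p = p := by
  induction s using Finset.induction_on with
  | empty => simp
  | insert a s ha ih =>
    conv_rhs => rw [← ih, ← hp.1 a]
    rw [sigmaP, ← AlgHom.comp_apply, comp_aeval]
    congr 2
    funext j
    by_cases hj : j = a
    · subst hj; simp [ha]
    · simp [hj]

lemma BInv.signedHom_eq {p : MvPolynomial (Fin N) ℂ} (hp : BInv p) (σ : Equiv.Perm (Fin N))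
    (ε : Fin N → ℤˣ) : signedHom σ ε p = p := by
  have h : signedHom σ ε p = rename σ
      (aeval (fun j => if j ∈ Finset.univ.filter (fun j => ε j = -1) then -X j
        else (X j : MvPolynomial (Fin N) ℂ)) p) := by
    rw [← AlgHom.comp_apply, comp_aeval, signedHom]
    congr 2
    funext j
    rcases Int.units_eq_one_or (ε j) with h | h
    · have : (1 : ℤˣ) ≠ -1 := by decide
      simp [h, this]
    · simp [h]
  rw [h, hp.sign_eq, hp.rename_eq]

open Sg in
lemma BInv.eval_act {p : MvPolynomial (Fin N) ℂ} (hp : BInv p) {π : Equiv.Perm (Sg N)}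
    (hπ : Odd π) (y : Fin N → ℂ) : eval (act π y) p = eval y p := by
  have hinj : Function.Injective fun j : Fin N => (π.symm (j, 1)).1 := by
    intro i j hij
    rcases eq_or_eq_ng hij with h | h
    · exact congrArg Prod.fst (π.symm.injective h)
    · rw [← hπ.symm] at h
      exact congrArg Prod.fst (π.symm.injective h)
  let σ : Equiv.Perm (Fin N) := Equiv.ofBijective _ (Finite.injective_iff_bijective.1 hinj)
  conv_rhs => rw [← hp.signedHom_eq σ fun j => (π.symm (j, 1)).2]
  have : (aeval y).comp (signedHom σ fun j => (π.symm (j, 1)).2) = aeval (act π y) := by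
    rw [signedHom, comp_aeval]
    congr 1
    funext j
    simp [act, co, sg, σ]
  exact (DFunLike.congr_fun this p).symm

open Sg in
lemma BInv.qe {m1 m2 m3 : ℕ} {p : MvPolynomial (Fin N) ℂ} (hp : BInv p) : QE m1 m2 m3 p :=
  .of_invariant fun _ hπ y => hp.eval_act hπ y

/-- A polynomial with trivial stabilizer. -/
def genericForm (N : ℕ) : MvPolynomial (Fin N) ℂ := ∑ j : Fin N, C ((j : ℂ) + 1) * X j

lemma signedHom_genericForm_injective : Function.Injective
    fun w : Equiv.Perm (Fin N) × (Fin N → ℤˣ) => signedHom w.1 w.2 (genericForm N) := by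
  have hev : ∀ (σ : Equiv.Perm (Fin N)) (ε : Fin N → ℤˣ) (i : Fin N),
      eval (Pi.single (σ i) 1) (signedHom σ ε (genericForm N)) =
        (((((i : ℕ) : ℤ) + 1) * (ε i : ℤ) : ℤ) : ℂ) := by
    intro σ ε i
    rw [genericForm, map_sum, map_sum, Finset.sum_eq_single i]
    · simp [signedHom]
    · intro j _ hj
      have : σ j ≠ σ i := fun h => hj (σ.injective h)
      simp [signedHom, this]
    · simp
  rintro ⟨σ, ε⟩ ⟨σ', ε'⟩ h
  have key : ∀ i, σ i = σ' i ∧ ε i = ε' i := by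
    intro i
    obtain ⟨j, hj⟩ := σ'.surjective (σ i)
    have h1 := congrArg (eval (Pi.single (σ i) 1)) h
    simp only at h1
    rw [hev, ← hj, hev, Int.cast_inj] at h1
    have h2 : i = j ∧ ε i = ε' j := by
      rcases Int.units_eq_one_or (ε i) with e | e <;> rcases Int.units_eq_one_or (ε' j) with e' | e' <;>
        rw [e, e'] at h1 ⊢ <;> simp at h1 <;> first
          | exact ⟨Fin.ext (by omega), rfl⟩
          | omega
    obtain ⟨rfl, h3⟩ := h2
    exact ⟨hj.symm, h3⟩
  exact Prod.ext (Equiv.ext fun i => (key i).1) (funext fun i => (key i).2)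

lemma card_signedPerm : Fintype.card (Equiv.Perm (Fin N) × (Fin N → ℤˣ)) = 2 ^ N * N.factorial := by
  rw [Fintype.card_prod, Fintype.card_perm, Fintype.card_fin, Fintype.card_fun, Fintype.card_units_int,
    Fintype.card_fin, mul_comm]

lemma linearIndependent_genericForm {q : MvPolynomial (Fin N) ℂ} (hq : q ≠ 0) :
    LinearIndependent (invariantSubalgebra N)
      fun k : Fin (2 ^ N * N.factorial) => q * genericForm N ^ (k : ℕ) := by
  rw [Fintype.linearIndependent_iff]
  intro c hc
  let E : Fin (2 ^ N * N.factorial) ≃ Equiv.Perm (Fin N) × (Fin N → ℤˣ) :=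
    (Fintype.equivFinOfCardEq card_signedPerm).symm
  have h0 : ∑ k, (c k : MvPolynomial (Fin N) ℂ) * genericForm N ^ (k : ℕ) = 0 := by
    apply mul_left_cancel₀ hq
    rw [mul_zero, Finset.mul_sum, ← hc]
    refine Finset.sum_congr rfl fun k _ => ?_
    rw [Algebra.smul_def, mul_left_comm]; rfl
  have h1 := Matrix.eq_zero_of_forall_index_sum_mul_pow_eq_zero
    (f := fun j => signedHom (E j).1 (E j).2 (genericForm N))
    (v := fun k => (c k : MvPolynomial (Fin N) ℂ)) (signedHom_genericForm_injective.comp E.injective)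
    fun j => by
      have h2 := congrArg (signedHom (E j).1 (E j).2) h0
      rw [map_sum, map_zero] at h2
      rw [← h2]
      refine Finset.sum_congr rfl fun k _ => ?_
      rw [map_mul, map_pow, BInv.signedHom_eq (c k).2]
  exact fun k => Subtype.ext (congrFun h1 k)

end Invariants

open Sg in
/-- The pairing defined by the Gaussian integral on leading terms of quasi-invariants. -/
def gaussPairing (N m1 m2 m3 : ℕ) : GradedPairing N (Sg N) (LR N) where
  Z := data N (m1 + m2) m3
  I := gaussI N
  gaussian := gaussI_isGaussian _ _
  τ := tau N (m1 + m2) m3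
  τ_inj := tau_injective
  piece := piece N m1 m2 m3
  piece_le := piece_le
  pow := powP N
  pow_mul_mem _ _ _ _ h := powP_mul_mem_piece h
  psum_mul_τ k q _ := psum_mul_tau k q
  ham_lt _ _ hd h := ham_piece_eq_zero hd h
  ham_mem _ _ h := ham_mem_piece h
  shift := -(data N (m1 + m2) m3).weightDeg
  euler_τ _ _ h := euler_tau (piece_le _ h)
  nondeg _ h := piece_nondeg h
  bound := 2 ^ N * N.factorial
  hol := hol N (m1 + m2) m3
  hol_fin := finiteDimensional_hol N _ _
  hol_le := finrank_hol_le N _ _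
  mem_hol _ h _ := (mem_hol _ _).2 h

open Sg in
lemma exists_qe_generators (N m1 m2 m3 : ℕ) :
    ∃ b : Fin (2 ^ N * N.factorial) → MvPolynomial (Fin N) ℂ, (∀ k, QE m1 m2 m3 (b k)) ∧
      ∀ p, QE m1 m2 m3 p → p ∈ Submodule.span (invariantSubalgebra N) (Set.range b) := by
  obtain ⟨v, δ, hv, hspan⟩ := (gaussPairing N m1 m2 m3).exists_generators
  choose b hb hlead using hv
  refine ⟨b, hb, ?_⟩
  set S := Submodule.span (invariantSubalgebra N) (Set.range b) with hS
  have hmul : ∀ c, BInv c → ∀ s ∈ S, c * s ∈ S := fun c hc s hs =>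
    S.smul_mem (⟨c, hc⟩ : invariantSubalgebra N) hs
  have hSQ : ∀ s ∈ S, QE m1 m2 m3 s := by
    intro s hs
    induction hs using Submodule.span_induction with
    | mem s hs => obtain ⟨k, rfl⟩ := hs; exact hb k
    | zero => simpa using QE.const (N := N) (m1 := m1) (m2 := m2) (m3 := m3) 0
    | add x y _ _ hx hy => exact hx.add hy
    | smul c x _ hx => exact (BInv.qe c.2).mul hx
  have hlift : ∀ d, ∀ q ∈ piece N m1 m2 m3 d, ∃ s ∈ S, HasLeading d s q := by
    intro d
    induction d using Nat.strong_induction_on with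
    | _ d ih =>
    let T : Submodule ℂ (MvPolynomial (Fin N) ℂ) :=
      { carrier := {q | ∃ s ∈ S, HasLeading d s q}
        add_mem' := fun ⟨s, hs, h⟩ ⟨s', hs', h'⟩ => ⟨s + s', add_mem hs hs', h.add h'⟩
        zero_mem' := ⟨0, zero_mem _, .of_isHomogeneous (isHomogeneous_zero _ _ _)⟩
        smul_mem' := fun c _ ⟨s, hs, h⟩ => ⟨c • s, by
          rw [smul_eq_C_mul]
          exact hmul _ ((invariantSubalgebra N).algebraMap_mem c) s hs, h.smul c⟩ }
    have hT : piece N m1 m2 m3 d ≤ T := by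
      refine (hspan d).trans (sup_le (Submodule.span_le.2 ?_) (Submodule.span_le.2 ?_))
      · rintro _ ⟨k, e, p, hp, hk, rfl, rfl⟩
        obtain ⟨s, hs, h⟩ := ih e (by omega) p hp
        refine ⟨powP N k * s, hmul _ (bInv_powP k) s hs, ?_⟩
        rw [add_comm]
        exact (HasLeading.of_isHomogeneous (powP_isHomogeneous k)).mul h
      · rintro _ ⟨i, rfl, rfl⟩
        exact ⟨b i, Submodule.subset_span ⟨i, rfl⟩, hlead i⟩
    exact hT
  have key : ∀ d, ∀ p, QE m1 m2 m3 p → p.totalDegree < d → p ∈ S := by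
    intro d
    induction d with
    | zero => intro p _ h; omega
    | succ d ih =>
      intro p hp hd
      obtain ⟨s, hs, h⟩ := hlift d _ ⟨p, hp, ⟨Nat.lt_succ_iff.1 hd, rfl⟩⟩
      have h1 := h.add ((HasLeading.mk (Nat.lt_succ_iff.1 hd) rfl).smul (-1))
      rw [neg_one_smul, neg_one_smul, add_neg_cancel] at h1
      have h2 : QE m1 m2 m3 (s + -p) := by
        simpa using (hSQ s hs).add (hp.smul (-1))
      suffices s + -p ∈ S by simpa using sub_mem hs this
      by_cases h3 : s + -p = 0
      · rw [h3]; exact zero_mem _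
      refine ih _ h2 (lt_of_le_of_ne h1.le fun h4 => ?_)
      obtain ⟨m, hm, hm'⟩ := Finset.exists_mem_eq_sup _ (support_nonempty.2 h3)
        fun m => m.sum fun _ e => e
      refine mem_support_iff.1 hm ?_
      have h5 := congrArg (coeff m) h1.top
      rwa [coeff_homogeneousComponent, if_pos (show m.degree = d from hm'.symm.trans h4), coeff_zero] at h5
  exact fun p hp => key _ p hp (Nat.lt_succ_self _)

lemma linearIndependent_of_mem_span {A V ι : Type} [CommRing A] [Nontrivial A] [AddCommGroup V]
    [Module A V] [Fintype ι] {b e : ι → V} (he : LinearIndependent A e)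
    (h : ∀ i, e i ∈ Submodule.span A (Set.range b)) : LinearIndependent A b := by
  have : Module.Finite A (Submodule.span A (Set.range b)) :=
    Module.Finite.span_of_finite _ (Set.finite_range b)
  have he' : LinearIndependent A fun i => (⟨e i, h i⟩ : Submodule.span A (Set.range b)) :=
    .of_comp (Submodule.span A (Set.range b)).subtype he
  have hb : LinearIndependent A fun i =>
      (⟨b i, Submodule.subset_span ⟨i, rfl⟩⟩ : Submodule.span A (Set.range b)) :=
    linearIndependent_of_top_le_span_of_card_le_finrank
      ((Submodule.span_range_subtype_eq_top_iff _ _).2 rfl).ge he'.fintype_card_le_finrank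
  exact hb.map' (Submodule.span A (Set.range b)).subtype (Submodule.ker_subtype _)

open Sg in
lemma exists_qe_basis (N m1 m2 m3 : ℕ) :
    ∃ b : Fin (2 ^ N * N.factorial) → MvPolynomial (Fin N) ℂ, (∀ k, QE m1 m2 m3 (b k)) ∧
      (∀ p, QE m1 m2 m3 p → p ∈ Submodule.span (invariantSubalgebra N) (Set.range b)) ∧
      LinearIndependent (invariantSubalgebra N) b := by
  obtain ⟨b, hb, hspan⟩ := exists_qe_generators N m1 m2 m3
  refine ⟨b, hb, hspan, ?_⟩
  have hcond : (conductor N (2 * (m1 + m2 + m3) + 1) : MvPolynomial (Fin N) ℂ) ≠ 0 := by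
    obtain ⟨d, h⟩ := hasLeading_conductor (N := N) (2 * (m1 + m2 + m3) + 1)
    intro h0
    have h1 := h.top
    rw [h0, map_zero] at h1
    exact pow_ne_zero _ disc_ne_zero h1.symm
  exact linearIndependent_of_mem_span (linearIndependent_genericForm hcond)
    fun k => hspan _ (QE.conductor_mul (Nat.lt_succ_self _) _)

end

/-- `Q_m^{tr}(BC_N)` is a free module of rank `2^N·N!` over the ring
`ℂ[x_1,…,x_N]^{W(B_N)}` of invariants of the hyperoctahedral group. -/
theorem stmt_17 (N : ℕ) (hN : 2 ≤ N) (m1 m2 m3 : ℕ) :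
    ∃ b : Fin (2 ^ N * Nat.factorial N) → MvPolynomial (Fin N) ℂ,
      -- the basis elements are trigonometric quasi-invariants
      (∀ k, b k ∈ QtrBC N m1 m2 m3) ∧
      -- they generate `Q_m^{tr}(BC_N)` over the invariant ring
      (∀ p ∈ QtrBC N m1 m2 m3,
        ∃ c : Fin (2 ^ N * Nat.factorial N) → MvPolynomial (Fin N) ℂ,
          (∀ k, BInv (c k)) ∧ p = ∑ k, c k * b k) ∧
      -- and they are independent over the invariant ring
      (∀ c : Fin (2 ^ N * Nat.factorial N) → MvPolynomial (Fin N) ℂ,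
        (∀ k, BInv (c k)) → (∑ k, c k * b k) = 0 → ∀ k, c k = 0) := by
  obtain ⟨b, hb, hspan, hind⟩ := exists_qe_basis N m1 m2 m3
  refine ⟨b, fun k => Sg.mem_QtrBC_iff.2 (hb k), fun p hp => ?_, fun c hc h => ?_⟩
  · obtain ⟨c, rfl⟩ := (Submodule.mem_span_range_iff_exists_fun _).1
      (hspan p (Sg.mem_QtrBC_iff.1 hp))
    exact ⟨fun k => c k, fun k => (c k).2, rfl⟩
  · have := Fintype.linearIndependent_iff.1 hind (fun k => (⟨c k, hc k⟩ : invariantSubalgebra N)) h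
    exact fun k => congrArg Subtype.val (this k)

end
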